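/- arXiv:1805.11338 — 3 statements merged into one kernel-verified Lean document; each statement's English description precedes it below -/
import Mathlib

section
/- Let g be a finite-dimensional simple Lie algebra over an algebraically closed field K of characteristic 0. The map −id_g : g → g, x ↦ −x, is a local automorphism of g; that is, for every x ∈ g there exists a Lie algebra automorphism α of g such that α(x) = −x. -/
/-- A linear map `φ : L → L` is a *local automorphism* of the Lie algebra `L` if for
every `x ∈ L` there exists a Lie algebra automorphism `e` of `L` with `φ x = e x`. -/
def IsLocalAutomorphism (K L : Type*) [Field K] [LieRing L] [LieAlgebra K L]
    (φ : L →ₗ[K] L) : Prop :=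
  ∀ x : L, ∃ e : L ≃ₗ⁅K⁆ L, φ x = e x

namespace NegIdLocalAut

open Module Module.End LieAlgebra

section Jordan

variable {K L : Type*} [Field K] [LieRing L] [LieAlgebra K L]

/-- The abstract Jordan decomposition of an element of a semisimple Lie algebra. -/
theorem exists_jordan_decomposition [IsAlgClosed K] [CharZero K] [FiniteDimensional K L]
    [IsKilling K L] (x : L) :
    ∃ s n : L, x = s + n ∧ (ad K L s).IsSemisimple ∧ IsNilpotent (ad K L n) ∧
      ad K L s ∈ Algebra.adjoin K {ad K L x} := by
  obtain ⟨N, -, S, hS₀, hN, hS, hSN⟩ := (ad K L x).exists_isNilpotent_isSemisimple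
  have hcomm : Commute (ad K L x) S := Algebra.commute_of_mem_adjoin_self hS₀
  have hN' := hN
  rw [eq_sub_of_add_eq hSN.symm] at hN'
  have aux {α : K} {y : L} (hy : y ∈ (ad K L x).maxGenEigenspace α) : S y = α • y := by
    rw [maxGenEigenspace_eq] at hy
    exact apply_eq_of_mem_of_comm_of_isFinitelySemisimple_of_isNil hy hcomm
      hS.isFinitelySemisimple hN'
  have h_der (y z : L) : S ⁅y, z⁆ = ⁅S y, z⁆ + ⁅y, S z⁆ := by
    have hy : y ∈ ⨆ α, (ad K L x).maxGenEigenspace α := by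
      simp [iSup_maxGenEigenspace_eq_top]
    have hz : z ∈ ⨆ α, (ad K L x).maxGenEigenspace α := by
      simp [iSup_maxGenEigenspace_eq_top]
    induction hy using Submodule.iSup_induction' with
    | mem α y hy =>
      induction hz using Submodule.iSup_induction' with
      | mem β z hz =>
        have hyz : ⁅y, z⁆ ∈ (ad K L x).maxGenEigenspace (α + β) :=
          LieModule.lie_mem_maxGenEigenspace_toEnd (R := K) (M := L) (x := x) hy hz
        rw [aux hy, aux hz, aux hyz, smul_lie, lie_smul, ← add_smul]
      | zero => simp
      | add _ _ _ _ h h' => simp only [lie_add, map_add, h, h']; abel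
    | zero => simp
    | add _ _ _ _ h h' => simp only [add_lie, map_add, h, h']; abel
  have h_der' : ∀ y z : L, S ⁅y, z⁆ = ⁅y, S z⁆ - ⁅z, S y⁆ := by
    intro y z
    rw [h_der, ← lie_skew (S y) z]; abel
  obtain ⟨s, hs⟩ := LieDerivation.IsKilling.exists_eq_ad (⟨S, h_der'⟩ : LieDerivation K L L)
  have hs' : ad K L s = S := by
    rw [← LieDerivation.coe_ad_apply_eq_ad_apply s, hs]
  refine ⟨s, x - s, by abel, hs' ▸ hS, ?_, hs' ▸ hS₀⟩
  rwa [map_sub, hs']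

/-- The semisimple part kills whatever the element kills, and more generally acts on its
eigenvectors by the same scalars. -/
theorem lie_eq_smul_of_mem_adjoin_of_isNilpotent {x s : L} (hs : (ad K L s).IsSemisimple)
    (hn : IsNilpotent (ad K L (x - s))) (hmem : ad K L s ∈ Algebra.adjoin K {ad K L x})
    {y : L} {c : K} (h : ⁅x, y⁆ = c • y) : ⁅s, y⁆ = c • y := by
  have hcomm : Commute (ad K L x) (ad K L s) := Algebra.commute_of_mem_adjoin_self hmem
  have hy : y ∈ (ad K L x).eigenspace c := by simpa [Module.End.mem_eigenspace_iff] using h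
  rw [map_sub] at hn
  simpa using apply_eq_of_mem_of_comm_of_isFinitelySemisimple_of_isNil
    (m := y) (μ := c) (k := 1) hy hcomm hs.isFinitelySemisimple hn

theorem exists_pow_sub_apply_eq_zero_of_lie_eq_smul {x s : L}
    (hn : IsNilpotent (ad K L (x - s))) (hmem : ad K L s ∈ Algebra.adjoin K {ad K L x})
    {y : L} {c : K} (h : ⁅s, y⁆ = c • y) : ∃ k : ℕ, ((ad K L x - c • (1 : End K L)) ^ k) y = 0 := by
  have hcomm : Commute (ad K L x) (ad K L s) := Algebra.commute_of_mem_adjoin_self hmem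
  obtain ⟨k, hk⟩ := hn
  refine ⟨k + 1, ?_⟩
  have e : ad K L x - c • (1 : End K L) = ad K L (x - s) + (ad K L s - c • (1 : End K L)) := by
    rw [map_sub]; abel
  have hc : Commute (ad K L (x - s)) (ad K L s - c • (1 : End K L)) := by
    rw [map_sub]
    exact ((hcomm.sub_left (Commute.refl _)).sub_right ((Commute.one_right _).smul_right c))
  have h0 : (ad K L s - c • (1 : End K L)) y = 0 := by simp [h]
  have key : ∀ j, (ad K L x - c • (1 : End K L)) ^ j • y = (ad K L (x - s)) ^ j • y := by
    intro j
    induction j with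
    | zero => simp
    | succ j ih =>
      rw [pow_succ', mul_smul, ih, e, add_smul, pow_succ', mul_smul]
      have : (ad K L s - c • (1 : End K L)) • (ad K L (x - s)) ^ j • y = 0 := by
        rw [← mul_smul, ← (hc.pow_left j).eq, mul_smul]
        simp only [Module.End.smul_def] at h0 ⊢
        rw [h0, map_zero]
      rw [this, add_zero]
  have := key (k + 1)
  rw [pow_succ' (ad K L (x - s)), hk, mul_zero, zero_smul] at this
  exact this

end Jordan

section EndLemmas

variable {K V : Type*} [Field K] [AddCommGroup V] [Module K V]

/-- Projecting to the kernel of a semisimple endomorphism. -/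
theorem exists_ker_component [FiniteDimensional K V] {T : End K V} (hT : T.IsSemisimple) (a : V) :
    ∃ a', T a' = 0 ∧ ∀ (E : End K V) (μ : K), T * E = E * T + μ • E →
      T (E a) = μ • E a → E a = E a' := by
  obtain ⟨a', ha', w, hw, rfl⟩ : ∃ a', T a' = 0 ∧ ∃ w, (∃ c, T c = w) ∧ a = a' + w := by
    have hp : LinearMap.ker T ∈ T.invtSubmodule := by
      intro x hx
      simp only [LinearMap.mem_ker] at hx
      simp [hx]
    obtain ⟨q, hq, hpq⟩ := (Module.End.isSemisimple_iff.mp hT) _ hp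
    obtain ⟨y, hy, z, hz, rfl⟩ := Submodule.mem_sup.mp
      (show a ∈ LinearMap.ker T ⊔ q by rw [hpq.sup_eq_top]; trivial)
    refine ⟨y, hy, z, ?_, rfl⟩
    have hinj : Function.Injective (T.restrict hq) := by
      rw [← LinearMap.ker_eq_bot, LinearMap.ker_eq_bot']
      intro m hm
      have h1 : (m : V) ∈ LinearMap.ker T := congrArg Subtype.val hm
      have := (Submodule.disjoint_def.mp hpq.disjoint) m h1 m.2
      exact Subtype.ext this
    obtain ⟨c, hc⟩ := (LinearMap.injective_iff_surjective.mp hinj) ⟨z, hz⟩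
    exact ⟨c, congrArg Subtype.val hc⟩
  obtain ⟨c, rfl⟩ := hw
  refine ⟨a', ha', fun E μ hE h ↦ ?_⟩
  have hE' : ∀ v, T (E v) = E (T v) + μ • E v := fun v ↦ by
    simpa using LinearMap.congr_fun hE v
  have h1 : T (E a') = μ • E a' := by rw [hE', ha']; simp
  have h2 : E (T c) = T (E c) - μ • E c := by rw [hE']; simp
  have h3 : E c ∈ T.genEigenspace μ 2 := by
    rw [show (2 : ℕ∞) = (2 : ℕ) from rfl, mem_genEigenspace_nat, LinearMap.mem_ker, pow_two]
    have : (T - μ • (1 : End K V)) (E c) = E (T c) := by simp [h2]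
    rw [Module.End.mul_apply, this]
    have : T (E (T c)) = μ • E (T c) := by
      rw [map_add, map_add, h1, smul_add] at h
      exact add_left_cancel h
    simp [this]
  have h4 := hT.isFinitelySemisimple.genEigenspace_eq_eigenspace μ (k := 2) (by norm_num) ▸ h3
  rw [mem_eigenspace_iff] at h4
  rw [map_add, h2, h4, sub_self, add_zero]

theorem pow_mul_of_commute_lie {M W C : End K V} (hC : M * W - W * M = C) (hMC : M * C = C * M)
    (i : ℕ) : M ^ (i + 1) * W = W * M ^ (i + 1) + (i + 1 : K) • (C * M ^ i) := by
  have h1 : M * W = W * M + C := by rw [← hC]; abel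
  induction i with
  | zero => simp [h1]
  | succ i ih =>
    rw [pow_succ' M (i + 1), mul_assoc, ih, mul_add, ← mul_assoc, h1, mul_smul_comm, ← mul_assoc M C,
      hMC, add_mul, mul_assoc, mul_assoc C M, ← pow_succ' M i,
      ← pow_succ' M (i + 1)]
    push_cast
    module

theorem isNilpotent_commutator [CharZero K] {M W C : End K V} (hC : M * W - W * M = C)
    (hMC : M * C = C * M) (hM : IsNilpotent M) : IsNilpotent C := by
  obtain ⟨D, hD, hDapp⟩ : ∃ D : End K (End K V), IsNilpotent D ∧ ∀ X, D X = M * X - X * M := by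
    refine ⟨LinearMap.mulLeft K M - LinearMap.mulRight K M, ?_, fun X ↦ rfl⟩
    refine (LinearMap.commute_mulLeft_right M M).isNilpotent_sub ?_ ?_
    · rwa [LinearMap.isNilpotent_mulLeft_iff]
    · rwa [LinearMap.isNilpotent_mulRight_iff]
  have leib : ∀ (Y : End K V) (j : ℕ),
      (D ^ (j + 1)) (W * Y) = W * (D ^ (j + 1)) Y + (j + 1 : K) • (C * (D ^ j) Y) := by
    have hDW : ∀ X, D (W * X) = W * D X + C * X := fun X ↦ by
      rw [hDapp, hDapp, ← hC]; noncomm_ring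
    have hDC : ∀ X, D (C * X) = C * D X := fun X ↦ by
      rw [hDapp, hDapp, mul_sub, ← mul_assoc, hMC]; noncomm_ring
    intro Y j
    induction j with
    | zero => simp [hDW]
    | succ j ih =>
      rw [pow_succ' D (j + 1), Module.End.mul_apply, ih, map_add, map_smul, hDW, hDC,
        ← Module.End.mul_apply, ← pow_succ', ← Module.End.mul_apply D,
        ← pow_succ']
      push_cast
      module
  have key : ∀ k : ℕ, (D ^ (k + 1)) (W ^ k) = 0 ∧ (D ^ k) (W ^ k) = (k.factorial : K) • C ^ k := by
    intro k
    induction k with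
    | zero => simp [hDapp]
    | succ k ih =>
      constructor
      · rw [pow_succ' W, leib, pow_succ' D (k + 1), Module.End.mul_apply, ih.1]
        simp
      · rw [pow_succ' W, leib, ih.1, ih.2, pow_succ' C, Nat.factorial_succ]
        simp only [mul_zero, zero_add, mul_smul_comm, smul_smul]
        push_cast
        ring_nf
  obtain ⟨k, hk⟩ := hD
  refine ⟨k, ?_⟩
  have := (key k).2
  rw [hk] at this
  simpa [Nat.factorial_ne_zero] using this.symm

theorem trace_mul_eq_zero_of_commute_lie [FiniteDimensional K V] [CharZero K] [IsAlgClosed K]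
    {M W C : End K V} (hC : M * W - W * M = C)
    (hMC : M * C = C * M) (hM : IsNilpotent M) : LinearMap.trace K V (W * M) = 0 := by
  rw [Module.End.trace_eq_sum_roots_charpoly_of_splits (IsAlgClosed.splits _)]
  refine Multiset.sum_eq_zero fun μ hμ ↦ ?_
  have hev : (W * M).HasEigenvalue μ :=
    (hasEigenvalue_iff_isRoot_charpoly _ _).mpr (Polynomial.isRoot_of_mem_roots hμ)
  obtain ⟨v, hv⟩ := hev.exists_hasEigenvector
  have hv1 : W (M v) = μ • v := hv.apply_eq_smul
  have hex : ∃ i, (M ^ i) v = 0 := hM.imp fun i hi ↦ by simp [hi]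
  classical
  have hi := Nat.find_spec hex
  rcases hfi : Nat.find hex with _ | j
  · rw [hfi] at hi
    exact absurd (by simpa using hi) hv.2
  rw [hfi] at hi
  have hj : (M ^ j) v ≠ 0 := Nat.find_min hex (by omega)
  by_contra hμ0
  have key : ((j : K) • C) ((M ^ j) v) = μ • (M ^ j) v := by
    rw [← map_smul, ← hv1]
    rcases j with _ | j
    · simp only [Nat.cast_zero, zero_smul, LinearMap.zero_apply]
      simp only [zero_add, pow_one] at hi
      simp [hi]
    · have := LinearMap.congr_fun (pow_mul_of_commute_lie hC hMC j) (M v)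
      simp only [Module.End.mul_apply, LinearMap.add_apply, LinearMap.smul_apply] at this
      rw [this, ← Module.End.mul_apply (M ^ j), ← pow_succ, ← Module.End.mul_apply (M ^ (j + 1)),
        ← pow_succ, hi]
      simp
  obtain ⟨k, hk⟩ : IsNilpotent ((j : K) • C) := (isNilpotent_commutator hC hMC hM).smul _
  have : ∀ k, (((j : K) • C) ^ k) ((M ^ j) v) = μ ^ k • (M ^ j) v := by
    intro k
    induction k with
    | zero => simp
    | succ k ih => rw [pow_succ', Module.End.mul_apply, ih, map_smul, key, smul_smul, pow_succ]
  have h2 := this k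
  rw [hk, LinearMap.zero_apply] at h2
  exact (smul_ne_zero (pow_ne_zero k hμ0) hj) h2.symm

variable {E H Z : End K V}

theorem mul_pow_of_weight (hHE : H * E - E * H = (2 : K) • E) (i : ℕ) :
    H * E ^ i = E ^ i * H + (2 * i : K) • E ^ i := by
  have h1 : H * E = E * H + (2 : K) • E := by rw [← hHE]; abel
  induction i with
  | zero => simp
  | succ i ih =>
    rw [pow_succ, ← mul_assoc, ih, add_mul, mul_assoc, h1, mul_add, smul_mul_assoc, ← mul_assoc,
      mul_smul_comm]
    push_cast
    module

theorem pow_mul_of_sl2 (hHE : H * E - E * H = (2 : K) • E) (hEZ : E * Z - Z * E = H) (i : ℕ) :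
    E ^ (i + 1) * Z = Z * E ^ (i + 1) + (i + 1 : K) • (E ^ i * (H + (i : K) • 1)) := by
  have h1 : E * Z = Z * E + H := by rw [← hEZ]; abel
  have h2 : H * E = E * H + (2 : K) • E := by rw [← hHE]; abel
  induction i with
  | zero => simp [h1]
  | succ i ih =>
    have h3 := mul_pow_of_weight hHE (i + 1)
    rw [pow_succ' E (i + 1), mul_assoc, ih, mul_add, ← mul_assoc, h1, add_mul, h3, mul_smul_comm,
      ← mul_assoc E, ← pow_succ', mul_assoc Z]
    push_cast
    simp only [mul_add, mul_smul_comm, mul_one]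
    module

/-- Highest weights are natural numbers, with only one raising operator assumed nilpotent. -/
theorem exists_nat_of_primitive [CharZero K] (hHE : H * E - E * H = (2 : K) • E)
    (hEZ : E * Z - Z * E = H) (hE : IsNilpotent E) {b : V} {μ : K} (hb : b ≠ 0) (hEb : E b = 0)
    (hHb : H b = μ • b) : ∃ m : ℕ, μ = m := by
  by_contra! hμ
  have key : ∀ i : ℕ, ∃ a, (E ^ i) a = b := by
    intro i
    induction i with
    | zero => exact ⟨b, by simp⟩
    | succ i ih =>
      obtain ⟨a, ha⟩ := ih
      have h1 := LinearMap.congr_fun (pow_mul_of_sl2 hHE hEZ i) a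
      have h2 := LinearMap.congr_fun (mul_pow_of_weight hHE i) a
      have h3 : (E ^ (i + 1)) a = 0 := by rw [pow_succ', Module.End.mul_apply, ha, hEb]
      simp only [Module.End.mul_apply, LinearMap.add_apply, LinearMap.smul_apply, h3, map_zero,
        zero_add, Module.End.one_apply, map_add, map_smul, ha, hHb] at h1 h2
      have h4 : (E ^ (i + 1)) (Z a) = ((i + 1 : K) * (μ - i)) • b := by
        rw [h1, eq_sub_of_add_eq h2.symm]; module
      have h5 : ((i + 1 : K) * (μ - i)) ≠ 0 :=
        mul_ne_zero (by exact_mod_cast Nat.succ_ne_zero i) (sub_ne_zero.mpr (hμ i))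
      refine ⟨((i + 1 : K) * (μ - i))⁻¹ • Z a, ?_⟩
      rw [map_smul, h4, smul_smul, inv_mul_cancel₀ h5, one_smul]
  obtain ⟨k, hk⟩ := hE
  obtain ⟨a, ha⟩ := key k
  rw [hk] at ha
  exact hb ha.symm

theorem mem_of_pow_sub_apply_eq_zero {U : Submodule K V} (hU : ∀ u ∈ U, H u ∈ U) {μ ν : K}
    (hμν : μ ≠ ν) {v : V} {k : ℕ} (hk : ((H - μ • (1 : End K V)) ^ k) v = 0)
    (hv : H v - ν • v ∈ U) : v ∈ U := by
  have key : ∀ j : ℕ, ((H - μ • (1 : End K V)) ^ j) v - (ν - μ) ^ j • v ∈ U := by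
    intro j
    induction j with
    | zero => simp
    | succ j ih =>
      rw [pow_succ', Module.End.mul_apply]
      set w := ((H - μ • (1 : End K V)) ^ j) v
      have h1 : (H - μ • (1 : End K V)) w - (ν - μ) ^ (j + 1) • v =
          (H (w - (ν - μ) ^ j • v) - μ • (w - (ν - μ) ^ j • v)) +
            (ν - μ) ^ j • (H v - ν • v) := by
        simp only [LinearMap.sub_apply, LinearMap.smul_apply, Module.End.one_apply, map_sub,
          map_smul]
        rw [pow_succ]
        module
      rw [h1]
      exact U.add_mem (U.sub_mem (hU _ ih) (U.smul_mem _ ih)) (U.smul_mem _ hv)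
  have := key k
  rw [hk, zero_sub, neg_mem_iff] at this
  exact (U.smul_mem_iff (pow_ne_zero k (sub_ne_zero.mpr hμν.symm))).mp this

/-- The weight two part is in the range of the raising operator. -/
theorem exists_apply_eq_of_weight_two [CharZero K] (hHE : H * E - E * H = (2 : K) • E)
    (hEZ : E * Z - Z * E = H) (hHZ : H * Z - Z * H = (-2 : K) • Z) (hE : IsNilpotent E) {v : V}
    {k : ℕ} (hv : ((H - (2 : K) • (1 : End K V)) ^ k) v = 0) : ∃ a, E a = v := by
  have hcomm : Commute (H - (2 : K) • (1 : End K V)) (E * Z) := by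
    have h1 : H * E = E * H + (2 : K) • E := by rw [← hHE]; abel
    have h2 : H * Z = Z * H + (-2 : K) • Z := by rw [← hHZ]; abel
    have : H * (E * Z) = E * Z * H := by
      rw [← mul_assoc, h1, add_mul, mul_assoc, h2, mul_add, mul_smul_comm, smul_mul_assoc,
        ← mul_assoc]
      module
    exact Commute.sub_left this ((Commute.one_left _).smul_left _)
  have hrange : ∀ u ∈ LinearMap.range E, H u ∈ LinearMap.range E := by
    rintro _ ⟨a, rfl⟩
    have := LinearMap.congr_fun hHE a
    simp only [LinearMap.sub_apply, Module.End.mul_apply, LinearMap.smul_apply] at this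
    exact ⟨H a + (2 : K) • a, by rw [map_add, map_smul, ← this]; abel⟩
  have key : ∀ (i : ℕ) (v : V), ((H - (2 : K) • (1 : End K V)) ^ k) v = 0 → (E ^ i) v = 0 →
      v ∈ LinearMap.range E := by
    intro i
    induction i with
    | zero => intro v _ h; simp only [pow_zero, Module.End.one_apply] at h; simp [h]
    | succ i ih =>
      intro v hv hi
      have h1 := LinearMap.congr_fun (pow_mul_of_sl2 hHE hEZ i) v
      simp only [Module.End.mul_apply, LinearMap.add_apply, LinearMap.smul_apply, hi, map_zero,
        zero_add, Module.End.one_apply] at h1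
      have h2 : (i + 1 : K) • (H v + (i : K) • v) - E (Z v) ∈ LinearMap.range E := by
        apply ih
        · have hc1 : Commute ((H - (2 : K) • (1 : End K V)) ^ k) H :=
            (Commute.sub_left (Commute.refl H) ((Commute.one_left _).smul_left _)).pow_left k
          have h3 : ((H - (2 : K) • (1 : End K V)) ^ k) (H v) = 0 := by
            rw [← Module.End.mul_apply, hc1.eq, Module.End.mul_apply, hv, map_zero]
          have h4 : ((H - (2 : K) • (1 : End K V)) ^ k) (E (Z v)) = 0 := by
            rw [← Module.End.mul_apply E, ← Module.End.mul_apply, (hcomm.pow_left k).eq,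
              Module.End.mul_apply, hv, map_zero]
          simp [h3, h4, hv]
        · rw [map_sub, map_smul, ← h1, pow_succ, Module.End.mul_apply, sub_self]
      have h5 : (i + 1 : K) ≠ 0 := by exact_mod_cast Nat.succ_ne_zero i
      have h6 : H v + (i : K) • v ∈ LinearMap.range E := by
        have := Submodule.add_mem _ h2 (LinearMap.mem_range_self E (Z v))
        rw [sub_add_cancel] at this
        exact (Submodule.smul_mem_iff _ h5).mp this
      refine mem_of_pow_sub_apply_eq_zero (μ := 2) (ν := -i) hrange ?_ hv ?_
      · intro h
        have : ((2 + i : ℕ) : K) = 0 := by push_cast; rw [h]; ring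
        exact absurd (Nat.cast_eq_zero.mp this) (by omega)
      · rwa [neg_smul, sub_neg_eq_add]
  obtain ⟨i, hi⟩ := hE
  exact key i v hv (by simp [hi])

end EndLemmas

section Sl2

variable {K L : Type*} [Field K] [LieRing L] [LieAlgebra K L]

theorem ad_mul_ad (x y : L) : ad K L x * ad K L y = ad K L y * ad K L x + ad K L ⁅x, y⁆ := by
  ext z
  simp

theorem ad_mul_ad_of_lie_eq_smul {x y : L} {c : K} (h : ⁅x, y⁆ = c • y) :
    ad K L x * ad K L y = ad K L y * ad K L x + c • ad K L y := by
  rw [ad_mul_ad, h, map_smul]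

theorem ad_mul_ad_of_lie_eq_zero {x y : L} (h : ⁅x, y⁆ = 0) :
    ad K L x * ad K L y = ad K L y * ad K L x + (0 : K) • ad K L y := by
  rw [ad_mul_ad, h, map_zero, zero_smul]

theorem isNilpotent_of_commutator_eq_smul {V : Type*} [AddCommGroup V] [Module K V]
    [FiniteDimensional K V] [CharZero K] {H Z : End K V} {c : K} (hc : c ≠ 0)
    (h : H * Z - Z * H = c • Z) : IsNilpotent Z := by
  by_contra hZ
  let D : End K (End K V) := LinearMap.mulLeft K H - LinearMap.mulRight K H
  have hD : ∀ X, D X = H * X - X * H := fun _ ↦ rfl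
  have h1 : H * Z = Z * H + c • Z := by rw [← h]; abel
  have key : ∀ k : ℕ, D (Z ^ k) = (k * c) • Z ^ k := by
    intro k
    induction k with
    | zero => simp [hD]
    | succ k ih =>
      rw [hD, sub_eq_iff_eq_add] at ih
      rw [hD, pow_succ, ← mul_assoc, ih, add_mul, mul_assoc (Z ^ k) H, h1, mul_add,
        smul_mul_assoc, mul_smul_comm, ← mul_assoc]
      push_cast
      module
  have hfin := D.finite_hasEigenvalue
  refine Set.infinite_of_injective_forall_mem (f := fun k : ℕ ↦ (k : K) * c) ?_ ?_ hfin
  · intro a b hab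
    exact Nat.cast_injective (mul_right_cancel₀ hc hab)
  · intro k
    exact Module.End.hasEigenvalue_of_hasEigenvector (x := Z ^ k)
      ⟨mem_eigenspace_iff.mpr (key k), fun h0 ↦ hZ ⟨k, h0⟩⟩

theorem exists_lie_lie_eq [IsAlgClosed K] [CharZero K] [FiniteDimensional K L] [IsKilling K L]
    {n : L} (hn : IsNilpotent (ad K L n)) : ∃ z, ⁅n, ⁅n, z⁆⁆ = n := by
  by_contra hne
  have hnot : n ∉ LinearMap.range (ad K L n * ad K L n) := by
    rintro ⟨z, hz⟩
    exact hne ⟨z, by simpa using hz⟩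
  obtain ⟨φ, hφ, hle⟩ := Submodule.exists_le_ker_of_notMem hnot
  set w := (LinearMap.BilinForm.toDual (killingForm K L)
    (IsKilling.killingForm_nondegenerate K L)).symm φ with hw
  have hφw : ∀ x, φ x = killingForm K L w x := fun x ↦ by
    rw [← LinearMap.BilinForm.toDual_def (IsKilling.killingForm_nondegenerate K L), hw,
      LinearEquiv.apply_symm_apply]
  have h1 : ⁅n, ⁅n, w⁆⁆ = 0 := by
    refine (IsKilling.killingForm_nondegenerate K L).1 _ fun y ↦ ?_
    have h2 : φ ⁅n, ⁅n, y⁆⁆ = 0 := hle ⟨y, by simp⟩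
    rw [hφw, ← neg_eq_zero, ← LieModule.traceForm_apply_lie_apply',
      ← neg_eq_zero, ← LieModule.traceForm_apply_lie_apply'] at h2
    exact h2
  apply hφ
  rw [hφw, killingForm_apply_apply]
  refine trace_mul_eq_zero_of_commute_lie (C := ad K L ⁅n, w⁆) ?_ ?_ hn
  · rw [ad_mul_ad]; abel
  · rw [ad_mul_ad, h1]; simp

/-- A nilpotent element embeds in an `sl₂`-triple commuting with a given semisimple element which
commutes with it. -/
theorem exists_sl2_of_isNilpotent [IsAlgClosed K] [CharZero K] [FiniteDimensional K L]
    [IsKilling K L] {s n : L} (hs : (ad K L s).IsSemisimple) (hn : IsNilpotent (ad K L n))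
    (hsn : ⁅s, n⁆ = 0) : ∃ h f : L, ⁅n, f⁆ = h ∧ ⁅h, n⁆ = (2 : K) • n ∧ ⁅h, f⁆ = (-2 : K) • f ∧
      ⁅s, h⁆ = 0 ∧ ⁅s, f⁆ = 0 := by
  obtain ⟨z₀, hz₀⟩ := exists_lie_lie_eq hn
  obtain ⟨z₁, hsz₁, hz₁⟩ := exists_ker_component hs z₀
  have hsn' := ad_mul_ad_of_lie_eq_zero (K := K) hsn
  have hnz₁ : ⁅n, ⁅n, z₁⁆⁆ = n := by
    have := hz₁ (ad K L n * ad K L n) 0 (by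
      rw [zero_smul, add_zero] at hsn' ⊢
      rw [← mul_assoc, hsn', mul_assoc, hsn', mul_assoc]) (by simp [hz₀, hsn])
    simpa [hz₀] using this.symm
  obtain ⟨z, hz⟩ : ∃ z, z = (-2 : K) • z₁ := ⟨_, rfl⟩
  have hsz : ⁅s, z⁆ = 0 := by
    simp only [ad_apply] at hsz₁
    rw [hz, lie_smul, hsz₁, smul_zero]
  obtain ⟨h, hh⟩ : ∃ h, ⁅n, z⁆ = h := ⟨_, rfl⟩
  have hhn : ⁅h, n⁆ = (2 : K) • n := by
    rw [← lie_skew, ← hh, hz, lie_smul, lie_smul, hnz₁]; module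
  have hsh : ⁅s, h⁆ = 0 := by rw [← hh, leibniz_lie, hsn, hsz]; simp
  have hHE : ad K L h * ad K L n - ad K L n * ad K L h = (2 : K) • ad K L n := by
    rw [ad_mul_ad_of_lie_eq_smul hhn]; abel
  have hEZ : ad K L n * ad K L z - ad K L z * ad K L n = ad K L h := by
    rw [ad_mul_ad, hh]; abel
  have hmaps : ∀ x ∈ LinearMap.ker (ad K L n), (ad K L h + (2 : K) • 1) x ∈
      LinearMap.ker (ad K L n) := by
    intro x hx
    simp only [LinearMap.mem_ker, ad_apply] at hx
    simp only [LinearMap.mem_ker, ad_apply, LinearMap.add_apply, LinearMap.smul_apply,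
      Module.End.one_apply, lie_add, lie_smul, hx, smul_zero, add_zero]
    rw [leibniz_lie, hx, ← lie_skew n h, hhn]
    simp [hx]
  have hinj : Function.Injective ((ad K L h + (2 : K) • 1).restrict hmaps) := by
    rw [← LinearMap.ker_eq_bot, LinearMap.ker_eq_bot']
    intro m hm
    by_contra hm0
    have h1 : (ad K L h + (2 : K) • 1) (m : L) = 0 := congrArg Subtype.val hm
    obtain ⟨k, hk⟩ := exists_nat_of_primitive hHE hEZ hn (b := (m : L)) (μ := -2)
      (by simpa using hm0) m.2 (by
        simp only [LinearMap.add_apply, LinearMap.smul_apply, Module.End.one_apply] at h1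
        rw [eq_neg_of_add_eq_zero_left h1, neg_smul])
    have : ((k + 2 : ℕ) : K) = 0 := by push_cast; rw [← hk]; ring
    exact absurd (Nat.cast_eq_zero.mp this) (by omega)
  have hker : ⁅h, z⁆ + (2 : K) • z ∈ LinearMap.ker (ad K L n) := by
    simp only [LinearMap.mem_ker, ad_apply, lie_add, lie_smul]
    rw [leibniz_lie, ← lie_skew n h, hhn, hh]
    simp [hh]
  obtain ⟨w, hw⟩ := (LinearMap.injective_iff_surjective.mp hinj) ⟨_, hker⟩
  have hw1 : ⁅h, (w : L)⁆ + (2 : K) • (w : L) = ⁅h, z⁆ + (2 : K) • z := congrArg Subtype.val hw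
  have hnw : ⁅n, (w : L)⁆ = 0 := w.2
  obtain ⟨f₀, hf₀⟩ : ∃ f₀, f₀ = z - (w : L) := ⟨_, rfl⟩
  have hnf₀ : ⁅n, f₀⁆ = h := by rw [hf₀, lie_sub, hnw, hh, sub_zero]
  have hhf₀ : ⁅h, f₀⁆ + (2 : K) • f₀ = 0 := by
    rw [hf₀, lie_sub, smul_sub, sub_add_sub_comm, hw1, sub_self]
  obtain ⟨f, hsf, hf⟩ := exists_ker_component hs f₀
  have hnf : ⁅n, f⁆ = h := by
    have := hf (ad K L n) 0 hsn' (by simp [hnf₀, hsh])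
    simpa [hnf₀] using this.symm
  have hhf : ⁅h, f⁆ + (2 : K) • f = 0 := by
    have := hf (ad K L h + (2 : K) • 1) 0 (by
      have := ad_mul_ad_of_lie_eq_zero (K := K) hsh
      rw [zero_smul, add_zero] at this ⊢
      simp [mul_add, add_mul, this]) (by simp [hhf₀])
    simpa [hhf₀] using this.symm
  refine ⟨h, f, hnf, hhn, ?_, hsh, by simpa using hsf⟩
  rw [neg_smul]
  exact eq_neg_of_add_eq_zero_left hhf

/-- For an `sl₂`-triple `(e, h, f)` commuting with `s`, the element `e` maps the weight zero part of
the centralizer of `s` onto the weight two part. -/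
theorem exists_lie_eq_of_weight_two [CharZero K] [FiniteDimensional K L]
    {s e h f h' : L} (hef : ⁅e, f⁆ = h) (hhe : ⁅h, e⁆ = (2 : K) • e) (hhf : ⁅h, f⁆ = (-2 : K) • f)
    (hs : (ad K L s).IsSemisimple) (hse : ⁅s, e⁆ = 0) (hsh' : ⁅s, h'⁆ = 0)
    (hh' : (ad K L h').IsSemisimple)
    (hn : IsNilpotent (ad K L (h - h'))) (hmem : ad K L h' ∈ Algebra.adjoin K {ad K L h})
    {y : L} (hsy : ⁅s, y⁆ = 0) (hy : ⁅h', y⁆ = (2 : K) • y) :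
    ∃ a, ⁅s, a⁆ = 0 ∧ ⁅h', a⁆ = 0 ∧ ⁅e, a⁆ = y := by
  have hHE : ad K L h * ad K L e - ad K L e * ad K L h = (2 : K) • ad K L e := by
    rw [ad_mul_ad_of_lie_eq_smul hhe]; abel
  have hEZ : ad K L e * ad K L f - ad K L f * ad K L e = ad K L h := by
    rw [ad_mul_ad, hef]; abel
  have hHZ : ad K L h * ad K L f - ad K L f * ad K L h = (-2 : K) • ad K L f := by
    rw [ad_mul_ad_of_lie_eq_smul hhf]; abel
  have hE : IsNilpotent (ad K L e) := isNilpotent_of_commutator_eq_smul two_ne_zero hHE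
  have hh'e := lie_eq_smul_of_mem_adjoin_of_isNilpotent hh' hn hmem hhe
  obtain ⟨k, hk⟩ := exists_pow_sub_apply_eq_zero_of_lie_eq_smul hn hmem hy
  obtain ⟨a₀, ha₀⟩ := exists_apply_eq_of_weight_two hHE hEZ hHZ hE hk
  obtain ⟨a₁, hha₁, ha₁⟩ := exists_ker_component hh' a₀
  have h1 : ad K L e a₁ = y := by
    rw [← ha₁ (ad K L e) 2 (ad_mul_ad_of_lie_eq_smul hh'e) (by rw [ha₀]; simpa using hy), ha₀]
  obtain ⟨a, hsa, ha⟩ := exists_ker_component hs a₁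
  refine ⟨a, by simpa using hsa, ?_, ?_⟩
  · have := ha (ad K L h') 0 (ad_mul_ad_of_lie_eq_zero hsh') (by simp [hha₁])
    rw [hha₁] at this
    simpa using this.symm
  · have := ha (ad K L e) 0 (ad_mul_ad_of_lie_eq_zero hse) (by rw [h1]; simpa using hsy)
    rw [h1] at this
    simpa using this.symm

end Sl2

section Cartan

variable {K L : Type*} [Field K] [LieRing L] [LieAlgebra K L]

variable (K) in
/-- The centralizer of a set, as a Lie subalgebra. -/
def centralizer (S : Set L) : LieSubalgebra K L where
  carrier := {y | ∀ s ∈ S, ⁅s, y⁆ = 0}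
  add_mem' := fun ha hb s hs ↦ by rw [lie_add, ha s hs, hb s hs, add_zero]
  zero_mem' := fun s _ ↦ lie_zero s
  smul_mem' := fun c y hy s hs ↦ by rw [lie_smul, hy s hs, smul_zero]
  lie_mem' := fun {a b} ha hb s hs ↦ by rw [leibniz_lie, ha s hs, hb s hs]; simp

theorem mem_centralizer {S : Set L} {y : L} : y ∈ centralizer K S ↔ ∀ s ∈ S, ⁅s, y⁆ = 0 := Iff.rfl

/-- Commuting ad-semisimple elements lie in a common Cartan subalgebra. -/
theorem exists_isCartanSubalgebra_superset [CharZero K] [FiniteDimensional K L] {S : Set L}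
    (hS : ∀ s ∈ S, (ad K L s).IsSemisimple) (hcomm : ∀ s ∈ S, ∀ t ∈ S, ⁅s, t⁆ = 0) :
    ∃ H : LieSubalgebra K L, H.IsCartanSubalgebra ∧ ∀ s ∈ S, s ∈ H := by
  obtain ⟨c, hc⟩ := LieAlgebra.exists_isCartanSubalgebra_engel K (centralizer K S)
  set H' := LieSubalgebra.engel K c
  have hSH' : ∀ s (hs : s ∈ S), (⟨s, fun t ht ↦ hcomm t ht s hs⟩ : centralizer K S) ∈ H' := by
    intro s hs
    rw [← hc.self_normalizing, LieSubalgebra.mem_normalizer_iff]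
    intro y _
    convert H'.zero_mem
    exact Subtype.ext (y.2 s hs)
  let φ : H' →ₗ⁅K⁆ L := (centralizer K S).incl.comp H'.incl
  have hφ : Function.Injective φ := Subtype.val_injective.comp Subtype.val_injective
  have hmem : ∀ y : L, y ∈ φ.range ↔ ∃ h : y ∈ centralizer K S, ⟨y, h⟩ ∈ H' := by
    intro y
    rw [LieHom.mem_range]
    constructor
    · rintro ⟨z, rfl⟩
      exact ⟨z.1.2, z.2⟩
    · rintro ⟨h, h'⟩
      exact ⟨⟨⟨y, h⟩, h'⟩, rfl⟩
  have hSφ : ∀ s ∈ S, s ∈ φ.range := fun s hs ↦ (hmem s).mpr ⟨_, hSH' s hs⟩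
  refine ⟨φ.range, ⟨?_, ?_⟩, hSφ⟩
  · exact (LieEquiv.ofInjective φ hφ).nilpotent_iff_equiv_nilpotent.mp hc.nilpotent
  · refine le_antisymm (fun y hy ↦ ?_) (LieSubalgebra.le_normalizer _)
    rw [LieSubalgebra.mem_normalizer_iff] at hy
    have hyC : y ∈ centralizer K S := by
      intro s hs
      obtain ⟨h1, -⟩ := (hmem _).mp (hy s (hSφ s hs))
      have h2 : ⁅s, ⁅s, y⁆⁆ = 0 := by rw [← lie_skew s y, lie_neg, h1 s hs, neg_zero]
      have h3 : y ∈ (ad K L s).genEigenspace 0 2 := by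
        rw [show (2 : ℕ∞) = (2 : ℕ) from rfl, mem_genEigenspace_nat, LinearMap.mem_ker, pow_two]
        simp [h2]
      rw [(hS s hs).isFinitelySemisimple.genEigenspace_eq_eigenspace 0 (by norm_num)] at h3
      simpa using h3
    refine (hmem y).mpr ⟨hyC, ?_⟩
    rw [← hc.self_normalizing, LieSubalgebra.mem_normalizer_iff]
    intro z hz
    obtain ⟨_, h'⟩ := (hmem _).mp (hy z ((hmem _).mpr ⟨z.2, hz⟩))
    exact h'

end Cartan

section Chevalley

variable {K L : Type*} [Field K] [CharZero K] [LieRing L] [LieAlgebra K L] [FiniteDimensional K L]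
  [IsKilling K L] {H : LieSubalgebra K L} [H.IsCartanSubalgebra] [LieModule.IsTriangularizable K H L]

open LieAlgebra.IsKilling LieModule

theorem exists_lie_ne_zero_of_add {α β γ : Weight K H L} (hα : α.IsNonZero) (hβ : β.IsNonZero)
    (hadd : (γ : H → K) = α + β) {h e f : L} (t : IsSl2Triple h e f)
    (he : e ∈ rootSpace H β) (hf : f ∈ rootSpace H (-β)) : ∃ x ∈ rootSpace H α, ⁅e, x⁆ ≠ 0 := by
  obtain ⟨x, hx, hx0⟩ := α.exists_ne_zero
  refine ⟨x, hx, fun hex ↦ ?_⟩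
  have hh : h = coroot β := t.h_eq_coroot hβ he hf
  have P : t.HasPrimitiveVectorWith x (α (coroot β)) :=
    ⟨hx0, by rw [hh]; exact lie_eq_smul_of_mem_rootSpace hx (coroot β), hex⟩
  obtain ⟨m, hm⟩ := P.exists_nat
  obtain ⟨y, hy, hy0⟩ := (-γ).exists_ne_zero
  have hy' : y ∈ rootSpace H (-(γ : H → K)) := by simpa using hy
  have hey : ⁅e, y⁆ = 0 := by
    have h1 : ⁅e, y⁆ ∈ rootSpace H (-(α : H → K)) := by
      have := lie_mem_genWeightSpace_of_mem_genWeightSpace he hy'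
      rwa [hadd, neg_add_rev, add_neg_cancel_left] at this
    have h2 := mem_ker_killingForm_of_mem_rootSpace_of_forall_rootSpace_neg K L H h1 ?_
    · simpa using h2
    · intro z hz
      rw [neg_neg] at hz
      obtain ⟨c, hc⟩ := (finrank_eq_one_iff_of_nonzero' (⟨x, hx⟩ : rootSpace H α)
        (by simpa using hx0)).mp (finrank_rootSpace_eq_one α hα) ⟨z, hz⟩
      have hc' : z = c • x := (congrArg Subtype.val hc).symm
      rw [hc', map_smul, traceForm_comm, ← traceForm_apply_lie_apply, ← lie_skew, hex]
      simp
  have Q : t.HasPrimitiveVectorWith y (-(γ (coroot β))) := by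
    refine ⟨hy0, ?_, hey⟩
    rw [hh]
    exact lie_eq_smul_of_mem_rootSpace hy' (coroot β)
  obtain ⟨m', hm'⟩ := Q.exists_nat
  have h3 : (γ (coroot β) : K) = α (coroot β) + β (coroot β) := congrFun hadd (coroot β)
  rw [hm, root_apply_coroot hβ] at h3
  rw [h3] at hm'
  have : ((m' + m + 2 : ℕ) : K) = 0 := by push_cast; rw [← hm']; ring
  exact absurd this (Nat.cast_ne_zero.mpr (by lia))

theorem rootSpace_le_of_add {α β γ : Weight K H L} (hα : α.IsNonZero) (hβ : β.IsNonZero)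
    (hγ : γ.IsNonZero) (hadd : (γ : H → K) = α + β) {h e f : L} (t : IsSl2Triple h e f)
    (he : e ∈ rootSpace H β) (hf : f ∈ rootSpace H (-β)) {G : LieSubalgebra K L}
    (hαG : ∀ x ∈ rootSpace H α, x ∈ G) (heG : e ∈ G) {y : L} (hy : y ∈ rootSpace H γ) :
    y ∈ G := by
  obtain ⟨x, hx, hex⟩ := exists_lie_ne_zero_of_add hα hβ hadd t he hf
  have h1 : ⁅e, x⁆ ∈ rootSpace H γ := by
    rw [hadd, add_comm]
    exact lie_mem_genWeightSpace_of_mem_genWeightSpace he hx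
  obtain ⟨c, hc⟩ := (finrank_eq_one_iff_of_nonzero' (⟨_, h1⟩ : rootSpace H γ)
        (by simpa using hex)).mp (finrank_rootSpace_eq_one γ hγ) ⟨y, hy⟩
  have hc' : y = c • ⁅e, x⁆ := (congrArg Subtype.val hc).symm
  rw [hc']
  exact G.smul_mem _ (G.lie_mem heG (hαG x hx))

theorem rootSpace_le_of_mem {α : Weight K H L} (hα : α.IsNonZero) {e : L} (he : e ∈ rootSpace H α)
    (he0 : e ≠ 0) {G : LieSubalgebra K L} (heG : e ∈ G) {y : L} (hy : y ∈ rootSpace H α) :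
    y ∈ G := by
  obtain ⟨c, hc⟩ := (finrank_eq_one_iff_of_nonzero' (⟨_, he⟩ : rootSpace H α)
        (by simpa using he0)).mp (finrank_rootSpace_eq_one α hα) ⟨y, hy⟩
  have hc' : y = c • e := (congrArg Subtype.val hc).symm
  rw [hc']
  exact G.smul_mem _ heG

variable (H) in
theorem exists_lieAlgebraBasis : ∃ s : Finset H.root, Nonempty (LieAlgebra.Basis s H) := by
  obtain ⟨b⟩ := (rootSystem H).nonempty_base
  have hnz : ∀ i : H.root, i.1.IsNonZero := fun i ↦ LieSubalgebra.isNonZero_coe_root i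
  choose h e f t he hf using fun i : b.support ↦ exists_isSl2Triple_of_weight_isNonZero (hnz i.1)
  have hh : ∀ i, h i = coroot i.1.1 := fun i ↦ (t i).h_eq_coroot (hnz _) (he i) (hf i)
  have hmat : ∀ i j : b.support, (i.1.1 (coroot j.1.1) : K) = b.cartanMatrix i j := by
    intro i j
    have := b.algebraMap_cartanMatrixIn_apply ℤ i j
    simp only [rootSystem_pairing_apply] at this
    rw [← this]; rfl
  refine ⟨b.support, ⟨{
    A := b.cartanMatrix
    h := h
    e := e
    f := f
    cartan_eq_lieSpan := ?_
    span_ef := ?_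
    linInd := ?_
    nondegen := b.cartanMatrix_nondegenerate
    sl2 := t
    lie_h_h := ?_
    lie_h_e := ?_
    lie_h_f := ?_
    lie_e_f_ne := ?_ }⟩⟩
  · refine le_antisymm (fun x hx ↦ ?_) (LieSubalgebra.lieSpan_le.mpr ?_)
    · have h1 : (⟨x, hx⟩ : H) ∈ Submodule.span K ((rootSystem H).coroot '' b.support) := by
        have := RootPairing.IsRootSystem.span_coroot_eq_top (P := rootSystem H)
        rw [b.span_coroot_support, RootPairing.corootSpan, this]; trivial
      have h2 := Submodule.mem_map_of_mem (f := H.subtype) h1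
      rw [Submodule.map_span] at h2
      refine LieSubalgebra.submodule_span_le_lieSpan (R := K) (L := L) (Submodule.span_mono ?_ h2)
      rintro _ ⟨_, ⟨i, hi, rfl⟩, rfl⟩
      exact ⟨⟨i, hi⟩, hh _⟩
    · rintro _ ⟨i, rfl⟩
      rw [hh]; exact (coroot i.1.1).2
  · set G := LieSubalgebra.lieSpan K L (Set.range e ∪ Set.range f)
    have heG : ∀ i, e i ∈ G := fun i ↦ LieSubalgebra.subset_lieSpan (Or.inl ⟨i, rfl⟩)
    have hfG : ∀ i, f i ∈ G := fun i ↦ LieSubalgebra.subset_lieSpan (Or.inr ⟨i, rfl⟩)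
    have hhG : ∀ i, h i ∈ G := fun i ↦ (t i).lie_e_f ▸ G.lie_mem (heG i) (hfG i)
    have hneg : ∀ {α : Weight K H L}, α.IsNonZero → (-α).IsNonZero := fun h ↦ by simpa using h
    have key : ∀ i : H.root, (∀ x ∈ rootSpace H i.1, x ∈ G) ∧ ∀ x ∈ rootSpace H (-i.1), x ∈ G := by
      intro i
      refine b.induction_add i (p := fun i : H.root ↦ (∀ x ∈ rootSpace H i.1, x ∈ G) ∧
        ∀ x ∈ rootSpace H (-i.1), x ∈ G) ?_ ?_ ?_
      · rintro i ⟨h1, h2⟩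
        have h3 := (rootSystem H).root_reflectionPerm i i
        rw [RootPairing.reflection_apply_self] at h3
        have h4 : (((rootSystem H).reflectionPerm i i).1 : H → K) = -i.1 := by
          ext x
          exact LinearMap.congr_fun h3 x
        simp only [h4, neg_neg]
        exact ⟨h2, h1⟩
      · intro i hi
        refine ⟨fun x hx ↦ rootSpace_le_of_mem (hnz i) (he ⟨i, hi⟩) (t ⟨i, hi⟩).e_ne_zero
          (heG _) hx, fun x hx ↦ ?_⟩
        have hx' : x ∈ rootSpace H (-i.1 : Weight K H L) := by simpa using hx
        have hf' : f ⟨i, hi⟩ ∈ rootSpace H (-i.1 : Weight K H L) := by simpa using hf ⟨i, hi⟩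
        exact rootSpace_le_of_mem (hneg (hnz i)) hf' (t ⟨i, hi⟩).f_ne_zero (hfG _) hx'
      · rintro i j k hk ⟨h1, h2⟩ hj
        have hadd : (k.1 : H → K) = i.1 + j.1 := by
          ext x
          exact LinearMap.congr_fun hk x
        refine ⟨fun x hx ↦ rootSpace_le_of_add (hnz i) (hnz j) (hnz k) hadd (t ⟨j, hj⟩)
          (he ⟨j, hj⟩) (hf ⟨j, hj⟩) h1 (heG _) hx, fun x hx ↦ ?_⟩
        refine rootSpace_le_of_add (α := -i.1) (β := -j.1) (γ := -k.1) (hneg (hnz i))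
          (hneg (hnz j)) (hneg (hnz k)) ?_ (t ⟨j, hj⟩).symm ?_ ?_ ?_ (hfG ⟨j, hj⟩) ?_
        · simp [hadd, add_comm]
        · simpa using hf ⟨j, hj⟩
        · simpa using he ⟨j, hj⟩
        · simpa using h2
        · simpa using hx
    have hHG : ∀ x ∈ H, x ∈ G := by
      intro x hx
      have h1 : (⟨x, hx⟩ : H) ∈ Submodule.span K ((rootSystem H).coroot '' b.support) := by
        have := RootPairing.IsRootSystem.span_coroot_eq_top (P := rootSystem H)
        rw [b.span_coroot_support, RootPairing.corootSpan, this]; trivial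
      have h2 := Submodule.mem_map_of_mem (f := H.subtype) h1
      rw [Submodule.map_span] at h2
      refine Submodule.span_le.mpr ?_ h2
      rintro _ ⟨_, ⟨i, hi, rfl⟩, rfl⟩
      have := hhG ⟨i, hi⟩
      rw [hh] at this
      exact this
    rw [eq_top_iff]
    have htop : (⨆ χ : Weight K H L, (genWeightSpace L χ).toSubmodule) = ⊤ := by
      rw [← LieSubmodule.iSup_toSubmodule, iSup_genWeightSpace_eq_top' K H L]
      rfl
    have hle : (⨆ χ : Weight K H L, (genWeightSpace L χ).toSubmodule) ≤ G.toSubmodule := by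
      refine iSup_le fun χ x hx ↦ ?_
      by_cases hχ : χ.IsNonZero
      · exact (key ⟨χ, by simpa [LieSubalgebra.root] using hχ⟩).1 x hx
      · rw [Weight.IsNonZero, not_not] at hχ
        have hx' : x ∈ rootSpace H (χ : H → K) := hx
        rw [show (χ : H → K) = 0 from hχ] at hx'
        exact hHG x (by simpa using hx')
    intro x _
    exact hle (htop ▸ Submodule.mem_top)
  · have h1 : LinearIndependent K fun i : b.support ↦ (rootSystem H).coroot i :=
      b.linearIndepOn_coroot
    have h2 := h1.map' H.subtype (Submodule.ker_subtype _)
    rwa [show h = H.subtype ∘ fun i : b.support ↦ (rootSystem H).coroot i from funext hh]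
  · intro i j
    rw [hh, hh]
    exact congrArg Subtype.val (trivial_lie_zero H H (coroot i.1.1) (coroot j.1.1))
  · intro i j
    rw [hh, ← Int.cast_smul_eq_zsmul K, ← hmat]
    exact lie_eq_smul_of_mem_rootSpace (he i) (coroot j.1.1)
  · intro i j
    rw [hh, ← Int.cast_smul_eq_zsmul K, Int.cast_neg, ← hmat]
    exact lie_eq_smul_of_mem_rootSpace (hf i) (coroot j.1.1)
  · intro i j hij
    have h1 := lie_mem_genWeightSpace_of_mem_genWeightSpace (he i) (hf j)
    by_contra h0
    have hne : (i.1.1 : H → K) + -(j.1.1 : H → K) ≠ 0 := by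
      intro h3
      rw [← sub_eq_add_neg, sub_eq_zero] at h3
      exact hij (Subtype.ext (Subtype.ext (DFunLike.coe_injective h3)))
    have h4 : genWeightSpace L ((i.1.1 : H → K) + -(j.1.1 : H → K)) ≠ ⊥ := by
      intro h5
      rw [h5] at h1
      exact h0 (by simpa using h1)
    let γ : Weight K H L := ⟨_, h4⟩
    have hγ : γ.IsNonZero := fun h ↦ hne h
    refine b.sub_notMem_range_root i.2 j.2 ⟨⟨γ, by simpa [LieSubalgebra.root] using hγ⟩, ?_⟩
    ext x
    simp [γ, sub_eq_add_neg]

omit [CharZero K] [FiniteDimensional K L] [IsKilling K L] in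
theorem symm_trans_apply {P M : Type*} [LieRing P] [LieAlgebra K P] [LieRing M] [LieAlgebra K M]
    (A : P ≃ₗ⁅K⁆ L) (B : P ≃ₗ⁅K⁆ M) {d : P} {x : L} {y : M} (hA : A d = x) (hB : B d = y) :
    (A.symm.trans B) x = y := by
  rw [← hA, ← hB]
  exact congrArg B (A.symm_apply_apply d)

omit [IsKilling K L] in
theorem basis_equiv_apply_h [IsSimple K L] {ι : Type*} [Finite ι] {H : LieSubalgebra K L}
    [H.IsCartanSubalgebra] [IsTriangularizable K H L] (b : LieAlgebra.Basis ι H)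
    (hA : b.A.reindex (Equiv.refl ι) (Equiv.refl ι) = b.symm.A) (i : ι) :
    Basis.equivOfReindex (Equiv.refl ι) b b.symm hA (b.h i) = -b.h i := by
  unfold Basis.equivOfReindex
  refine symm_trans_apply _ _ (d := ⟨(b.h i, b.symm.h i),
    LieSubalgebra.subset_lieSpan (Or.inl (Or.inl ⟨i, rfl⟩))⟩) ?_ ?_
  · rfl
  · rfl

omit [IsKilling K L] [H.IsCartanSubalgebra] [IsTriangularizable K H L] in
variable (H) in
/-- The Chevalley involution: an automorphism acting as `-1` on a Cartan subalgebra. -/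
theorem exists_lieEquiv_apply_eq_neg [IsAlgClosed K] [IsSimple K L] [H.IsCartanSubalgebra] :
    ∃ θ : L ≃ₗ⁅K⁆ L, ∀ h ∈ H, θ h = -h := by
  obtain ⟨s, ⟨b⟩⟩ := exists_lieAlgebraBasis (K := K) H
  refine ⟨Basis.equivOfReindex (Equiv.refl s) b b.symm (by ext; rfl), fun h hh ↦ ?_⟩
  have h1 : h ∈ Submodule.span K (Set.range b.h) := b.coe_cartan_eq_span ▸ hh
  clear hh
  induction h1 using Submodule.span_induction with
  | mem x hx =>
    obtain ⟨i, rfl⟩ := hx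
    exact basis_equiv_apply_h b _ i
  | zero => simp
  | add x y _ _ hx hy => rw [map_add, hx, hy, neg_add]
  | smul c x _ hx => rw [map_smul, hx, smul_neg]

end Chevalley

section Dominance

open MvPolynomial

variable {K σ : Type*} [Field K] {n : ℕ}

/-- The chain rule for substitution into a multivariate polynomial. -/
theorem pderiv_aeval {R τ : Type*} [CommRing R] [Fintype τ] (F : τ → MvPolynomial σ R)
    (G : MvPolynomial τ R) (i : σ) :
    pderiv i (aeval F G) = ∑ j, aeval F (pderiv j G) * pderiv i (F j) := by
  classical
  induction G using MvPolynomial.induction_on with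
  | C a => simp
  | add p q hp hq => simp only [map_add, hp, hq, add_mul, Finset.sum_add_distrib]
  | mul_X p k hp =>
    simp only [map_mul, aeval_X, pderiv_mul, hp, map_add, pderiv_X, add_mul,
      Finset.sum_add_distrib, Finset.sum_mul]
    congr 1
    · exact Finset.sum_congr rfl fun j _ ↦ by ring
    · rw [Finset.sum_eq_single k]
      · simp
      · intro j _ hj
        simp [hj.symm]
      · simp

theorem aeval_injective_of_span_jacobian [CharZero K] [Finite σ] (F : Fin n → MvPolynomial σ K)
    (p : σ → K)
    (hJ : Submodule.span K (Set.range fun i : σ ↦ fun j ↦ eval p (pderiv i (F j))) = ⊤) :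
    Function.Injective (aeval F : MvPolynomial (Fin n) K →ₐ[K] MvPolynomial σ K) := by
  classical
  have := Fintype.ofFinite σ
  have hc : ∀ k : Fin n, ∃ c : σ → K, ∑ i, c i • (fun j ↦ eval p (pderiv i (F j))) =
      (Pi.single k 1 : Fin n → K) := fun k ↦ by
    have : (Pi.single k 1 : Fin n → K) ∈ Submodule.span K
      (Set.range fun i : σ ↦ fun j ↦ eval p (pderiv i (F j))) := hJ ▸ Submodule.mem_top
    exact (Submodule.mem_span_range_iff_exists_fun K).mp this
  choose c hc using hc
  let N : Matrix (Fin n) (Fin n) (MvPolynomial σ K) :=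
    Matrix.of fun k j ↦ ∑ i, C (c k i) * pderiv i (F j)
  have hN : N.det ≠ 0 := by
    intro h0
    have h1 : (eval p).mapMatrix N = 1 := by
      ext k j
      have := congrFun (hc k) j
      simp only [Finset.sum_apply, Pi.smul_apply, smul_eq_mul] at this
      simp [N, this, Matrix.one_apply, Pi.single_apply, eq_comm]
    have h2 := (eval p).map_det N
    rw [h0, h1] at h2
    simp at h2
  have hker : ∀ G : MvPolynomial (Fin n) K, aeval F G = 0 → ∀ j, aeval F (pderiv j G) = 0 := by
    intro G hG j
    have h1 : N.mulVec (fun j ↦ aeval F (pderiv j G)) = 0 := by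
      ext1 k
      have : ∀ i, ∑ j, aeval F (pderiv j G) * pderiv i (F j) = 0 := fun i ↦ by
        rw [← pderiv_aeval, hG, map_zero]
      simp only [Matrix.mulVec, dotProduct, N, Matrix.of_apply, Pi.zero_apply, Finset.sum_mul]
      rw [Finset.sum_comm]
      refine Finset.sum_eq_zero fun i _ ↦ ?_
      have h2 := congrArg (C (c k i) * ·) (this i)
      simp only [Finset.mul_sum, mul_zero] at h2
      rw [← h2]
      exact Finset.sum_congr rfl fun j _ ↦ by ring
    exact congrFun (Matrix.eq_zero_of_mulVec_eq_zero hN h1) j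
  have key : ∀ (d : ℕ) (G : MvPolynomial (Fin n) K), aeval F G = 0 →
      (∀ m : Fin n →₀ ℕ, d ≤ m.degree → coeff m G = 0) → G = 0 := by
    intro d
    induction d with
    | zero => exact fun G _ h ↦ by ext m; simpa using h m (Nat.zero_le _)
    | succ d ih =>
      intro G hG hd
      have hd' : ∀ j, pderiv j G = 0 := fun j ↦ ih _ (hker G hG j) fun m hm ↦ by
        rw [coeff_pderiv, hd _ (by simpa using hm)]
        simp
      have hGC : G = C (coeff 0 G) := by
        ext m
        rw [coeff_C]
        split_ifs with hm
        · rw [hm]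
        · obtain ⟨j, hj⟩ : ∃ j, m j ≠ 0 := by
            by_contra! h
            exact hm (by ext j; simp [h j])
          have h1 := coeff_pderiv (i := j) G (m - Finsupp.single j 1)
          rw [hd', coeff_zero, tsub_add_cancel_of_le] at h1
          · have h2 : (((m - Finsupp.single j 1 : Fin n →₀ ℕ) j : K) + 1) ≠ 0 :=
              Nat.cast_add_one_ne_zero _
            exact (mul_eq_zero.mp h1.symm).resolve_right h2
          · simpa [Finsupp.single_le_iff] using Nat.one_le_iff_ne_zero.mpr hj
      rw [hGC, aeval_C] at hG
      rw [hGC, (map_eq_zero_iff _ (C_injective σ K)).mp hG, map_zero]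
  refine (injective_iff_map_eq_zero _).mpr fun G hG ↦ ?_
  refine key (G.totalDegree + 1) G hG fun m hm ↦ ?_
  by_contra h
  have := le_totalDegree (mem_support_iff.mpr h)
  rw [Finsupp.degree_eq_sum] at hm
  rw [Finsupp.sum_fintype _ _ (fun _ ↦ rfl)] at this
  lia

theorem exists_basicOpen_subset_or {A : Type*} [CommRing A] [IsDomain A]
    {s : Set (PrimeSpectrum A)} (hs : Topology.IsConstructible s) :
    ∃ Q : A, Q ≠ 0 ∧ (((PrimeSpectrum.basicOpen Q : Set (PrimeSpectrum A)) ⊆ s ∧ ⊥ ∈ s) ∨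
      ((PrimeSpectrum.basicOpen Q : Set (PrimeSpectrum A)) ⊆ sᶜ ∧ ⊥ ∉ s)) := by
  induction hs using Topology.IsConstructible.empty_union_induction with
  | open_retrocompact U hU _ =>
    by_cases h : ⊥ ∈ U
    · obtain ⟨_, ⟨Q, rfl⟩, h1, h2⟩ :=
        PrimeSpectrum.isTopologicalBasis_basic_opens.exists_subset_of_mem_open h hU
      refine ⟨Q, fun h0 ↦ ?_, Or.inl ⟨h2, h⟩⟩
      simp [h0] at h1
    · refine ⟨1, one_ne_zero, Or.inr ⟨fun x _ hx ↦ h ?_, h⟩⟩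
      exact (PrimeSpectrum.le_iff_specializes _ _).mp bot_le |>.mem_open hU hx
  | union s hs t ht h1 h2 =>
    obtain ⟨Q, hQ, h1⟩ := h1
    obtain ⟨R, hR, h2⟩ := h2
    refine ⟨Q * R, mul_ne_zero hQ hR, ?_⟩
    have hQR : ∀ x ∈ PrimeSpectrum.basicOpen (Q * R),
        x ∈ PrimeSpectrum.basicOpen Q ∧ x ∈ PrimeSpectrum.basicOpen R := by
      intro x hx
      rwa [PrimeSpectrum.basicOpen_mul] at hx
    rcases h1 with ⟨h1, h1'⟩ | ⟨h1, h1'⟩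
    · exact Or.inl ⟨fun x hx ↦ Or.inl (h1 (hQR x hx).1), Or.inl h1'⟩
    · rcases h2 with ⟨h2, h2'⟩ | ⟨h2, h2'⟩
      · exact Or.inl ⟨fun x hx ↦ Or.inr (h2 (hQR x hx).2), Or.inr h2'⟩
      · refine Or.inr ⟨fun x hx h ↦ ?_, by simp [h1', h2']⟩
        exact h.elim (h1 (hQR x hx).1) (h2 (hQR x hx).2)
  | compl s hs h =>
    obtain ⟨Q, hQ, h⟩ := h
    refine ⟨Q, hQ, ?_⟩
    rw [compl_compl, Set.notMem_compl_iff]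
    exact h.symm

/-- A polynomial map whose Jacobian has full rank somewhere takes on the nonvanishing locus of a
nonzero polynomial all values of a nonempty open set. -/
theorem exists_eval_eq_of_span_jacobian [CharZero K] [IsAlgClosed K] [Finite σ]
    (F : Fin n → MvPolynomial σ K) (p : σ → K)
    (hJ : Submodule.span K (Set.range fun i : σ ↦ fun j ↦ eval p (pderiv i (F j))) = ⊤)
    {r : MvPolynomial σ K} (hr : r ≠ 0) :
    ∃ Q : MvPolynomial (Fin n) K, Q ≠ 0 ∧ ∀ u, eval u Q ≠ 0 →
      ∃ x, eval x r ≠ 0 ∧ ∀ j, eval x (F j) = u j := by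
  set φ : MvPolynomial (Fin n) K →ₐ[K] MvPolynomial σ K := aeval F
  have hinj : Function.Injective φ := aeval_injective_of_span_jacobian F p hJ
  have hfp : φ.toRingHom.FinitePresentation :=
    RingHom.FinitePresentation.of_finiteType.mp ?_
  swap
  · exact RingHom.FiniteType.of_comp_finiteType (f := C) (by
      rw [show φ.toRingHom.comp C = C from φ.comp_algebraMap]
      exact RingHom.finiteType_algebraMap.mpr inferInstance)
  have hcon := PrimeSpectrum.isConstructible_comap_image hfp
    (s := PrimeSpectrum.basicOpen r) ?_
  swap
  · exact PrimeSpectrum.isConstructible_basicOpen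
  obtain ⟨Q, hQ, h | ⟨-, h⟩⟩ := exists_basicOpen_subset_or hcon
  swap
  · refine absurd ⟨⊥, ?_, ?_⟩ h
    · simpa using hr
    · ext x
      simp [map_eq_zero_iff _ hinj]
  refine ⟨Q, hQ, fun u hu ↦ ?_⟩
  have hu' : (⟨RingHom.ker (eval u), RingHom.ker_isPrime _⟩ : PrimeSpectrum _) ∈
    PrimeSpectrum.basicOpen Q := hu
  obtain ⟨P, hrP, hP⟩ := h.1 hu'
  have hprime := P.2
  have hvan := MvPolynomial.IsPrime.vanishingIdeal_zeroLocus (K := K) P.asIdeal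
  have hrP' : r ∉ vanishingIdeal K (zeroLocus K P.asIdeal) := by rw [hvan]; exact hrP
  rw [mem_vanishingIdeal_iff] at hrP'
  push Not at hrP'
  obtain ⟨x, hx, hxr⟩ := hrP'
  refine ⟨x, hxr, fun j ↦ ?_⟩
  have h1 : X j - C (u j) ∈ RingHom.ker (eval u) := by simp
  have h2 : X j - C (u j) ∈ (PrimeSpectrum.comap φ.toRingHom P).asIdeal := by rw [hP]; exact h1
  have h3 := hx _ h2
  simpa [φ, sub_eq_zero] using h3

end Dominance

section Tangent

variable {K V : Type*} [Field K] [AddCommGroup V] [Module K V]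

/-- `D` is the velocity at `0` of a polynomial curve through `1` which stays in `M` off the zero
locus of a polynomial not vanishing at `0`. -/
def IsTangent (M : Submonoid (End K V)) (D : End K V) : Prop :=
  ∃ (m : ℕ) (p : Fin m → Polynomial K) (A : Fin m → End K V) (r : Polynomial K),
    r.eval 0 ≠ 0 ∧ ∑ k, (p k).eval 0 • A k = 1 ∧ ∑ k, (p k).derivative.eval 0 • A k = D ∧
      ∀ t, r.eval t ≠ 0 → ∑ k, (p k).eval t • A k ∈ M

theorem list_prod_map_derivation {R ι : Type*} [CommRing R] [Algebra K R] [Fintype ι]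
    [DecidableEq ι] (ev : R →ₐ[K] K) (d : Derivation K R R) (l : List (Matrix ι ι R))
    (h : ∀ A ∈ l, A.map ev = 1) :
    l.prod.map ev = 1 ∧
      l.prod.map (fun x ↦ ev (d x)) = (l.map fun A ↦ A.map fun x ↦ ev (d x)).sum := by
  induction l with
  | nil =>
    constructor
    · simp [Matrix.map_one]
    · ext a b
      simp [Matrix.one_apply, apply_ite]
  | cons A l ih =>
    obtain ⟨h1, h2⟩ := ih fun B hB ↦ h B (List.mem_cons_of_mem _ hB)
    have hA := h A List.mem_cons_self
    have h3 : (A * l.prod).map (fun x ↦ ev (d x)) =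
        A.map ev * l.prod.map (fun x ↦ ev (d x)) + A.map (fun x ↦ ev (d x)) * l.prod.map ev := by
      ext a b
      simp [Matrix.mul_apply, map_sum, Derivation.leibniz, Finset.sum_add_distrib, mul_comm]
    rw [List.prod_cons, List.map_cons, List.sum_cons, h3, Matrix.map_mul, hA, h1, h2]
    simp [add_comm]

open MvPolynomial in
/-- A vector whose image under the tangent vectors of `M` fills `K ^ n` has an orbit containing a
nonempty open set. -/
theorem exists_apply_eq_of_span_tangent [CharZero K] [IsAlgClosed K] [FiniteDimensional K V]
    (M : Submonoid (End K V)) {n : ℕ} (π : V →ₗ[K] (Fin n → K)) (v : V)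
    (hspan : Submodule.span K {y | ∃ D, IsTangent M D ∧ π (D v) = y} = ⊤) :
    ∃ Q : MvPolynomial (Fin n) K, Q ≠ 0 ∧ ∀ u, eval u Q ≠ 0 → ∃ g ∈ M, π (g v) = u := by
  classical
  obtain ⟨N, w, hw, hw'⟩ : ∃ (N : ℕ) (w : Fin N → Fin n → K),
      (∀ i, ∃ D, IsTangent M D ∧ π (D v) = w i) ∧ Submodule.span K (Set.range w) = ⊤ := by
    obtain ⟨f, hf, hf', -⟩ := Submodule.exists_fun_fin_finrank_span_eq K
      {y | ∃ D, IsTangent M D ∧ π (D v) = y}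
    exact ⟨_, f, hf, by rw [hf', hspan]⟩
  choose D hD hDw using hw
  choose m p A r hr hA1 hAD hAM using hD
  let bV := Module.finBasis K V
  let T := LinearMap.toMatrixAlgEquiv bV
  let ι := Fin (finrank K V)
  let σ := Fin N
  let R := MvPolynomial σ K
  let G : σ → Matrix ι ι R := fun i ↦
    Matrix.of fun a b ↦ ∑ k, Polynomial.aeval (X i : R) (p i k) * C (T (A i k) a b)
  have hev : ∀ (x : σ → K) i q, aeval x (Polynomial.aeval (X i : R) q) = q.eval (x i) := by
    intro x i q
    rw [← Polynomial.aeval_algHom_apply, aeval_X, Polynomial.coe_aeval_eq_eval]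
  have hGx : ∀ (x : σ → K) i, (G i).map (aeval x) = T (∑ k, (p i k).eval (x i) • A i k) := by
    intro x i
    ext a b
    simp only [G, Matrix.map_apply, Matrix.of_apply, map_sum, map_mul, map_smul,
      Matrix.sum_apply, Matrix.smul_apply, smul_eq_mul]
    refine Finset.sum_congr rfl fun k _ ↦ ?_
    rw [hev, aeval_C, Algebra.algebraMap_self, RingHom.id_apply]
  have hG0 : ∀ i, (G i).map (aeval (0 : σ → K)) = 1 := by
    intro i
    rw [hGx, Pi.zero_apply, hA1, map_one]
  have hGd : ∀ i j, (G i).map (fun x ↦ aeval (0 : σ → K) (pderiv j x)) =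
      if i = j then T (D i) else 0 := by
    intro i j
    ext a b
    simp only [G, Matrix.map_apply, Matrix.of_apply, map_sum]
    have h1 : ∀ k, aeval (0 : σ → K)
        (pderiv j (Polynomial.aeval (X i : R) (p i k) * C (T (A i k) a b))) =
        if i = j then (p i k).derivative.eval 0 * T (A i k) a b else 0 := by
      intro k
      rw [mul_comm, pderiv_C_mul, Derivation.map_aeval, smul_eq_mul, map_mul, map_mul, hev,
        aeval_C, pderiv_X, Algebra.algebraMap_self, RingHom.id_apply, Pi.zero_apply]
      by_cases hij : i = j
      · simp [hij, mul_comm]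
      · simp [hij]
    simp only [h1]
    split_ifs with hij
    · rw [← hAD i, map_sum, Matrix.sum_apply]
      exact Finset.sum_congr rfl fun k _ ↦ by rw [map_smul, Matrix.smul_apply, smul_eq_mul]
    · simp
  let P : Matrix ι ι R := (List.ofFn G).prod
  have hPx : ∀ x : σ → K, P.map (aeval x) =
      T (List.ofFn fun i ↦ ∑ k, (p i k).eval (x i) • A i k).prod := by
    intro x
    have h1 := map_list_prod ((aeval x : R →ₐ[K] K).toRingHom.mapMatrix (m := ι)) (List.ofFn G)
    have h2 := map_list_prod T (List.ofFn fun i ↦ ∑ k, (p i k).eval (x i) • A i k)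
    rw [h2]
    refine h1.trans ?_
    rw [List.map_ofFn, List.map_ofFn]
    congr 2
    ext1 i
    exact hGx x i
  have hPd : ∀ j, P.map (fun x ↦ aeval (0 : σ → K) (pderiv j x)) = T (D j) := by
    intro j
    rw [(list_prod_map_derivation _ (pderiv j) (List.ofFn G) _).2]
    · rw [List.map_ofFn, List.sum_ofFn]
      refine (Finset.sum_congr rfl fun i _ ↦ hGd i j).trans ?_
      exact (Finset.sum_ite_eq' Finset.univ j fun i ↦ T (D i)).trans (if_pos (Finset.mem_univ j))
    · intro B hB
      rw [List.mem_ofFn] at hB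
      obtain ⟨i, rfl⟩ := hB
      exact hG0 i
  let ℓ : Fin n → Matrix ι ι K →ₗ[K] K := fun j ↦
    LinearMap.proj j ∘ₗ π ∘ₗ LinearMap.applyₗ v ∘ₗ T.symm.toLinearMap
  have hℓ : ∀ (g : End K V) j, ℓ j (T g) = π (g v) j := by
    intro g j
    simp [ℓ]
  let F : Fin n → R := fun j ↦ ∑ a, ∑ b, C (ℓ j (Matrix.single a b 1)) * P a b
  have hF : ∀ (ψ : R →ₗ[K] K) j, ψ (F j) = ℓ j (P.map ψ) := by
    intro ψ j
    conv_rhs => rw [Matrix.matrix_eq_sum_single (P.map ψ)]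
    simp only [F, map_sum]
    refine Finset.sum_congr rfl fun a _ ↦ Finset.sum_congr rfl fun b _ ↦ ?_
    rw [C_mul', map_smul, Matrix.map_apply, ← mul_one (ψ (P a b)), ← smul_eq_mul (ψ (P a b)),
      ← Matrix.smul_single, map_smul, smul_eq_mul, smul_eq_mul, mul_one,
      smul_eq_mul, mul_comm]
  let r' : R := ∏ i, Polynomial.aeval (X i : R) (r i)
  have hr'x : ∀ x : σ → K, eval x r' = ∏ i, (r i).eval (x i) := by
    intro x
    simp only [r', map_prod]
    refine Finset.prod_congr rfl fun i _ ↦ ?_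
    rw [← hev, aeval_eq_eval]
  have hJ : Submodule.span K (Set.range fun i : σ ↦ fun j ↦ eval (0 : σ → K) (pderiv i (F j))) =
      ⊤ := by
    rw [← hw']
    congr 2
    ext1 i
    ext1 j
    rw [← hDw, ← hℓ, ← hPd]
    exact hF ((aeval 0).toLinearMap ∘ₗ (pderiv i).toLinearMap) j
  have hr' : r' ≠ 0 := by
    intro h0
    have := hr'x 0
    rw [h0, map_zero] at this
    exact Finset.prod_ne_zero_iff.mpr (fun i _ ↦ hr i) this.symm
  obtain ⟨Q, hQ, h⟩ := exists_eval_eq_of_span_jacobian F 0 hJ hr'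
  refine ⟨Q, hQ, fun u hu ↦ ?_⟩
  obtain ⟨x, hx, hxu⟩ := h u hu
  refine ⟨(List.ofFn fun i ↦ ∑ k, (p i k).eval (x i) • A i k).prod, ?_, ?_⟩
  · refine Submonoid.list_prod_mem _ fun g hg ↦ ?_
    rw [List.mem_ofFn] at hg
    obtain ⟨i, rfl⟩ := hg
    refine hAM i _ ?_
    rw [hr'x] at hx
    exact Finset.prod_ne_zero_iff.mp hx i (Finset.mem_univ i)
  · ext j
    rw [← hℓ, ← hPx x, ← hxu]
    exact (hF (aeval x).toLinearMap j).symm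

end Tangent

section Automorphisms

variable {K L : Type*} [Field K] [LieRing L] [LieAlgebra K L]

/-- The exponential of a nilpotent inner derivation, as an automorphism. -/
theorem exists_lieEquiv_eq_exp [CharZero K] {a : L} {m : ℕ} (hm : ad K L a ^ m = 0) : ∃ e : L ≃ₗ⁅K⁆ L,
    ∀ y, e y = ∑ i ∈ Finset.range m, ((i.factorial : K)⁻¹) • (ad K L a ^ i) y := by
  let _ : Module ℚ L := Module.compHom L (algebraMap ℚ K)
  have hq : ∀ (q : ℚ) (y : L), q • y = (q : K) • y := fun q y ↦ by
    rw [← eq_ratCast (algebraMap ℚ K) q]; rfl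
  let _ : LieAlgebra ℚ L := { lie_smul := fun q x y ↦ by rw [hq, hq, lie_smul] }
  have h : (LieDerivation.ad K L a).toLinearMap = ad K L a :=
    LinearMap.ext fun _ ↦ by simp
  have hn : _root_.IsNilpotent (LieDerivation.ad K L a).toLinearMap := ⟨m, by rwa [h]⟩
  refine ⟨LieDerivation.exp (LieDerivation.ad K L a) hn, fun y ↦ ?_⟩
  rw [LieDerivation.exp_map_apply, IsNilpotent.exp_eq_sum (k := m) (by rw [h]; exact hm),
    LinearMap.sum_apply]
  refine Finset.sum_congr rfl fun i _ ↦ ?_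
  rw [LinearMap.smul_apply, hq, h]
  push_cast
  rfl

theorem lieEquiv_exp_apply_of_lie_eq_zero {a s : L} {m : ℕ} {e : L ≃ₗ⁅K⁆ L}
    (he : ∀ y, e y = ∑ i ∈ Finset.range (m + 1), ((i.factorial : K)⁻¹) • (ad K L a ^ i) y)
    (hs : ⁅a, s⁆ = 0) : e s = s := by
  rw [he, Finset.sum_eq_single 0]
  · simp
  · intro i _ hi
    obtain ⟨j, rfl⟩ := Nat.exists_eq_succ_of_ne_zero hi
    rw [pow_succ, Module.End.mul_apply, ad_apply, hs, map_zero, smul_zero]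
  · simp

/-- Linear maps agreeing on eigenvectors with integer eigenvalues agree. -/
theorem linearMap_ext_of_iSup_eigenspace {V W : Type*} [AddCommGroup V] [Module K V]
    [AddCommGroup W] [Module K W] {D : End K V} (hD : ⨆ k : ℤ, D.eigenspace (k : K) = ⊤)
    {f g : V →ₗ[K] W} (h : ∀ (k : ℤ) y, D y = (k : K) • y → f y = g y) : f = g := by
  rw [← LinearMap.eqLocus_eq_top, eq_top_iff, ← hD, iSup_le_iff]
  exact fun k y hy ↦ h k y (mem_eigenspace_iff.mp hy)

/-- An ad-diagonalizable element with integer eigenvalues integrates to a one-parameter torus. -/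
theorem exists_torus [CharZero K] [FiniteDimensional K L] {z : L}
    (hz : ⨆ k : ℤ, (ad K L z).eigenspace (k : K) = ⊤) : ∃ (N : ℕ) (π : Fin (2 * N + 1) → End K L),
    ∑ i, π i = 1 ∧ ∑ i : Fin (2 * N + 1), ((i : ℕ) : K) • π i = (N : K) • 1 + ad K L z ∧
    ∀ c : K, c ≠ 0 → ∃ τ : L ≃ₗ⁅K⁆ L, (∀ y, (∑ i : Fin (2 * N + 1), c ^ (i : ℕ) • π i) y = c ^ N • τ y) ∧
      ∀ (k : ℤ) y, ⁅z, y⁆ = (k : K) • y → τ y = c ^ k • y := by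
  obtain ⟨N, hN⟩ : ∃ N : ℕ, ∀ (k : ℤ) (y : L), ⁅z, y⁆ = (k : K) • y → y ≠ 0 → |k| ≤ N := by
    have hfin : {k : ℤ | (ad K L z).HasEigenvalue (k : K)}.Finite :=
      Set.Finite.preimage (Set.injOn_of_injective Int.cast_injective)
        (Module.End.finite_hasEigenvalue (ad K L z))
    obtain ⟨N, hN⟩ := (hfin.image fun k ↦ k.natAbs).bddAbove
    refine ⟨N, fun k y hy hy0 ↦ ?_⟩
    have h1 : (ad K L z).HasEigenvalue (k : K) :=
      hasEigenvalue_of_hasEigenvector ⟨mem_eigenspace_iff.mpr hy, hy0⟩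
    have := hN ⟨k, h1, rfl⟩
    rw [Int.abs_eq_natAbs]
    exact_mod_cast this
  let v : Fin (2 * N + 1) → K := fun i ↦ ((i : ℕ) : K) - N
  have hv : Function.Injective v := fun i j hij ↦ by
    have : ((i : ℕ) : K) = (j : ℕ) := sub_left_injective hij
    exact Fin.ext (Nat.cast_injective this)
  let π : Fin (2 * N + 1) → End K L := fun i ↦
    Polynomial.aeval (ad K L z) (Lagrange.basis Finset.univ v i)
  have hπ : ∀ (g : Fin (2 * N + 1) → K) (j : Fin (2 * N + 1)) (y : L), ⁅z, y⁆ = v j • y →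
      (∑ i, g i • π i) y = g j • y := by
    intro g j y hy
    rw [LinearMap.sum_apply, Finset.sum_eq_single j]
    · rw [LinearMap.smul_apply, aeval_apply_of_mem_apply_eq_smul hy,
        Lagrange.eval_basis_self (Set.injOn_of_injective hv) (Finset.mem_univ j), one_smul]
    · intro i _ hi
      rw [LinearMap.smul_apply, aeval_apply_of_mem_apply_eq_smul hy,
        Lagrange.eval_basis_of_ne hi (Finset.mem_univ j), zero_smul, smul_zero]
    · simp
  have hidx : ∀ (k : ℤ) (y : L), ⁅z, y⁆ = (k : K) • y → y ≠ 0 →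
      ∃ j : Fin (2 * N + 1), ((j : ℕ) : ℤ) = k + N ∧ ⁅z, y⁆ = v j • y := by
    intro k y hy hy0
    have h1 := abs_le.mp (hN k y hy hy0)
    refine ⟨⟨(k + N).toNat, by lia⟩, by simp only; lia, ?_⟩
    have h2 : (((k + N).toNat : ℤ) : K) = ((k + N : ℤ) : K) := by
      rw [Int.toNat_of_nonneg (by lia)]
    rw [hy]
    congr 1
    simp only [v]
    push_cast at h2
    rw [h2]; ring
  refine ⟨N, π, ?_, ?_, fun c hc ↦ ?_⟩
  · refine linearMap_ext_of_iSup_eigenspace hz fun k y hy ↦ ?_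
    rcases eq_or_ne y 0 with rfl | hy0
    · simp
    obtain ⟨j, -, hj⟩ := hidx k y hy hy0
    simpa using hπ (fun _ ↦ 1) j y hj
  · refine linearMap_ext_of_iSup_eigenspace hz fun k y hy ↦ ?_
    rcases eq_or_ne y 0 with rfl | hy0
    · simp
    obtain ⟨j, -, hj⟩ := hidx k y hy hy0
    rw [hπ (fun i ↦ ((i : ℕ) : K)) j y hj]
    rw [LinearMap.add_apply, ad_apply, hj]
    simp only [v, LinearMap.smul_apply, Module.End.one_apply]
    module
  · let T : K → End K L := fun c ↦ (c ^ N)⁻¹ • ∑ i : Fin (2 * N + 1), c ^ (i : ℕ) • π i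
    have hT : ∀ c : K, c ≠ 0 → ∀ (k : ℤ) y, ⁅z, y⁆ = (k : K) • y → T c y = c ^ k • y := by
      intro c hc k y hy
      rcases eq_or_ne y 0 with rfl | hy0
      · simp
      obtain ⟨j, hjk, hj⟩ := hidx k y hy hy0
      have h1 := hπ (fun i ↦ c ^ (i : ℕ)) j y hj
      simp only [T, LinearMap.smul_apply]
      rw [h1, smul_smul]
      congr 1
      rw [← zpow_natCast c j, hjk, zpow_add₀ hc, zpow_natCast]
      field_simp
    have hinv : ∀ c : K, c ≠ 0 → T c⁻¹ ∘ₗ T c = LinearMap.id := by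
      intro c hc
      refine linearMap_ext_of_iSup_eigenspace hz fun k y hy ↦ ?_
      rw [LinearMap.comp_apply, hT c hc k y hy, map_smul, hT _ (inv_ne_zero hc) k y hy, smul_smul,
        inv_zpow, mul_inv_cancel₀ (zpow_ne_zero _ hc)]
      simp
    have hlie : ∀ x y, T c ⁅x, y⁆ = ⁅T c x, T c y⁆ := by
      have h1 : (ad K L : L →ₗ[K] End K L).compr₂ (T c) =
          (ad K L : L →ₗ[K] End K L).compl₁₂ (T c) (T c) := by
        refine linearMap_ext_of_iSup_eigenspace hz fun k x hx ↦ ?_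
        refine linearMap_ext_of_iSup_eigenspace hz fun l y hy ↦ ?_
        rw [ad_apply] at hx hy
        have hxy : ⁅z, ⁅x, y⁆⁆ = ((k + l : ℤ) : K) • ⁅x, y⁆ := by
          rw [leibniz_lie, hx, hy]
          simp only [smul_lie, lie_smul, Int.cast_add, add_smul]
        simp only [LinearMap.compr₂_apply, LinearMap.compl₁₂_apply, LieHom.coe_toLinearMap,
          ad_apply]
        rw [hT c hc _ _ hxy, hT c hc k x hx, hT c hc l y hy, zpow_add₀ hc]
        simp only [smul_lie, lie_smul, smul_smul, mul_comm]
      exact fun x y ↦ LinearMap.congr_fun (LinearMap.congr_fun h1 x) y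
    let τ : L ≃ₗ⁅K⁆ L :=
      { T c with
        map_lie' := hlie _ _
        invFun := T c⁻¹
        left_inv := fun x ↦ LinearMap.congr_fun (hinv c hc) x
        right_inv := fun x ↦ by
          have := LinearMap.congr_fun (hinv _ (inv_ne_zero hc)) x
          rwa [inv_inv] at this }
    refine ⟨τ, fun y ↦ ?_, hT c hc⟩
    change _ = c ^ N • T c y
    simp only [T, LinearMap.smul_apply]
    rw [smul_inv_smul₀ (pow_ne_zero _ hc)]

end Automorphisms

section Stabilizer

variable {K L : Type*} [Field K] [LieRing L] [LieAlgebra K L]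

variable (K) in
/-- Nonzero scalar multiples of the automorphisms fixing `S` pointwise. -/
def scaledStabilizer (S : Set L) : Submonoid (End K L) where
  carrier := {g | ∃ c : K, c ≠ 0 ∧ ∃ τ : L ≃ₗ⁅K⁆ L, (∀ y, g y = c • τ y) ∧ ∀ s ∈ S, τ s = s}
  one_mem' := ⟨1, one_ne_zero, LieEquiv.refl, by simp, by simp⟩
  mul_mem' := by
    rintro g g' ⟨c, hc, τ, hτ, hS⟩ ⟨c', hc', τ', hτ', hS'⟩
    refine ⟨c * c', mul_ne_zero hc hc', τ'.trans τ, fun y ↦ ?_, fun s hs ↦ ?_⟩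
    · rw [Module.End.mul_apply, hτ, hτ', map_smul, smul_smul, LieEquiv.trans_apply]
    · rw [LieEquiv.trans_apply, hS' s hs, hS s hs]

theorem isTangent_one (S : Set L) : IsTangent (scaledStabilizer K S) 1 := by
  refine ⟨1, fun _ ↦ 1 + Polynomial.X, fun _ ↦ 1, 1 + Polynomial.X, by simp, by simp, by simp,
    fun t ht ↦ ⟨1 + t, by simpa using ht, LieEquiv.refl, fun y ↦ by simp, by simp⟩⟩

theorem isTangent_ad_of_isNilpotent [CharZero K] {S : Set L} {a : L} (ha : a ∈ centralizer K S)
    (hn : IsNilpotent (ad K L a)) : IsTangent (scaledStabilizer K S) (ad K L a) := by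
  obtain ⟨m, hm⟩ := hn
  refine ⟨m + 2, fun i ↦ Polynomial.C ((i.1.factorial : K)⁻¹) * Polynomial.X ^ i.1,
    fun i ↦ ad K L a ^ i.1, 1, by simp, ?_, ?_, fun t _ ↦ ?_⟩
  · rw [Fin.sum_univ_succ]
    simp
  · rw [Fin.sum_univ_succ, Fin.sum_univ_succ]
    simp
  · have h0 : ∀ i, ad K L (t • a) ^ i = t ^ i • ad K L a ^ i := fun i ↦ by
      rw [map_smul, smul_pow]
    obtain ⟨e, he⟩ := exists_lieEquiv_eq_exp (K := K) (a := t • a) (m := m + 2)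
      (by rw [h0, pow_add (ad K L a), hm, zero_mul, smul_zero])
    refine ⟨1, one_ne_zero, e, fun y ↦ ?_, fun s hs ↦ lieEquiv_exp_apply_of_lie_eq_zero he ?_⟩
    · rw [he, one_smul, LinearMap.sum_apply,
        ← Fin.sum_univ_eq_sum_range (fun i ↦ ((i.factorial : K)⁻¹) • (ad K L (t • a) ^ i) y)]
      refine Finset.sum_congr rfl fun i _ ↦ ?_
      rw [h0, LinearMap.smul_apply, LinearMap.smul_apply, smul_smul]
      simp
    · rw [smul_lie, ← lie_skew, ha s hs, neg_zero, smul_zero]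

theorem isTangent_add_ad_of_integral [CharZero K] [FiniteDimensional K L] {S : Set L} {z : L}
    (ha : z ∈ centralizer K S) (hz : ⨆ k : ℤ, (ad K L z).eigenspace (k : K) = ⊤) :
    ∃ N : ℕ, IsTangent (scaledStabilizer K S) ((N : K) • 1 + ad K L z) := by
  obtain ⟨N, π, h1, h2, h3⟩ := exists_torus hz
  refine ⟨N, 2 * N + 1, fun i ↦ (1 + Polynomial.X) ^ i.1, π, 1 + Polynomial.X, by simp, by simpa,
    ?_, fun t ht ↦ ?_⟩
  · rw [← h2]
    refine Finset.sum_congr rfl fun i _ ↦ ?_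
    simp [Polynomial.derivative_pow]
  · have ht' : 1 + t ≠ 0 := by simpa using ht
    obtain ⟨τ, hτ, hτ'⟩ := h3 _ ht'
    refine ⟨(1 + t) ^ N, pow_ne_zero _ ht', τ, fun y ↦ ?_, fun s hs ↦ ?_⟩
    · simpa using hτ y
    · have := hτ' 0 s (by rw [← lie_skew, ha s hs]; simp)
      simpa using this

open LieAlgebra.IsKilling LieModule

/-- The tangent vectors to the scaled stabilizer of a toral set span all derivations coming
from its centralizer. -/
theorem ad_mem_span_isTangent [CharZero K] [IsAlgClosed K] [FiniteDimensional K L] [IsKilling K L]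
    (H : LieSubalgebra K L) [H.IsCartanSubalgebra] {S : Set L} (hS : ∀ s ∈ S, s ∈ H) {a : L}
    (ha : a ∈ centralizer K S) :
    ad K L a ∈ Submodule.span K {D | IsTangent (scaledStabilizer K S) D} := by
  set E := Submodule.span K {D | IsTangent (scaledStabilizer K S) D}
  have hHH : ∀ x ∈ H, ∀ y ∈ H, ⁅x, y⁆ = 0 := fun x hx y hy ↦
    congrArg Subtype.val (trivial_lie_zero H H ⟨x, hx⟩ ⟨y, hy⟩)
  have hHC : ∀ x ∈ H, x ∈ centralizer K S := fun x hx s hs ↦ hHH s (hS s hs) x hx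
  have hcor : ∀ α : H.root, ad K L (coroot α.1 : L) ∈ E := by
    intro α
    obtain ⟨N, hN⟩ := isTangent_add_ad_of_integral (K := K) (hHC _ (coroot α.1).2) (by
      rw [eq_top_iff, ← LieSubmodule.top_toSubmodule (R := K) (L := H) (M := L),
        ← iSup_genWeightSpace_eq_top' K H L,
        LieSubmodule.iSup_toSubmodule, iSup_le_iff]
      intro β
      refine le_trans (fun y hy ↦ ?_) (le_iSup _ ((chainBotCoeff α.1 β : ℤ) - chainTopCoeff α.1 β))
      rw [mem_eigenspace_iff, ad_apply]
      have h1 := lie_eq_smul_of_mem_rootSpace hy (coroot α.1)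
      rw [apply_coroot_eq_cast] at h1
      exact h1)
    have h1 : (N : K) • (1 : End K L) ∈ E := E.smul_mem _ (Submodule.subset_span (isTangent_one S))
    simpa using E.sub_mem (Submodule.subset_span hN) h1
  have hHE : ∀ x ∈ H, ad K L x ∈ E := by
    intro x hx
    have h1 : (⟨x, hx⟩ : H) ∈ Submodule.span K (Set.range (rootSystem H).coroot) := by
      rw [RootPairing.IsRootSystem.span_coroot_eq_top (P := rootSystem H)]; trivial
    have h2 : Submodule.span K (Set.range (rootSystem H).coroot) ≤
        E.comap ((ad K L : L →ₗ[K] End K L) ∘ₗ H.subtype) := by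
      rw [Submodule.span_le]
      rintro _ ⟨i, rfl⟩
      exact hcor i
    exact h2 h1
  let C : LieSubmodule K H L :=
    { (centralizer K S).toSubmodule with
      lie_mem := fun {x y} hy s hs ↦ by
        change ⁅s, ⁅(x : L), y⁆⁆ = 0
        rw [leibniz_lie, hHC x x.2 s hs, hy s hs]
        simp }
  have hC : ∀ y : C, ad K L (y : L) ∈ E := by
    intro y
    have hy : y ∈ ⨆ χ : LieModule.Weight K H C, genWeightSpace C χ := by
      simp [iSup_genWeightSpace_eq_top' K H C]
    induction hy using LieSubmodule.iSup_induction' with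
    | zero => simp
    | add y y' _ _ h h' => simpa using E.add_mem h h'
    | mem χ y hy =>
      have hy' : (y : L) ∈ rootSpace H χ :=
        map_genWeightSpace_le (f := C.incl) ((LieSubmodule.mem_map _).mpr ⟨y, hy, rfl⟩)
      rcases eq_or_ne (χ : H → K) 0 with h0 | h0
      · rw [h0] at hy'
        exact hHE _ (by simpa using hy')
      · exact Submodule.subset_span (isTangent_ad_of_isNilpotent y.2
          (isNilpotent_ad_of_mem_rootSpace H h0 hy'))
  exact hC ⟨a, ha⟩

end Stabilizer

section Main

variable {K L : Type*} [Field K] [LieRing L] [LieAlgebra K L]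

theorem lieEquiv_exp_apply_of_lie_lie_lie_eq_zero {a : L} {m : ℕ} {e : L ≃ₗ⁅K⁆ L}
    (he : ∀ y, e y = ∑ i ∈ Finset.range (m + 3), ((i.factorial : K)⁻¹) • (ad K L a ^ i) y)
    {y : L} (hy : ⁅a, ⁅a, ⁅a, y⁆⁆⁆ = 0) : e y = y + ⁅a, y⁆ + (2 : K)⁻¹ • ⁅a, ⁅a, y⁆⁆ := by
  have h3 : (ad K L a ^ 3) y = 0 := by simpa [pow_succ] using hy
  rw [he, add_comm m 3, Finset.sum_range_add, Finset.sum_eq_zero (s := Finset.range m)]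
  · simp [Finset.sum_range_succ, pow_two]
  · intro i _
    rw [add_comm 3 i, pow_add, Module.End.mul_apply, h3, map_zero, smul_zero]

/-- The simple reflection attached to an `𝔰𝔩₂`-triple. -/
theorem exists_lieEquiv_apply_eq_neg_of_sl2 [CharZero K] {h e f : L} (hef : ⁅e, f⁆ = h)
    (hhe : ⁅h, e⁆ = (2 : K) • e) (hhf : ⁅h, f⁆ = (-2 : K) • f) (he : IsNilpotent (ad K L e))
    (hf : IsNilpotent (ad K L f)) :
    ∃ w : L ≃ₗ⁅K⁆ L, w f = -e ∧ ∀ s, ⁅s, e⁆ = 0 → ⁅s, f⁆ = 0 → w s = s := by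
  obtain ⟨m, hm⟩ := he
  obtain ⟨k, hk⟩ := hf
  obtain ⟨w, hw⟩ := exists_lieEquiv_eq_exp (K := K) (a := e) (m := m + 3)
    (by rw [pow_add, hm, zero_mul])
  obtain ⟨w', hw'⟩ := exists_lieEquiv_eq_exp (K := K) (a := -f) (m := k + 3)
    (by rw [map_neg, neg_pow, pow_add, pow_add (ad K L f), hk]; simp)
  have hfe : ⁅f, e⁆ = -h := by rw [← lie_skew, hef]
  have heh : ⁅e, h⁆ = (-2 : K) • e := by rw [← lie_skew, hhe, neg_smul]
  have hfh : ⁅f, h⁆ = (2 : K) • f := by rw [← lie_skew, hhf, neg_smul, neg_neg]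
  refine ⟨w.trans w', ?_, fun s hse hsf ↦ ?_⟩
  · have h1 : w f = f + h - e := by
      rw [lieEquiv_exp_apply_of_lie_lie_lie_eq_zero hw (by simp [hef, heh])]
      simp only [hef, heh]
      module
    have h2 : w' f = f := by
      rw [lieEquiv_exp_apply_of_lie_lie_lie_eq_zero hw' (by simp)]
      simp
    have h3 : w' h = h - (2 : K) • f := by
      rw [lieEquiv_exp_apply_of_lie_lie_lie_eq_zero hw' (by simp [hfh])]
      simp only [neg_lie, lie_neg, hfh, lie_smul, lie_self]
      module
    have h4 : w' e = e + h - f := by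
      rw [lieEquiv_exp_apply_of_lie_lie_lie_eq_zero hw' (by simp [hfe, hfh])]
      simp only [neg_lie, lie_neg, hfe, hfh]
      module
    rw [LieEquiv.trans_apply, h1, map_sub, map_add, h2, h3, h4]
    module
  · rw [LieEquiv.trans_apply, lieEquiv_exp_apply_of_lie_eq_zero hw,
      lieEquiv_exp_apply_of_lie_eq_zero hw']
    · rw [neg_lie, ← lie_skew, hsf, neg_zero, neg_zero]
    · rw [← lie_skew, hse, neg_zero]

theorem exists_lieEquiv_smul_apply_eq_neg_of_sl2 [CharZero K] [IsAlgClosed K] {h e f : L} (hef : ⁅e, f⁆ = h)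
    (hhe : ⁅h, e⁆ = (2 : K) • e) (hhf : ⁅h, f⁆ = (-2 : K) • f) (he : IsNilpotent (ad K L e))
    (hf : IsNilpotent (ad K L f)) {c : K} (hc : c ≠ 0) :
    ∃ w : L ≃ₗ⁅K⁆ L, w (c • f) = -e ∧ ∀ s, ⁅s, e⁆ = 0 → ⁅s, f⁆ = 0 → w s = s := by
  obtain ⟨a, ha⟩ := IsAlgClosed.exists_pow_nat_eq c⁻¹ two_pos
  have ha0 : a ≠ 0 := by
    rintro rfl
    exact inv_ne_zero hc (by simpa using ha.symm)
  obtain ⟨w, hw, hws⟩ := exists_lieEquiv_apply_eq_neg_of_sl2 (h := h) (e := a • e) (f := a⁻¹ • f)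
    (by rw [smul_lie, lie_smul, hef, smul_inv_smul₀ ha0])
    (by rw [lie_smul, hhe, smul_comm]) (by rw [lie_smul, hhf, smul_comm])
    (by rw [map_smul]; exact he.smul a) (by rw [map_smul]; exact hf.smul a⁻¹)
  refine ⟨w, ?_, fun s hse hsf ↦ hws s (by rw [lie_smul, hse, smul_zero])
    (by rw [lie_smul, hsf, smul_zero])⟩
  rw [← smul_inv_smul₀ ha0 f, map_smul, map_smul, hw, smul_neg, smul_neg, smul_smul, smul_smul,
    mul_assoc, ← pow_two, ha, mul_inv_cancel₀ hc, one_smul]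

variable [CharZero K] [IsAlgClosed K] [FiniteDimensional K L]

/-- If `[𝔤^S, v] ⊇ V`, the coordinates in `V` of the orbit of `v` under the scaled stabilizer of
`S` contain a nonempty principal open set. -/
theorem exists_scaledStabilizer_orbit [IsKilling K L]
    (H : LieSubalgebra K L) [H.IsCartanSubalgebra] {S : Set L} (hS : ∀ s ∈ S, s ∈ H)
    {n : ℕ} {V : Submodule K L} (π : L →ₗ[K] (Fin n → K)) (hπ : ∀ u, ∃ y ∈ V, π y = u) {v : L}
    (hv : ∀ y ∈ V, ∃ a ∈ centralizer K S, ⁅a, v⁆ = y) :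
    ∃ Q : MvPolynomial (Fin n) K, Q ≠ 0 ∧
      ∀ u, MvPolynomial.eval u Q ≠ 0 → ∃ g ∈ scaledStabilizer K S, π (g v) = u := by
  refine exists_apply_eq_of_span_tangent _ π v (eq_top_iff.mpr fun u _ ↦ ?_)
  obtain ⟨y, hy, rfl⟩ := hπ u
  obtain ⟨a, ha, rfl⟩ := hv y hy
  have h1 := Submodule.mem_map_of_mem (f := π ∘ₗ LinearMap.applyₗ v)
    (ad_mem_span_isTangent H hS ha)
  rw [Submodule.map_span] at h1
  refine Submodule.span_mono ?_ h1
  rintro _ ⟨D, hD, rfl⟩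
  exact ⟨D, hD, rfl⟩

/-- Two vectors of `V` whose scaled stabilizer orbits are infinitesimally all of `V` are conjugate
up to a scalar by an automorphism fixing `S`. -/
theorem exists_lieEquiv_apply_eq_smul [IsKilling K L]
    (H : LieSubalgebra K L) [H.IsCartanSubalgebra] {S : Set L} (hS : ∀ s ∈ S, s ∈ H)
    {V : Submodule K L} (hV : ∀ τ : L ≃ₗ⁅K⁆ L, (∀ s ∈ S, τ s = s) → ∀ y ∈ V, τ y ∈ V) {v w : L}
    (hvV : v ∈ V) (hwV : w ∈ V) (hv : ∀ y ∈ V, ∃ a ∈ centralizer K S, ⁅a, v⁆ = y)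
    (hw : ∀ y ∈ V, ∃ a ∈ centralizer K S, ⁅a, w⁆ = y) :
    ∃ c : K, c ≠ 0 ∧ ∃ τ : L ≃ₗ⁅K⁆ L, τ v = c • w ∧ ∀ s ∈ S, τ s = s := by
  obtain ⟨p, hp⟩ := V.subtype.exists_leftInverse_of_injective V.ker_subtype
  have hp' : ∀ y (hy : y ∈ V), p y = ⟨y, hy⟩ := fun y hy ↦ LinearMap.congr_fun hp ⟨y, hy⟩
  let b := (Module.finBasis K V).equivFun
  let π := b.toLinearMap ∘ₗ p
  have hπ : ∀ u, ∃ y ∈ V, π y = u := fun u ↦ ⟨b.symm u, (b.symm u).2, by simp [π, hp']⟩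
  have hπ' : ∀ y ∈ V, ∀ y' ∈ V, π y = π y' → y = y' := by
    intro y hy y' hy' hyy
    have := b.injective hyy
    rw [hp' y hy, hp' y' hy'] at this
    exact congrArg Subtype.val this
  obtain ⟨Q, hQ, h⟩ := exists_scaledStabilizer_orbit H hS π hπ hv
  obtain ⟨Q', hQ', h'⟩ := exists_scaledStabilizer_orbit H hS π hπ hw
  obtain ⟨u, hu⟩ : ∃ u, MvPolynomial.eval u (Q * Q') ≠ 0 := by
    by_contra! hall
    exact mul_ne_zero hQ hQ' (MvPolynomial.funext fun u ↦ by rw [hall, map_zero])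
  rw [map_mul] at hu
  obtain ⟨g, ⟨c, hc, τ, hτ, hτS⟩, hgu⟩ := h u (left_ne_zero_of_mul hu)
  obtain ⟨g', ⟨c', hc', τ', hτ', hτS'⟩, hgu'⟩ := h' u (right_ne_zero_of_mul hu)
  rw [hτ] at hgu
  rw [hτ'] at hgu'
  have heq := hπ' _ (V.smul_mem c (hV τ hτS v hvV)) _ (V.smul_mem c' (hV τ' hτS' w hwV))
    (hgu.trans hgu'.symm)
  refine ⟨c⁻¹ * c', mul_ne_zero (inv_ne_zero hc) hc', τ.trans τ'.symm, ?_, fun s hs ↦ ?_⟩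
  · rw [LieEquiv.trans_apply, ← inv_smul_smul₀ hc (τ v), heq, map_smul, map_smul,
      LieEquiv.symm_apply_apply, smul_smul]
  · rw [LieEquiv.trans_apply, hτS s hs]
    nth_rewrite 1 [← hτS' s hs]
    exact LieEquiv.symm_apply_apply τ' s

theorem exists_lieEquiv_apply_eq_neg_self [IsSimple K L] (x : L) :
    ∃ α : L ≃ₗ⁅K⁆ L, α x = -x := by
  obtain ⟨s, n, rfl, hs, hn, hsx⟩ := exists_jordan_decomposition (K := K) x
  have hsn : ⁅s, n⁆ = 0 := by
    have := lie_eq_smul_of_mem_adjoin_of_isNilpotent (x := s + n) (s := s) (y := s + n) (c := 0) hs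
      (by simpa using hn) hsx (by simp)
    simpa using this
  obtain ⟨h, f, hnf, hhn, hhf, hsh, hsf⟩ := exists_sl2_of_isNilpotent hs hn hsn
  obtain ⟨h', m, rfl, hh', hm, hh'm⟩ := exists_jordan_decomposition (K := K) h
  have key : ∀ (c : K) y, ⁅h' + m, y⁆ = c • y → ⁅h', y⁆ = c • y := fun c y ↦
    lie_eq_smul_of_mem_adjoin_of_isNilpotent hh' (by simpa using hm) hh'm
  have hh'n := key _ _ hhn
  have hh'f := key _ _ hhf
  have hh's : ⁅h', s⁆ = 0 := by
    simpa using key 0 s (by rw [← lie_skew, hsh]; simp)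
  have hsh' : ⁅s, h'⁆ = 0 := by rw [← lie_skew, hh's, neg_zero]
  obtain ⟨H, _, hH⟩ := exists_isCartanSubalgebra_superset (K := K) (S := {s, h'})
    (by simp [hs, hh']) (by simp [hsh', hh's])
  obtain ⟨θ, hθ⟩ := exists_lieEquiv_apply_eq_neg H
  have hθs : θ s = -s := hθ s (hH s (by simp))
  have hθh' : θ h' = -h' := hθ h' (hH h' (by simp))
  let V : Submodule K L := (ad K L s).eigenspace 0 ⊓ (ad K L h').eigenspace (-2)
  have hV : ∀ y, y ∈ V ↔ ⁅s, y⁆ = 0 ∧ ⁅h', y⁆ = (-2 : K) • y := fun y ↦ by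
    simp [V]
  have hfn : IsNilpotent (ad K L f) := by
    refine isNilpotent_of_commutator_eq_smul (H := ad K L (h' + m)) (c := (-2 : K)) (by simp) ?_
    rw [ad_mul_ad, hhf, map_smul, add_sub_cancel_left]
  obtain ⟨c, hc, τ, hτ, hτS⟩ : ∃ c : K, c ≠ 0 ∧ ∃ τ : L ≃ₗ⁅K⁆ L, τ (θ n) = c • f ∧
      ∀ t ∈ ({s, h'} : Set L), τ t = t := by
    refine exists_lieEquiv_apply_eq_smul H hH (V := V) ?_ ?_ ?_ ?_ ?_
    · intro σ hσ y hy
      rw [hV] at hy ⊢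
      have h1 := hσ s (by simp)
      have h2 := hσ h' (by simp)
      constructor
      · nth_rewrite 1 [← h1]
        rw [← LieEquiv.map_lie, hy.1, map_zero]
      · nth_rewrite 1 [← h2]
        rw [← LieEquiv.map_lie, hy.2, map_smul]
    · rw [hV, ← neg_neg s, ← hθs, ← neg_neg h', ← hθh']
      simp only [neg_lie, ← LieEquiv.map_lie, hsn, hh'n, map_zero, neg_zero, true_and]
      rw [map_smul, neg_smul]
    · exact (hV f).mpr ⟨hsf, hh'f⟩
    · intro y hy
      rw [hV] at hy
      have hθ' : ∀ z, ⁅z, θ.symm y⁆ = θ.symm ⁅θ z, y⁆ := fun z ↦ by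
        rw [LieEquiv.map_lie, LieEquiv.symm_apply_apply]
      obtain ⟨a, ha1, ha2, ha3⟩ := exists_lie_eq_of_weight_two hnf hhn hhf hs hsn hsh' hh'
        (by simpa using hm) hh'm (y := θ.symm y) (by rw [hθ', hθs, neg_lie, hy.1]; simp)
        (by rw [hθ', hθh', neg_lie, hy.2, neg_smul, neg_neg, map_smul])
      refine ⟨-θ a, ?_, ?_⟩
      · rw [mem_centralizer]
        simp only [Set.mem_insert_iff, Set.mem_singleton_iff, forall_eq_or_imp, forall_eq]
        rw [← neg_neg s, ← hθs, ← neg_neg h', ← hθh']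
        simp only [neg_lie, lie_neg, ← LieEquiv.map_lie, ha1, ha2, map_zero, neg_zero, and_self]
      · rw [neg_lie, lie_skew, ← LieEquiv.map_lie, ha3, LieEquiv.apply_symm_apply]
    · intro y hy
      rw [hV] at hy
      obtain ⟨a, ha1, ha2, ha3⟩ := exists_lie_eq_of_weight_two (e := f) (f := n) (h := -(h' + m))
        (h' := -h') (y := y) (by rw [← lie_skew, hnf]) (by rw [neg_lie, hhf, neg_smul, neg_neg])
        (by rw [neg_lie, hhn, neg_smul]) hs hsf (by rw [lie_neg, hsh', neg_zero])
        (by rw [map_neg]; exact isSemisimple_neg.mpr hh')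
        (by rw [neg_sub_neg, sub_add_cancel_left, map_neg]; exact hm.neg)
        (by
          rw [map_neg, map_neg]
          refine neg_mem (Algebra.adjoin_le ?_ hh'm)
          rw [Set.singleton_subset_iff]
          exact neg_mem_iff.mp (Algebra.subset_adjoin (Set.mem_singleton _)))
        hy.1 (by rw [neg_lie, hy.2, neg_smul, neg_neg])
      refine ⟨-a, ?_, by rw [neg_lie, lie_skew, ha3]⟩
      rw [mem_centralizer]
      simp only [Set.mem_insert_iff, Set.mem_singleton_iff, forall_eq_or_imp, forall_eq]
      rw [neg_lie, neg_eq_zero] at ha2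
      rw [lie_neg, lie_neg, ha1, ha2, neg_zero]
      exact ⟨rfl, rfl⟩
  obtain ⟨w, hw, hws⟩ := exists_lieEquiv_smul_apply_eq_neg_of_sl2 hnf hhn hhf hn hfn hc
  refine ⟨(θ.trans τ).trans w, ?_⟩
  rw [LieEquiv.trans_apply, LieEquiv.trans_apply, map_add, map_add, map_add, hτ, hw, hθs,
    map_neg, map_neg, hτS s (by simp), hws s hsn hsf, neg_add]

end Main

end NegIdLocalAut

theorem neg_id_isLocalAutomorphism
    (K L : Type*) [Field K] [IsAlgClosed K] [CharZero K]
    [LieRing L] [LieAlgebra K L] [FiniteDimensional K L] [LieAlgebra.IsSimple K L] :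
    IsLocalAutomorphism K L (-(LinearMap.id : L →ₗ[K] L)) ∧
      ∀ x : L, ∃ α : L ≃ₗ⁅K⁆ L, α x = -x := by
  have h : ∀ x : L, ∃ α : L ≃ₗ⁅K⁆ L, α x = -x :=
    NegIdLocalAut.exists_lieEquiv_apply_eq_neg_self
  exact ⟨fun x ↦ (h x).imp fun _ hα ↦ hα.symm, h⟩
end

section
/- Let g be a finite-dimensional simple Lie algebra over an algebraically closed field K of characteristic 0. Every anti-automorphism of g is a local automorphism of g. -/
section

open LieAlgebra LieModule Module
open LieAlgebra.IsKilling

section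
variable {K L : Type*} [Field K] [CharZero K] [LieRing L] [LieAlgebra K L]
  [IsKilling K L] [FiniteDimensional K L]
  {H : LieSubalgebra K L} [H.IsCartanSubalgebra] [IsTriangularizable K H L]

lemma exists_smul_lie_eq_of_mem_rootSpace_add {α β γ : Weight K H L} (hα : α.IsNonZero)
    (hγ : γ.IsNonZero) (hadd : (γ : H → K) = α + β) {h e f : L} (t : IsSl2Triple h e f)
    (he : e ∈ rootSpace H α) (hf : f ∈ rootSpace H (-α)) {y : L} (hy : y ∈ rootSpace H γ) :
    ∃ x ∈ rootSpace H β, y = ⁅e, x⁆ := by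
  obtain rfl := t.h_eq_coroot hα he hf
  obtain ⟨x, hx, x_ne0⟩ := (chainTop α β).exists_ne_zero
  have prim : t.HasPrimitiveVectorWith x (chainLength α β : K) :=
    have := lie_mem_genWeightSpace_of_mem_genWeightSpace he hx
    ⟨x_ne0, (chainLength_smul _ _ hx).symm, by rwa [genWeightSpace_add_chainTop _ _ hα] at this⟩
  have h1 : 1 ≤ chainTopCoeff α β := by
    have := ((rootSpace_zsmul_add_ne_bot_iff α β hα 1).1 (by
      rw [one_smul, ← hadd]; exact γ.genWeightSpace_ne_bot)).1
    exact_mod_cast this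
  have h2 := chainTopCoeff_le_chainLength α β
  obtain ⟨T, hT⟩ := Nat.exists_eq_add_of_le' h1
  set z := ((toEnd K L L f) ^ (T + 1)) x with hz
  have hzmem : z ∈ rootSpace H β := by
    have := toEnd_pow_apply_mem hf hx (T + 1)
    convert this using 2
    rw [coe_chainTop', hT]; simp
  have hez : ⁅e, z⁆ = ((T + 1) * (chainLength α β - T : K)) • ((toEnd K L L f) ^ T) x :=
    prim.lie_e_pow_succ_toEnd_f T
  have hne : ⁅e, z⁆ ≠ 0 := by
    rw [hez]
    refine smul_ne_zero (mul_ne_zero (Nat.cast_add_one_ne_zero T) ?_)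
      (prim.pow_toEnd_f_ne_zero_of_eq_nat rfl (by omega))
    rw [sub_ne_zero]
    norm_cast
    omega
  have hmem : ⁅e, z⁆ ∈ rootSpace H γ := by
    rw [hadd]; exact lie_mem_genWeightSpace_of_mem_genWeightSpace he hzmem
  obtain ⟨c, hc⟩ := (finrank_eq_one_iff_of_nonzero' (⟨⁅e, z⁆, hmem⟩ : rootSpace H γ)
    (by simpa [LieSubmodule.mk_eq_zero] using hne)).mp (finrank_rootSpace_eq_one _ hγ) ⟨y, hy⟩
  refine ⟨c • z, (rootSpace H β).smul_mem c hzmem, ?_⟩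
  rw [lie_smul]
  exact (congrArg Subtype.val hc).symm
end

section
variable (K L : Type*) [Field K] [CharZero K] [LieRing L] [LieAlgebra K L]
  [IsKilling K L] [FiniteDimensional K L]
  (H : LieSubalgebra K L) [H.IsCartanSubalgebra] [IsTriangularizable K H L]

theorem exists_basis_of_isCartanSubalgebra :
    ∃ b : (rootSystem H).Base, Nonempty (LieAlgebra.Basis b.support H) := by
  classical
  obtain ⟨b⟩ := RootPairing.nonempty_base (rootSystem H)
  have nz (i : H.root) : (i : Weight K H L).IsNonZero := LieSubalgebra.isNonZero_coe_root i
  choose h e f t he hf using fun i : b.support ↦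
    exists_isSl2Triple_of_weight_isNonZero (nz i)
  have hh (i : b.support) : h i = coroot (i.1 : Weight K H L) :=
    (t i).h_eq_coroot (nz i) (he i) (hf i)
  have hpair (i j : b.support) :
      ((i.1 : Weight K H L) (coroot (j.1 : Weight K H L)) : K) = (b.cartanMatrix i j : ℤ) := by
    have := b.algebraMap_cartanMatrixIn_apply ℤ i j
    simpa using this.symm
  set S := LieSubalgebra.lieSpan K L (Set.range e ∪ Set.range f) with hS
  have heS (i) : e i ∈ S := LieSubalgebra.subset_lieSpan (.inl ⟨i, rfl⟩)
  have hfS (i) : f i ∈ S := LieSubalgebra.subset_lieSpan (.inr ⟨i, rfl⟩)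
  have hhS (i) : h i ∈ S := by rw [← (t i).lie_e_f]; exact S.lie_mem (heS i) (hfS i)
  have hspan : H.toSubmodule = Submodule.span K (Set.range h) := by
    have h1 : Submodule.span K ((rootSystem H).coroot '' b.support) = ⊤ := by
      rw [b.span_coroot_support]
      exact RootPairing.IsRootSystem.span_coroot_eq_top
    have h2 : H.toSubmodule = (⊤ : Submodule K H).map H.toSubmodule.subtype := by
      simp
    rw [h2, ← h1, Submodule.map_span, ← Set.image_comp]
    congr 1
    ext x
    simp [hh]
  have one_dim (i : H.root) (x y : L) (hx : x ∈ rootSpace H (i : Weight K H L)) (hx0 : x ≠ 0)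
      (hy : y ∈ rootSpace H (i : Weight K H L)) : ∃ c : K, y = c • x := by
    obtain ⟨c, hc⟩ := (finrank_eq_one_iff_of_nonzero' (⟨x, hx⟩ : rootSpace H (i : Weight K H L))
      (by simpa [LieSubmodule.mk_eq_zero] using hx0)).mp
      (finrank_rootSpace_eq_one _ (nz i)) ⟨y, hy⟩
    exact ⟨c, (congrArg Subtype.val hc).symm⟩
  have hroots (i : H.root) : (∀ x ∈ rootSpace H (i : Weight K H L), x ∈ S) ∧
      ∀ x ∈ rootSpace H (-(i : Weight K H L) : H → K), x ∈ S := by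
    have hneg (i j : H.root) (hij : (rootSystem H).root j = -(rootSystem H).root i) :
        ((j : Weight K H L) : H → K) = -(i : Weight K H L) := by
      ext x; simpa using LinearMap.congr_fun hij x
    refine b.induction_add i (p := fun i ↦ (∀ x ∈ rootSpace H (i : Weight K H L), x ∈ S) ∧
      ∀ x ∈ rootSpace H (-(i : Weight K H L) : H → K), x ∈ S) ?_ ?_ ?_
    · rintro i ⟨h1, h2⟩
      have := hneg i ((rootSystem H).reflectionPerm i i)
          (by rw [RootPairing.root_reflectionPerm, RootPairing.reflection_apply_self])
      rw [this, neg_neg]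
      exact ⟨h2, h1⟩
    · intro i hi
      constructor
      · intro x hx
        obtain ⟨c, rfl⟩ := one_dim i _ x (he ⟨i, hi⟩) (t _).e_ne_zero hx
        exact S.smul_mem c (heS _)
      · intro x hx
        have h3 := hneg i ((rootSystem H).reflectionPerm i i)
          (by rw [RootPairing.root_reflectionPerm, RootPairing.reflection_apply_self])
        obtain ⟨c, rfl⟩ := one_dim ((rootSystem H).reflectionPerm i i) (f ⟨i, hi⟩) x
          (by rw [h3]; exact hf ⟨i, hi⟩) (t _).f_ne_zero (by rw [h3]; exact hx)
        exact S.smul_mem c (hfS _)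
    · rintro i j k hk ⟨h1, h2⟩ hj
      have hk' : ((k : Weight K H L) : H → K) = (j : Weight K H L) + (i : Weight K H L) := by
        ext x; simpa [add_comm] using LinearMap.congr_fun hk x
      constructor
      · intro x hx
        obtain ⟨y, hy, rfl⟩ := exists_smul_lie_eq_of_mem_rootSpace_add (nz j) (nz k) hk'
          (t ⟨j, hj⟩) (he ⟨j, hj⟩) (hf ⟨j, hj⟩) hx
        exact S.lie_mem (heS _) (h1 y hy)
      · intro x hx
        have hk2 : ((-(k : Weight K H L) : Weight K H L) : H → K) =
            (-(j : Weight K H L) : Weight K H L) + (-(i : Weight K H L) : Weight K H L) := by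
          simp only [Weight.coe_neg, hk', neg_add]
        obtain ⟨y, hy, rfl⟩ := exists_smul_lie_eq_of_mem_rootSpace_add (nz j).neg (nz k).neg hk2
          (t ⟨j, hj⟩).symm (by simpa using hf ⟨j, hj⟩) (by simpa using he ⟨j, hj⟩)
          (by simpa using hx)
        exact S.lie_mem (hfS _) (h2 y (by simpa using hy))
  have hHS : ∀ x ∈ H, x ∈ S := by
    intro x hx
    have hx : x ∈ H.toSubmodule := hx
    rw [hspan] at hx
    exact Submodule.span_le.2 (by rintro _ ⟨i, rfl⟩; exact hhS i) hx
  have htop : S = ⊤ := by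
    rw [eq_top_iff]
    intro x _
    have hx : x ∈ (⊤ : LieSubmodule K H L).toSubmodule := trivial
    rw [← cartan_sup_iSup_rootSpace_eq_top H] at hx
    simp only [LieSubmodule.sup_toSubmodule, LieSubmodule.iSup_toSubmodule] at hx
    have hle : H.toLieSubmodule.toSubmodule ⊔ ⨆ α : Weight K H L, ⨆ (_ : α.IsNonZero),
        (rootSpace H α).toSubmodule ≤ S.toSubmodule := by
      refine sup_le (fun y hy ↦ hHS y (by simpa using hy)) (iSup₂_le fun α hα y hy ↦ ?_)
      exact (hroots ⟨α, by simpa using hα⟩).1 y hy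
    exact hle hx
  refine ⟨b, ⟨{
    A := b.cartanMatrix
    h := h
    e := e
    f := f
    cartan_eq_lieSpan := ?_
    span_ef := htop
    linInd := ?_
    nondegen := b.cartanMatrix_nondegenerate
    sl2 := t
    lie_h_h := ?_
    lie_h_e := ?_
    lie_h_f := ?_
    lie_e_f_ne := ?_ }⟩⟩
  · apply le_antisymm
    · intro x hx
      have hx : x ∈ H.toSubmodule := hx
      rw [hspan] at hx
      exact LieSubalgebra.submodule_span_le_lieSpan hx
    · rw [LieSubalgebra.lieSpan_le]
      rintro _ ⟨i, rfl⟩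
      rw [hh]; exact (coroot _).2
  · have h1 := b.linearIndepOn_coroot
    have h2 := h1.linearIndependent.map' H.toSubmodule.subtype
      (LinearMap.ker_eq_bot.2 Subtype.coe_injective)
    convert! h2 using 1
    ext i
    simp [hh]
    rfl
  · intro i j
    rw [hh, hh, ← LieSubalgebra.coe_bracket, trivial_lie_zero, ZeroMemClass.coe_zero]
  · intro i j
    have := lie_eq_smul_of_mem_rootSpace (he i) (coroot (j.1 : Weight K H L))
    rw [hh, ← LieSubalgebra.coe_bracket_of_module, this, hpair, Int.cast_smul_eq_zsmul]
  · intro i j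
    have := lie_eq_smul_of_mem_rootSpace (hf i) (coroot (j.1 : Weight K H L))
    rw [hh, ← LieSubalgebra.coe_bracket_of_module, this, Pi.neg_apply, hpair, neg_smul, neg_smul,
      Int.cast_smul_eq_zsmul]
  · intro i j hij
    by_contra hne
    have hm := lie_mem_genWeightSpace_of_mem_genWeightSpace (he i) (hf j)
    have hnb : rootSpace H (((i.1 : Weight K H L) : H → K) + -(j.1 : Weight K H L)) ≠ ⊥ := by
      intro hb
      have hm : ⁅e i, f j⁆ ∈
          rootSpace H (((i.1 : Weight K H L) : H → K) + -(j.1 : Weight K H L)) := hm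
      rw [hb] at hm
      exact hne (by simpa using hm)
    let w : Weight K H L := ⟨_, hnb⟩
    by_cases hw : w.IsZero
    · have : (i.1 : Weight K H L) = j.1 := by
        ext x
        have := congrFun hw x
        simpa [w, sub_eq_zero, ← sub_eq_add_neg] using this
      exact hij (Subtype.ext (Subtype.ext this))
    · refine b.sub_notMem_range_root i.2 j.2 ⟨⟨w, by simpa using hw⟩, ?_⟩
      ext x
      simp [w, sub_eq_add_neg]
end

theorem LieAlgebra.Basis.equivOfReindex_symm_h {K ι L : Type*} [Finite ι] [Field K] [CharZero K]
    [LieRing L] [LieAlgebra K L] [FiniteDimensional K L] [IsSimple K L]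
    {H : LieSubalgebra K L} (b : LieAlgebra.Basis ι H)
    (h : b.A.reindex (Equiv.refl ι) (Equiv.refl ι) = b.symm.A) (i : ι) :
    b.equivOfReindex (Equiv.refl ι) b.symm h (b.h i) = -b.h i := by
  have key (M : LieSubalgebra K (L × L)) (e₁ e₂ : M ≃ₗ⁅K⁆ L) (h₁ : ∀ m, e₁ m = m.1.1)
      (h₂ : ∀ m, e₂ m = m.1.2) (hm : (b.h i, -b.h i) ∈ M) :
      (e₁.symm.trans e₂) (b.h i) = -b.h i := by
    have : e₁.symm (b.h i) = ⟨_, hm⟩ := by rw [LieEquiv.symm_apply_eq, h₁]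
    rw [LieEquiv.trans_apply, this, h₂]
  refine key _ _ _ (fun _ ↦ rfl) (fun _ ↦ rfl) (LieSubalgebra.subset_lieSpan ?_)
  exact .inl (.inl ⟨i, rfl⟩)

/-- The Chevalley involution: some automorphism acts as `-1` on a given Cartan subalgebra. -/
theorem exists_lieEquiv_eq_neg_of_isCartanSubalgebra {K L : Type*} [Field K] [IsAlgClosed K]
    [CharZero K] [LieRing L] [LieAlgebra K L] [FiniteDimensional K L] [IsSimple K L]
    (H : LieSubalgebra K L) [H.IsCartanSubalgebra] :
    ∃ c : L ≃ₗ⁅K⁆ L, ∀ x ∈ H, c x = -x := by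
  obtain ⟨_, ⟨b⟩⟩ := exists_basis_of_isCartanSubalgebra K L H
  have h : b.A.reindex (Equiv.refl _) (Equiv.refl _) = b.symm.A := rfl
  refine ⟨b.equivOfReindex (Equiv.refl _) b.symm h, fun x hx ↦ ?_⟩
  replace hx : x ∈ H.toSubmodule := hx
  rw [b.coe_cartan_eq_span] at hx
  induction hx using Submodule.span_induction with
  | mem y hy => obtain ⟨i, rfl⟩ := hy; exact b.equivOfReindex_symm_h h i
  | zero => simp
  | add y z _ _ hy hz => rw [map_add, hy, hz, neg_add]
  | smul a y _ hy => rw [map_smul, hy, smul_neg]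

theorem LieAlgebra.nontrivial_of_isSimple (K L : Type*) [CommRing K] [LieRing L] [LieAlgebra K L]
    [IsSimple K L] : Nontrivial L := by
  by_contra h
  rw [not_nontrivial_iff_subsingleton] at h
  exact LieAlgebra.IsSimple.non_abelian K (L := L) ⟨fun _ _ ↦ Subsingleton.elim _ _⟩

section
attribute [local instance] LieRing.ofAssociativeRing
variable {K L : Type*} [Field K] [IsAlgClosed K] [CharZero K] [LieRing L] [LieAlgebra K L]
  [FiniteDimensional K L] [IsSimple K L]

omit [CharZero K] in
/-- Schur's lemma for the adjoint representation of a simple Lie algebra. -/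
theorem exists_eq_smul_one_of_commute_ad (C : End K L) (hC : ∀ y, Commute C (ad K L y)) :
    ∃ c : K, C = c • 1 := by
  have : Nontrivial L := nontrivial_of_isSimple K L
  obtain ⟨c, hc⟩ := Module.End.exists_eigenvalue C
  let I : LieIdeal K L :=
    { C.eigenspace c with
      lie_mem := by
        intro x m hm
        have hm : m ∈ C.eigenspace c := hm
        change ⁅x, m⁆ ∈ C.eigenspace c
        rw [Module.End.mem_eigenspace_iff] at hm ⊢
        have := LinearMap.congr_fun (hC x).eq m
        simp only [Module.End.mul_apply, ad_apply] at this
        rw [this, hm, lie_smul] }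
  have hI : I = ⊤ := by
    refine (LieAlgebra.IsSimple.eq_bot_or_eq_top I).resolve_left fun h ↦ ?_
    obtain ⟨v, hv⟩ := hc.exists_hasEigenvector
    have : v ∈ I := hv.1
    rw [h] at this
    exact hv.2 (by simpa using this)
  refine ⟨c, LinearMap.ext fun v ↦ ?_⟩
  have : v ∈ I := by rw [hI]; trivial
  have : v ∈ C.eigenspace c := this
  simpa [Module.End.mem_eigenspace_iff] using this

omit [IsAlgClosed K] [CharZero K] [FiniteDimensional K L] in
theorem ad_injective_of_isSimple : Function.Injective (ad K L) :=
  (injective_iff_map_eq_zero _).2 fun x hx ↦ by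
    have : x ∈ (ad K L).ker := hx
    rw [ad_ker_eq_self_module_ker, self_module_ker_eq_center, center_eq_bot] at this
    simpa using this

/-- The abstract Jordan decomposition in a simple Lie algebra. -/
theorem exists_jordan_decomposition (x : L) : ∃ s n : L, x = s + n ∧ ⁅s, n⁆ = 0 ∧
    (ad K L s).IsSemisimple ∧ IsNilpotent (ad K L n) ∧
    ∀ (c : K) (y : L), ⁅x, y⁆ = c • y → ⁅s, y⁆ = c • y := by
  obtain rfl | hx0 := eq_or_ne x 0
  · exact ⟨0, 0, by simp, by simp, by simp, by simp, by simp⟩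
  obtain ⟨N, hN, S, hS, hNn, hSs, hx⟩ := (ad K L x).exists_isNilpotent_isSemisimple
  have hcomm : Commute N S :=
    Algebra.commute_of_mem_adjoin_singleton_of_commute hS
      (Algebra.commute_of_mem_adjoin_self hN).symm
  have hSx : Commute S (ad K L x) := (Algebra.commute_of_mem_adjoin_self hS).symm
  have heig : ∀ (c : K) (y : L), ⁅x, y⁆ = c • y → S y = c • y := by
    intro c y hy
    obtain rfl | hy0 := eq_or_ne y 0
    · simp
    have hS' := hS
    rw [Algebra.adjoin_singleton_eq_range_aeval] at hS'
    obtain ⟨p, hp⟩ := hS'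
    have h1 : S y = p.eval c • y := by
      rw [← hp]
      exact Module.End.aeval_apply_of_hasEigenvector ⟨by simpa using hy, hy0⟩
    have h2 : N y = (c - p.eval c) • y := by
      have := LinearMap.congr_fun hx y
      rw [ad_apply, hy, LinearMap.add_apply, h1] at this
      rw [sub_smul, this, add_sub_cancel_right]
    have h3 : Module.End.HasEigenvalue N (c - p.eval c) :=
      Module.End.hasEigenvalue_of_hasEigenvector ⟨by simpa using h2, hy0⟩
    have h4 := h3.isNilpotent_of_isNilpotent hNn
    rw [isNilpotent_iff_eq_zero, sub_eq_zero] at h4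
    rw [h1, ← h4]
  have hz : ∀ y, ∃ z, ⁅S, ad K L y⁆ = ad K L z := by
    have h1 := ad_mem_adjoin_of_isSemisimple hcomm hNn hSs
    rw [← hx] at h1
    let P : Subalgebra K (End K (End K L)) :=
      { carrier := {F | ∀ y, ∃ z, F (ad K L y) = ad K L z}
        mul_mem' := by
          intro F G hF hG y
          obtain ⟨z, hz⟩ := hG y
          obtain ⟨w, hw⟩ := hF z
          exact ⟨w, by rw [Module.End.mul_apply, hz, hw]⟩
        add_mem' := by
          intro F G hF hG y
          obtain ⟨z, hz⟩ := hG y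
          obtain ⟨w, hw⟩ := hF y
          exact ⟨w + z, by rw [LinearMap.add_apply, hz, hw, map_add]⟩
        algebraMap_mem' := fun r y ↦ ⟨r • y, by simp [Module.algebraMap_end_apply]⟩ }
    have h2 : Algebra.adjoin K {ad K (End K L) (ad K L x)} ≤ P := by
      rw [Algebra.adjoin_le_iff, Set.singleton_subset_iff]
      exact fun y ↦ ⟨⁅x, y⁆, by simp⟩
    exact fun y ↦ h2 h1 y
  have inj := ad_injective_of_isSimple (K := K) (L := L)
  choose z hz using hz
  let D : LieDerivation K L L :=
    { toFun := z
      map_add' := fun a b ↦ inj (by simp only [← hz, map_add, lie_add])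
      map_smul' := fun a b ↦ inj (by simp only [← hz, map_smul, RingHom.id_apply, Ring.lie_def,
        mul_smul_comm, smul_mul_assoc, smul_sub])
      leibniz' := fun a b ↦ inj (by
        change ad K L (z ⁅a, b⁆) = ad K L (⁅a, z b⁆ - ⁅b, z a⁆)
        rw [← hz, map_sub, LieHom.map_lie, LieHom.map_lie, LieHom.map_lie, ← hz, ← hz,
          ← lie_skew (ad K L b), leibniz_lie]
        abel) }
  obtain ⟨s, hs⟩ := LieDerivation.IsKilling.exists_eq_ad D
  have hzs (y : L) : z y = ⁅s, y⁆ := by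
    change D y = _
    rw [← hs]
    simp
  obtain ⟨c, hc⟩ := exists_eq_smul_one_of_commute_ad (S - ad K L s) (fun y ↦ by
    rw [commute_iff_lie_eq, sub_lie, hz, hzs, LieHom.map_lie, sub_self])
  have hSx0 : S x = 0 := by rw [heig 0 x (by simp), zero_smul]
  have hSad : S = ad K L s := by
    have hsx : ⁅s, x⁆ = 0 := inj (by rw [← hzs, ← hz, map_zero]; exact hSx.lie_eq)
    have h5 := LinearMap.congr_fun hc x
    simp only [LinearMap.sub_apply, hSx0, ad_apply, hsx, sub_self, LinearMap.smul_apply,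
      Module.End.one_apply] at h5
    rw [(smul_eq_zero.1 h5.symm).resolve_right hx0, zero_smul] at hc
    exact sub_eq_zero.1 hc
  subst hSad
  have hNad : N = ad K L (x - s) := by rw [map_sub, hx, add_sub_cancel_right]
  have hsx : ⁅s, x⁆ = 0 := hSx0
  exact ⟨s, x - s, by abel, by simp [hsx], hSs, hNad ▸ hNn, heig⟩
end

section
variable {K V : Type*} [Field K] [CharZero K] [AddCommGroup V] [Module K V]

theorem pow_succ_mul_eq_of_commute {A B C : Module.End K V} (hC : A * B = B * A + C)
    (hAC : Commute A C) (k : ℕ) :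
    A ^ (k + 1) * B = B * A ^ (k + 1) + (k + 1 : K) • (A ^ k * C) := by
  induction k with
  | zero => simp [hC]
  | succ k ih =>
    rw [pow_succ' A (k + 1), mul_assoc, ih, mul_add, ← mul_assoc, hC, mul_smul_comm, ← mul_assoc,
      ← pow_succ', add_mul, mul_assoc B, ← pow_succ', (hAC.pow_left (k + 1)).eq, add_assoc,
      Nat.cast_add, Nat.cast_one, add_smul (k + 1 : K) 1, one_smul, add_comm (C * _)]

theorem isNilpotent_mul_of_commute_lie {A B C : Module.End K V} (hC : A * B = B * A + C)
    (hAC : Commute A C) (hA : IsNilpotent A) : IsNilpotent (A * B) := by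
  have hCn : ∀ k, (∃ j, A ^ k * C ^ j = 0) → ∃ j, C ^ j = 0 := by
    intro k
    induction k with
    | zero => simp
    | succ k ih =>
      rintro ⟨j, hj⟩
      refine ih ⟨j + 1 + j, ?_⟩
      have h1 : C ^ j * (A ^ (k + 1) * B) * C ^ j = 0 := by
        rw [← mul_assoc, (hAC.pow_pow (k + 1) j).symm.eq, hj, zero_mul, zero_mul]
      rw [pow_succ_mul_eq_of_commute hC hAC, mul_add, add_mul, ← mul_assoc, mul_assoc, hj,
        mul_zero, zero_add, mul_smul_comm, smul_mul_assoc, ← mul_assoc,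
        (hAC.pow_pow k j).symm.eq, mul_assoc (A ^ k), ← pow_succ, mul_assoc, ← pow_add,
        smul_eq_zero] at h1
      exact h1.resolve_left (Nat.cast_add_one_ne_zero k)
  obtain ⟨r, hr⟩ := hA
  obtain ⟨m, hm⟩ := hCn r ⟨0, by rw [hr, zero_mul]⟩
  have hker : ∀ (k : ℕ) v, (A ^ (k + 1)) v = 0 →
      (A ^ k) ((A * B) v) = ((k + 1 : K) • C) ((A ^ k) v) := by
    intro k v hv
    have h1 := LinearMap.congr_fun (pow_succ_mul_eq_of_commute hC hAC k) v
    rw [pow_succ, mul_assoc] at h1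
    rw [Module.End.mul_apply] at h1
    rw [h1, LinearMap.add_apply, ← pow_succ, Module.End.mul_apply, hv, map_zero, zero_add,
      (hAC.pow_left k).eq]
    rfl
  have hpres : ∀ (k : ℕ) v, (A ^ k) v = 0 → (A ^ k) ((A * B) v) = 0 := by
    intro k v hv
    rw [hker k v (by rw [pow_succ', Module.End.mul_apply, hv, map_zero]), hv, map_zero]
  have hpow : ∀ (k j : ℕ) v, (A ^ (k + 1)) v = 0 →
      (A ^ (k + 1)) (((A * B) ^ j) v) = 0 ∧
      (A ^ k) (((A * B) ^ j) v) = (((k + 1 : K) • C) ^ j) ((A ^ k) v) := by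
    intro k j v hv
    induction j with
    | zero => simp [hv]
    | succ j ih =>
      rw [pow_succ' (A * B) j, Module.End.mul_apply (A * B)]
      refine ⟨hpres _ _ ih.1, ?_⟩
      rw [hker _ _ ih.1, ih.2, pow_succ' (_ • C), Module.End.mul_apply (_ • C)]
  have hfin : ∀ k, ∃ M, ∀ v, (A ^ k) v = 0 → ((A * B) ^ M) v = 0 := by
    intro k
    induction k with
    | zero => exact ⟨0, fun v hv ↦ hv⟩
    | succ k ih =>
      obtain ⟨M, hM⟩ := ih
      refine ⟨M + m, fun v hv ↦ ?_⟩
      rw [pow_add, Module.End.mul_apply]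
      refine hM _ ?_
      rw [(hpow k m v hv).2, smul_pow, hm, smul_zero, LinearMap.zero_apply]
  obtain ⟨M, hM⟩ := hfin r
  exact ⟨M, LinearMap.ext fun v ↦ hM v (by rw [hr, LinearMap.zero_apply])⟩

omit [CharZero K] in
theorem Module.End.IsSemisimple.apply_eq_zero_of_apply_apply_eq_zero {S : Module.End K V}
    (hS : S.IsSemisimple) {v : V} (hv : S (S v) = 0) : S v = 0 := by
  obtain ⟨q, hq, hc⟩ := Module.End.isSemisimple_iff.1 hS (LinearMap.ker S) (by
    intro w hw
    have hw : S w = 0 := hw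
    simp [hw])
  obtain ⟨a, ha, b, hb, rfl⟩ := Submodule.mem_sup.1
    (hc.sup_eq_top ▸ Submodule.mem_top : v ∈ LinearMap.ker S ⊔ q)
  rw [map_add, LinearMap.mem_ker.1 ha, zero_add] at hv ⊢
  have : S b ∈ LinearMap.ker S ⊓ q := ⟨hv, hq hb⟩
  simpa [hc.inf_eq_bot] using this

omit [CharZero K] in
theorem Module.End.IsSemisimple.exists_eq_add [FiniteDimensional K V] {S : Module.End K V}
    (hS : S.IsSemisimple) (v : V) : ∃ a w, S a = 0 ∧ v = a + S w := by
  have hd : Disjoint (LinearMap.ker S) (LinearMap.range S) := by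
    rw [Submodule.disjoint_def]
    rintro _ hx ⟨w, rfl⟩
    exact hS.apply_eq_zero_of_apply_apply_eq_zero hx
  have hc := (Submodule.isCompl_iff_disjoint _ _
    (by rw [add_comm, LinearMap.finrank_range_add_finrank_ker])).2 hd
  obtain ⟨a, ha, _, ⟨w, rfl⟩, rfl⟩ := Submodule.mem_sup.1
    (hc.sup_eq_top ▸ Submodule.mem_top : v ∈ LinearMap.ker S ⊔ LinearMap.range S)
  exact ⟨a, w, ha, rfl⟩

omit [CharZero K] in
theorem mul_pow_eq_of_sl2 {A H : Module.End K V} (hHA : H * A = A * H + (2 : K) • A) (k : ℕ) :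
    H * A ^ k = A ^ k * H + (2 * k : K) • A ^ k := by
  induction k with
  | zero => simp
  | succ k ih =>
    rw [pow_succ, ← mul_assoc, ih, add_mul, mul_assoc, hHA, mul_add, smul_mul_assoc,
      mul_smul_comm, ← mul_assoc, add_assoc, ← add_smul]
    push_cast
    congr 2
    ring

omit [CharZero K] in
theorem pow_succ_mul_eq_of_sl2 {A H Y : Module.End K V} (hAY : A * Y = Y * A + H)
    (hHA : H * A = A * H + (2 : K) • A) (k : ℕ) :
    A ^ (k + 1) * Y = Y * A ^ (k + 1) + (k + 1 : K) • (H * A ^ k - (k : K) • A ^ k) := by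
  induction k with
  | zero => simp [hAY]
  | succ k ih =>
    rw [pow_succ' A (k + 1), mul_assoc, ih, mul_add, ← mul_assoc, hAY, mul_smul_comm, mul_sub,
      ← mul_assoc A H, eq_sub_of_add_eq hHA.symm, mul_smul_comm, ← pow_succ', add_mul, mul_assoc Y,
      ← pow_succ', sub_mul, mul_assoc H, ← pow_succ', smul_mul_assoc, ← pow_succ']
    push_cast
    module
end

section
variable {K L : Type*} [Field K] [CharZero K] [LieRing L] [LieAlgebra K L]
  [FiniteDimensional K L] [IsSimple K L]

omit [CharZero K] [FiniteDimensional K L] [IsSimple K L] in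
theorem ad_mul_ad (x y : L) : ad K L x * ad K L y = ad K L y * ad K L x + ad K L ⁅x, y⁆ := by
  ext w
  simp only [Module.End.mul_apply, LinearMap.add_apply, ad_apply]
  rw [leibniz_lie x y w, add_comm]

theorem exists_lie_lie_eq_of_isNilpotent_ad {n : L} (hn : IsNilpotent (ad K L n)) :
    ∃ y : L, ⁅n, ⁅n, y⁆⁆ = n := by
  set B := killingForm K L
  have hBn : B.Nondegenerate := LieAlgebra.IsKilling.killingForm_nondegenerate K L
  have hBr : B.IsRefl := (LieModule.traceForm_isSymm K L L).isRefl
  have hinv (x y z : L) : B ⁅x, y⁆ z = -B y ⁅x, z⁆ := by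
    rw [← lie_skew, map_neg, LinearMap.neg_apply]
    exact congrArg _ (LieModule.traceForm_apply_lie_apply K L L y x z)
  set W := LinearMap.range (ad K L n * ad K L n)
  have hW : n ∈ B.orthogonal (B.orthogonal W) := by
    rw [LinearMap.BilinForm.mem_orthogonal_iff]
    intro w hw
    rw [LinearMap.BilinForm.mem_orthogonal_iff] at hw
    have h1 : ⁅n, ⁅n, w⁆⁆ = 0 := by
      refine hBn.2 _ fun a ↦ ?_
      have : B ⁅n, ⁅n, a⁆⁆ w = 0 := hw _ ⟨a, rfl⟩
      rw [hinv, hinv, neg_neg] at this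
      exact this
    change B w n = 0
    rw [show B w n = B n w from LieModule.traceForm_comm K L L w n]
    have h2 : IsNilpotent (ad K L n * ad K L w) := by
      refine isNilpotent_mul_of_commute_lie (ad_mul_ad n w) ?_ hn
      rw [commute_iff_eq, ad_mul_ad, h1, map_zero, add_zero]
    exact (LinearMap.isNilpotent_trace_of_isNilpotent h2).eq_zero
  rw [LinearMap.BilinForm.orthogonal_orthogonal hBn hBr] at hW
  exact hW

/-- The Jacobson-Morozov theorem inside the centralizer of a semisimple element. -/
theorem exists_sl2_of_isNilpotent_ad {s n : L} (hs : (ad K L s).IsSemisimple)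
    (hn : IsNilpotent (ad K L n)) (hsn : ⁅s, n⁆ = 0) :
    ∃ h f : L, ⁅n, f⁆ = h ∧ ⁅h, n⁆ = (2 : K) • n ∧ ⁅h, f⁆ = -((2 : K) • f) ∧
      ⁅s, h⁆ = 0 ∧ ⁅s, f⁆ = 0 := by
  have hs0 : ∀ v : L, ⁅s, ⁅s, v⁆⁆ = 0 → ⁅s, v⁆ = 0 := fun v hv ↦
    hs.apply_eq_zero_of_apply_apply_eq_zero hv
  obtain ⟨y, hsy, hy⟩ : ∃ y : L, ⁅s, y⁆ = 0 ∧ ⁅n, ⁅n, y⁆⁆ = -((2 : K) • n) := by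
    obtain ⟨y, hy⟩ := exists_lie_lie_eq_of_isNilpotent_ad (K := K) hn
    obtain ⟨a, w, ha, rfl⟩ := hs.exists_eq_add y
    replace ha : ⁅s, a⁆ = 0 := ha
    rw [ad_apply] at hy
    have hns (v : L) : ⁅n, ⁅s, v⁆⁆ = ⁅s, ⁅n, v⁆⁆ := by
      rw [leibniz_lie s n, hsn, zero_lie, zero_add]
    have h1 : ⁅n, ⁅n, a⁆⁆ + ⁅s, ⁅n, ⁅n, w⁆⁆⁆ = n := by
      rw [← hns, ← hns, ← lie_add, ← lie_add, hy]
    have h2 : ⁅s, ⁅n, ⁅n, w⁆⁆⁆ = 0 := by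
      refine hs0 _ ?_
      rw [eq_sub_of_add_eq' h1, lie_sub, hsn, ← hns, ← hns, ha]; simp
    rw [h2, add_zero] at h1
    exact ⟨(-2 : K) • a, by rw [lie_smul, ha, smul_zero], by rw [lie_smul, lie_smul, h1, neg_smul]⟩
  set h := ⁅n, y⁆ with hh
  have hhn : ⁅h, n⁆ = (2 : K) • n := by rw [← lie_skew, hy, neg_neg]
  have hsh : ⁅s, h⁆ = 0 := by rw [hh, leibniz_lie, hsn, hsy]; simp
  let U : Submodule K L := LinearMap.ker (ad K L n) ⊓ LinearMap.ker (ad K L s)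
  have hU (u : L) : u ∈ U ↔ ⁅n, u⁆ = 0 ∧ ⁅s, u⁆ = 0 := Iff.rfl
  have hmaps : ∀ u ∈ U, (ad K L h + (2 : K) • 1) u ∈ U := by
    intro u hu
    rw [hU] at hu
    change ⁅h, u⁆ + (2 : K) • u ∈ U
    refine U.add_mem ?_ (U.smul_mem _ hu)
    rw [hU, leibniz_lie, leibniz_lie s, hsh, hu.1, hu.2, hy, neg_lie, smul_lie]
    simp [hu.1]
  have hinj : Function.Injective (((ad K L h + (2 : K) • 1).restrict hmaps) : U →ₗ[K] U) := by
    rw [injective_iff_map_eq_zero]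
    rintro ⟨u, hu⟩ hu0
    have hu1 : ⁅h, u⁆ = -((2 : K) • u) := by
      have : ⁅h, u⁆ + (2 : K) • u = 0 := congrArg Subtype.val hu0
      exact eq_neg_of_add_eq_zero_left this
    have hHA : ad K L h * ad K L n = ad K L n * ad K L h + (2 : K) • ad K L n := by
      rw [ad_mul_ad, hhn, map_smul]
    have key : ∀ k : ℕ, ∃ w, u = (ad K L n ^ k) w := by
      intro k
      induction k with
      | zero => exact ⟨u, rfl⟩
      | succ k ih =>
        obtain ⟨w, hw⟩ := ih
        have h1 := LinearMap.congr_fun (pow_succ_mul_eq_of_sl2 (ad_mul_ad n y) hHA k) w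
        have h2 : (ad K L n ^ (k + 1)) w = 0 := by
          rw [pow_succ', Module.End.mul_apply, ← hw]; exact hu.1
        simp only [Module.End.mul_apply, LinearMap.add_apply, LinearMap.smul_apply,
          LinearMap.sub_apply, h2, map_zero, ← hw, ad_apply, zero_add] at h1
        rw [hu1] at h1
        have h3 : (-((k + 1 : K) * (k + 2)))⁻¹ • (ad K L n ^ (k + 1)) ⁅y, w⁆ = u := by
          rw [h1, inv_smul_eq_iff₀]
          · module
          · exact neg_ne_zero.2 (mul_ne_zero (by exact_mod_cast Nat.succ_ne_zero k)
              (by exact_mod_cast Nat.succ_ne_zero (k + 1)))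
        exact ⟨_, by rw [map_smul, h3]⟩
    obtain ⟨r, hr⟩ := hn
    obtain ⟨w, hw⟩ := key r
    rw [hr] at hw
    exact Subtype.ext hw
  have hsurj := LinearMap.surjective_of_injective hinj
  have hv : ⁅h, y⁆ + (2 : K) • y ∈ U := by
    rw [hU, lie_add, lie_add, leibniz_lie n, leibniz_lie s, hsh, hsy, hy,
      lie_smul, lie_smul, hsy, ← hh, neg_lie, smul_lie, ← hh]
    simp
  obtain ⟨⟨y', hy'⟩, hyy⟩ := hsurj ⟨_, hv⟩
  replace hyy : ⁅h, y'⁆ + (2 : K) • y' = ⁅h, y⁆ + (2 : K) • y := congrArg Subtype.val hyy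
  rw [hU] at hy'
  refine ⟨h, y - y', ?_, hhn, ?_, hsh, ?_⟩
  · rw [lie_sub, hy'.1, sub_zero]
  · rw [lie_sub, eq_sub_of_add_eq hyy]
    module
  · rw [lie_sub, hsy, hy'.2, sub_zero]
end

section
variable {K L : Type*} [Field K] [CharZero K] [LieRing L] [LieAlgebra K L]

theorem isNilpotent_of_mul_sub_mul_eq_smul {V : Type*} [AddCommGroup V] [Module K V]
    [FiniteDimensional K V] {A B : Module.End K V} {c : K} (hc : c ≠ 0)
    (h : A * B - B * A = c • B) : IsNilpotent B := by
  have hpow (k : ℕ) : A * B ^ k - B ^ k * A = (k * c : K) • B ^ k := by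
    induction k with
    | zero => simp
    | succ k ih =>
      have h1 : A * B ^ (k + 1) - B ^ (k + 1) * A =
          (A * B ^ k - B ^ k * A) * B + B ^ k * (A * B - B * A) := by
        rw [pow_succ]; noncomm_ring
      rw [h1, ih, h, smul_mul_assoc, mul_smul_comm, ← pow_succ, ← add_smul]
      push_cast
      ring_nf
  by_contra hB
  let T : Module.End K (Module.End K V) := LinearMap.mulLeft K A - LinearMap.mulRight K A
  have hT (k : ℕ) : T.HasEigenvector (k * c) (B ^ k) :=
    ⟨by rw [Module.End.mem_eigenspace_iff]; exact hpow k, fun h0 ↦ hB ⟨k, h0⟩⟩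
  have hli := Module.End.eigenvectors_linearIndependent' T (fun k : ℕ ↦ (k * c : K))
    (fun i j hij ↦ by simpa [hc] using hij) _ hT
  exact not_finite_iff_infinite.2 inferInstance hli.finite

/-- The exponential of an `ad`-nilpotent element, evaluated where it is quadratic. -/
theorem exists_lieEquiv_exp {x : L} (hx : IsNilpotent (ad K L x)) :
    ∃ g : L ≃ₗ⁅K⁆ L, ∀ v, ⁅x, ⁅x, ⁅x, v⁆⁆⁆ = 0 → g v = v + ⁅x, v⁆ + (2⁻¹ : K) • ⁅x, ⁅x, v⁆⁆ := by
  let _ : Module ℚ L := Module.compHom L (algebraMap ℚ K)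
  let _ : LieAlgebra ℚ L := { lie_smul := fun t y z ↦ lie_smul (algebraMap ℚ K t) y z }
  have hsm (q : ℚ) (v : L) : q • v = (q : K) • v := rfl
  have hx' : IsNilpotent (LieDerivation.inner K L L (-x)).toLinearMap := by
    convert hx using 1
    ext y
    simp
  obtain ⟨k, hk⟩ := id hx'
  refine ⟨LieDerivation.exp _ hx', fun v hv ↦ ?_⟩
  have hD (y : L) : (LieDerivation.inner K L L (-x)).toLinearMap y = ⁅x, y⁆ := by simp
  rw [LieDerivation.exp_map_apply, IsNilpotent.exp_eq_sum (k := 3 + k)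
    (by rw [pow_add, hk, mul_zero]), Finset.sum_range_add, LinearMap.add_apply,
    LinearMap.sum_apply, LinearMap.sum_apply, Finset.sum_eq_zero (s := Finset.range k), add_zero]
  · simp only [Finset.sum_range_succ, Finset.sum_range_zero, pow_succ, pow_zero, one_mul,
      LinearMap.smul_apply, Module.End.mul_apply, Module.End.one_apply, hD, hsm]
    norm_num
  · intro i _
    rw [add_comm 3, pow_add, LinearMap.smul_apply, Module.End.mul_apply]
    simp only [pow_succ, pow_zero, one_mul, Module.End.mul_apply, hD, hv, map_zero, smul_zero]

/-- The nontrivial element of the Weyl group of an `sl₂`-triple. -/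
theorem exists_lieEquiv_weyl {n h f : L} (hn : IsNilpotent (ad K L n))
    (hf : IsNilpotent (ad K L f)) (hnf : ⁅n, f⁆ = h) (hhn : ⁅h, n⁆ = (2 : K) • n)
    (hhf : ⁅h, f⁆ = -((2 : K) • f)) :
    ∃ w : L ≃ₗ⁅K⁆ L, w n = -f ∧ w h = -h ∧ ∀ s : L, ⁅s, n⁆ = 0 → ⁅s, f⁆ = 0 → w s = s := by
  obtain ⟨E, hE⟩ := exists_lieEquiv_exp hn
  obtain ⟨F, hF⟩ := exists_lieEquiv_exp (K := K) (x := -f) (by rw [map_neg]; exact hf.neg)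
  have hnh : ⁅n, h⁆ = -((2 : K) • n) := by rw [← lie_skew, hhn]
  have hfh : ⁅f, h⁆ = (2 : K) • f := by rw [← lie_skew, hhf, neg_neg]
  have hfn : ⁅f, n⁆ = -h := by rw [← lie_skew, hnf]
  have hEn : E n = n := by rw [hE] <;> simp
  have hFf : F f = f := by rw [hF] <;> simp
  have hEh : E h = h - (2 : K) • n := by rw [hE] <;> simp [hnh, sub_eq_add_neg]
  have hFh : F h = h - (2 : K) • f := by rw [hF] <;> simp [hfh, sub_eq_add_neg]
  have hEf : E f = f + h - n := by rw [hE] <;> simp [hnf, hnh, sub_eq_add_neg]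
  have hFn : F n = n + h - f := by rw [hF] <;> simp [hfn, hfh, sub_eq_add_neg]
  refine ⟨(E.trans F).trans E, ?_, ?_, fun s hsn hsf ↦ ?_⟩
  · simp only [LieEquiv.trans_apply, hEn, hFn, map_add, map_sub, hEh, hEf]
    module
  · simp only [LieEquiv.trans_apply, hEn, hFn, hFh, map_add, map_sub, map_smul, hEh, hEf]
    module
  · have hns : ⁅n, s⁆ = 0 := by rw [← lie_skew, hsn, neg_zero]
    have hfs : ⁅f, s⁆ = 0 := by rw [← lie_skew, hsf, neg_zero]
    have hEs : E s = s := by rw [hE] <;> simp [hns]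
    have hFs : F s = s := by rw [hF] <;> simp [hfs]
    simp only [LieEquiv.trans_apply, hEs, hFs]
end

section
variable {K L : Type*} [Field K] [CharZero K] [LieRing L] [LieAlgebra K L]
  [FiniteDimensional K L]

theorem exists_isCartanSubalgebra_mem_of_isSemisimple {s t : L} (hs : (ad K L s).IsSemisimple)
    (ht : (ad K L t).IsSemisimple) (hst : ⁅s, t⁆ = 0) :
    ∃ H : LieSubalgebra K L, H.IsCartanSubalgebra ∧ s ∈ H ∧ t ∈ H := by
  have hs0 : ∀ v : L, ⁅s, ⁅s, v⁆⁆ = 0 → ⁅s, v⁆ = 0 := fun v hv ↦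
    hs.apply_eq_zero_of_apply_apply_eq_zero hv
  have ht0 : ∀ v : L, ⁅t, ⁅t, v⁆⁆ = 0 → ⁅t, v⁆ = 0 := fun v hv ↦
    ht.apply_eq_zero_of_apply_apply_eq_zero hv
  let C : LieSubalgebra K L :=
    { LinearMap.ker (ad K L s) ⊓ LinearMap.ker (ad K L t) with
      lie_mem' := by
        rintro a b ⟨ha, ha'⟩ ⟨hb, hb'⟩
        replace ha : ⁅s, a⁆ = 0 := ha
        replace ha' : ⁅t, a⁆ = 0 := ha'
        replace hb : ⁅s, b⁆ = 0 := hb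
        replace hb' : ⁅t, b⁆ = 0 := hb'
        refine ⟨?_, ?_⟩
        · change ⁅s, ⁅a, b⁆⁆ = 0
          rw [leibniz_lie, ha, hb, zero_lie, lie_zero, add_zero]
        · change ⁅t, ⁅a, b⁆⁆ = 0
          rw [leibniz_lie, ha', hb', zero_lie, lie_zero, add_zero] }
  have hC (y : L) : y ∈ C ↔ ⁅s, y⁆ = 0 ∧ ⁅t, y⁆ = 0 := Iff.rfl
  have hts : ⁅t, s⁆ = 0 := by rw [← lie_skew, hst, neg_zero]
  obtain ⟨x, hx⟩ := LieAlgebra.exists_isCartanSubalgebra_engel K C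
  set H := LieSubalgebra.engel K x
  have hmem (y : L) (hyC : y ∈ C) (hy : ∀ z ∈ H, ⁅y, (z : L)⁆ = 0) : (⟨y, hyC⟩ : C) ∈ H := by
    rw [← hx.self_normalizing, LieSubalgebra.mem_normalizer_iff]
    intro z hz
    rw [show ⁅(⟨y, hyC⟩ : C), z⁆ = 0 from Subtype.ext (hy z hz)]
    exact H.zero_mem
  have hsC : s ∈ C := (hC s).2 ⟨lie_self s, hts⟩
  have htC : t ∈ C := (hC t).2 ⟨hst, lie_self t⟩
  have hsH : s ∈ H.map C.incl := ⟨⟨s, hsC⟩, hmem s hsC fun z _ ↦ ((hC z).1 z.2).1, rfl⟩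
  have htH : t ∈ H.map C.incl := ⟨⟨t, htC⟩, hmem t htC fun z _ ↦ ((hC z).1 z.2).2, rfl⟩
  have hHC (y : L) (hy : y ∈ H.map C.incl) : y ∈ C := by
    obtain ⟨z, -, rfl⟩ := hy
    exact z.2
  refine ⟨H.map C.incl, ⟨?_, ?_⟩, hsH, htH⟩
  · have := hx.nilpotent
    exact (LieSubalgebra.equivMapOfInjective C.incl H Subtype.val_injective).surjective
      |>.lieAlgebra_isNilpotent
  · refine le_antisymm (fun y hy ↦ ?_) (LieSubalgebra.le_normalizer _)
    rw [LieSubalgebra.mem_normalizer_iff'] at hy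
    have hyC : y ∈ C := (hC y).2 ⟨hs0 _ ((hC _).1 (hHC _ (hy s hsH))).1,
      ht0 _ ((hC _).1 (hHC _ (hy t htH))).2⟩
    refine ⟨⟨y, hyC⟩, ?_, rfl⟩
    change _ ∈ H
    rw [← hx.self_normalizing, LieSubalgebra.mem_normalizer_iff']
    intro z hz
    obtain ⟨z', hz', hzz⟩ := hy z ⟨z, hz, rfl⟩
    rwa [show ⁅z, (⟨y, hyC⟩ : C)⁆ = z' from Subtype.ext hzz.symm]
end

section
variable {K L : Type*} [Field K] [CharZero K] [LieRing L] [LieAlgebra K L]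
  [FiniteDimensional K L]

theorem exists_lie_eq_of_sl2 {s t e h f : L} (hst : ⁅s, t⁆ = 0) (hef : ⁅e, f⁆ = h)
    (hhe : ⁅h, e⁆ = (2 : K) • e) (hhf : ⁅h, f⁆ = -((2 : K) • f)) (hsh : ⁅s, h⁆ = 0)
    (hse : ⁅s, e⁆ = 0) (hsf : ⁅s, f⁆ = 0) (hth : ⁅t, h⁆ = 0) (hte : ⁅t, e⁆ = (2 : K) • e)
    (htf : ⁅t, f⁆ = -((2 : K) • f)) (he : IsNilpotent (ad K L e))
    (hht : IsNilpotent (ad K L (h - t))) {v : L} (hsv : ⁅s, v⁆ = 0) (htv : ⁅t, v⁆ = (2 : K) • v) :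
    ∃ y : L, ⁅s, y⁆ = 0 ∧ ⁅t, y⁆ = 0 ∧ ⁅y, e⁆ = v := by
  let V : Submodule K L := LinearMap.ker (ad K L s) ⊓ (ad K L t).eigenspace 2
  have hV (u : L) : u ∈ V ↔ ⁅s, u⁆ = 0 ∧ ⁅t, u⁆ = (2 : K) • u :=
    and_congr Iff.rfl Module.End.mem_eigenspace_iff
  have hf (u : L) (hu : u ∈ V) : ⁅s, ⁅f, u⁆⁆ = 0 ∧ ⁅t, ⁅f, u⁆⁆ = 0 := by
    rw [hV] at hu
    rw [leibniz_lie s, leibniz_lie t, hsf, htf, hu.1, hu.2]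
    simp
  have hmaps : ∀ u ∈ V, (ad K L e * ad K L f) u ∈ V := by
    intro u hu
    change ⁅e, ⁅f, u⁆⁆ ∈ V
    rw [hV, leibniz_lie s, leibniz_lie t, hse, hte, (hf u hu).1, (hf u hu).2]
    simp
  have hHA : ad K L h * ad K L e = ad K L e * ad K L h + (2 : K) • ad K L e := by
    rw [ad_mul_ad, hhe, map_smul]
  have hfix (u : L) (hu : u ∈ V) (hu0 : ⁅e, ⁅f, u⁆⁆ = 0) (hu1 : ⁅h - t, u⁆ = 0) : u = 0 := by
    have hu2 : ⁅h, u⁆ = (2 : K) • u := by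
      rw [← ((hV u).1 hu).2, ← sub_eq_zero, ← sub_lie, hu1]
    have key (k : ℕ) : (ad K L e ^ k) u = 0 → u = 0 := by
      induction k with
      | zero => exact id
      | succ k ih =>
        refine fun hk ↦ ih ?_
        have h1 := LinearMap.congr_fun (pow_succ_mul_eq_of_sl2 (ad_mul_ad e f) (hef.symm ▸ hHA) k) u
        have h2 := LinearMap.congr_fun (mul_pow_eq_of_sl2 hHA k) u
        rw [pow_succ, mul_assoc, Module.End.mul_apply, Module.End.mul_apply (ad K L e), ad_apply,
          ad_apply, hu0, map_zero, LinearMap.add_apply, Module.End.mul_apply (ad K L f), ← pow_succ,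
          hk, map_zero, zero_add, LinearMap.smul_apply, LinearMap.sub_apply, hef, h2,
          LinearMap.add_apply, Module.End.mul_apply, ad_apply, hu2, map_smul,
          LinearMap.smul_apply, LinearMap.smul_apply, ← add_smul, ← sub_smul, smul_smul,
          eq_comm, smul_eq_zero] at h1
        refine h1.resolve_left (mul_ne_zero (Nat.cast_add_one_ne_zero k) ?_)
        have : (2 + 2 * k - k : K) = ((k + 2 : ℕ) : K) := by push_cast; ring
        rw [this]
        exact Nat.cast_ne_zero.2 (by omega)
    obtain ⟨k, hk⟩ := he
    exact key k (by rw [hk, LinearMap.zero_apply])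
  have hinj : Function.Injective (((ad K L e * ad K L f).restrict hmaps) : V →ₗ[K] V) := by
    rw [injective_iff_map_eq_zero]
    rintro ⟨u, hu⟩ hu0
    replace hu0 : ⁅e, ⁅f, u⁆⁆ = 0 := congrArg Subtype.val hu0
    have hN (u : L) (hu : u ∈ V) (hu0 : ⁅e, ⁅f, u⁆⁆ = 0) :
        ⁅h - t, u⁆ ∈ V ∧ ⁅e, ⁅f, ⁅h - t, u⁆⁆⁆ = 0 := by
      rw [hV] at hu
      refine ⟨?_, ?_⟩
      · rw [hV, leibniz_lie s, leibniz_lie t, lie_sub, lie_sub, hsh, hth, hu.1, hu.2]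
        simp [hst]
      · rw [sub_lie, hu.2, lie_sub, lie_sub, lie_smul, lie_smul, hu0, smul_zero, sub_zero,
          leibniz_lie f, lie_add, leibniz_lie e h, hu0, ← lie_skew f h, ← lie_skew e h,
          hhe, hhf]
        simp [hu0]
    have key (k : ℕ) : ∀ u ∈ V, ⁅e, ⁅f, u⁆⁆ = 0 → (ad K L (h - t) ^ k) u = 0 → u = 0 := by
      induction k with
      | zero => exact fun u _ _ h0 ↦ h0
      | succ k ih =>
        intro u hu hu0 hk
        rw [pow_succ, Module.End.mul_apply] at hk
        exact hfix u hu hu0 (ih _ (hN u hu hu0).1 (hN u hu hu0).2 hk)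
    obtain ⟨k, hk⟩ := hht
    exact Subtype.ext (key k u hu hu0 (by rw [hk, LinearMap.zero_apply]))
  obtain ⟨⟨u, hu⟩, huv⟩ := LinearMap.surjective_of_injective hinj ⟨v, (hV v).2 ⟨hsv, htv⟩⟩
  replace huv : ⁅e, ⁅f, u⁆⁆ = v := congrArg Subtype.val huv
  refine ⟨-⁅f, u⁆, ?_, ?_, ?_⟩
  · rw [lie_neg, (hf u hu).1, neg_zero]
  · rw [lie_neg, (hf u hu).2, neg_zero]
  · rw [neg_lie, lie_skew, huv]
end

section
open Finset.HasAntidiagonal (antidiagonal)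
open Finset.Nat

variable {K L : Type*} [Field K] [CharZero K] [LieRing L] [LieAlgebra K L]

/-- The formal differential equation `u' = ⁅x, u⁆` on the coefficients of power series. -/
def IsFormalSolution (K : Type*) {L : Type*} [Field K] [LieRing L] [LieAlgebra K L]
    (x u : ℕ → L) : Prop :=
  ∀ k : ℕ, (k + 1 : K) • u (k + 1) = ∑ p ∈ antidiagonal k, ⁅x p.1, u p.2⁆

theorem sum_antidiagonal_assoc {M : Type*} [AddCommMonoid M] (F : ℕ → ℕ → ℕ → M) (k : ℕ) :
    ∑ p ∈ antidiagonal k, ∑ q ∈ antidiagonal p.1, F q.1 q.2 p.2 =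
      ∑ p ∈ antidiagonal k, ∑ q ∈ antidiagonal p.2, F p.1 q.1 q.2 := by
  rw [Finset.sum_sigma', Finset.sum_sigma']
  refine Finset.sum_nbij' (fun a ↦ ⟨(a.2.1, a.2.2 + a.1.2), (a.2.2, a.1.2)⟩)
    (fun a ↦ ⟨(a.1.1 + a.2.1, a.2.2), (a.1.1, a.2.1)⟩) ?_ ?_ ?_ ?_ ?_ <;>
    rintro ⟨⟨p, q⟩, ⟨a, b⟩⟩ h <;>
    simp only [Finset.mem_sigma, Finset.HasAntidiagonal.mem_antidiagonal] at h ⊢ <;>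
    obtain ⟨rfl, rfl⟩ := h <;> simp [add_assoc]

theorem sum_antidiagonal_left_comm {M : Type*} [AddCommMonoid M] (F : ℕ → ℕ → ℕ → M) (k : ℕ) :
    ∑ p ∈ antidiagonal k, ∑ q ∈ antidiagonal p.2, F p.1 q.1 q.2 =
      ∑ p ∈ antidiagonal k, ∑ q ∈ antidiagonal p.2, F q.1 p.1 q.2 := by
  rw [← sum_antidiagonal_assoc, ← sum_antidiagonal_assoc (fun a b c ↦ F b a c)]
  exact Finset.sum_congr rfl fun p _ ↦ (sum_antidiagonal_swap (f := fun q ↦ F q.1 q.2 p.2)).symm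

omit [CharZero K] in
theorem IsFormalSolution.lie {x u v : ℕ → L} (hu : IsFormalSolution K x u)
    (hv : IsFormalSolution K x v) :
    IsFormalSolution K x (fun k ↦ ∑ p ∈ antidiagonal k, ⁅u p.1, v p.2⁆) := by
  intro k
  have h1 : (k + 1 : K) • ∑ p ∈ antidiagonal (k + 1), ⁅u p.1, v p.2⁆ =
      ∑ p ∈ antidiagonal (k + 1), ⁅(p.1 : K) • u p.1, v p.2⁆ +
        ∑ p ∈ antidiagonal (k + 1), ⁅u p.1, (p.2 : K) • v p.2⁆ := by
    rw [Finset.smul_sum, ← Finset.sum_add_distrib]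
    refine Finset.sum_congr rfl fun p hp ↦ ?_
    rw [smul_lie, lie_smul, ← add_smul, ← Nat.cast_add,
      Finset.HasAntidiagonal.mem_antidiagonal.1 hp, Nat.cast_succ]
  rw [h1, sum_antidiagonal_succ, sum_antidiagonal_succ']
  simp only [Nat.cast_zero, zero_smul, zero_lie, lie_zero, zero_add, Nat.cast_succ]
  have h2 : ∑ p ∈ antidiagonal k, ⁅(p.1 + 1 : K) • u (p.1 + 1), v p.2⁆ =
      ∑ p ∈ antidiagonal k, ∑ q ∈ antidiagonal p.2, ⁅⁅x p.1, u q.1⁆, v q.2⁆ := by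
    rw [← sum_antidiagonal_assoc (fun a b c ↦ ⁅⁅x a, u b⁆, v c⁆)]
    exact Finset.sum_congr rfl fun p _ ↦ by rw [hu, sum_lie]
  have h3 : ∑ p ∈ antidiagonal k, ⁅u p.1, (p.2 + 1 : K) • v (p.2 + 1)⁆ =
      ∑ p ∈ antidiagonal k, ∑ q ∈ antidiagonal p.2, ⁅u q.1, ⁅x p.1, v q.2⁆⁆ := by
    rw [← sum_antidiagonal_left_comm (fun a b c ↦ ⁅u a, ⁅x b, v c⁆⁆)]
    exact Finset.sum_congr rfl fun p _ ↦ by rw [hv, lie_sum]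
  rw [h2, h3, ← Finset.sum_add_distrib]
  refine Finset.sum_congr rfl fun p _ ↦ ?_
  rw [lie_sum, ← Finset.sum_add_distrib]
  exact Finset.sum_congr rfl fun q _ ↦ (leibniz_lie _ _ _).symm

theorem IsFormalSolution.eq {x u v : ℕ → L} (hu : IsFormalSolution K x u)
    (hv : IsFormalSolution K x v) (h0 : u 0 = v 0) : u = v := by
  funext k
  induction k using Nat.strong_induction_on with
  | _ k ih =>
    cases k with
    | zero => exact h0
    | succ k =>
      refine smul_right_injective L (Nat.cast_add_one_ne_zero (R := K) k) ?_
      change (k + 1 : K) • u (k + 1) = (k + 1 : K) • v (k + 1)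
      rw [hu, hv]
      refine Finset.sum_congr rfl fun p hp ↦ ?_
      rw [ih p.2 (Nat.lt_succ_of_le (Finset.HasAntidiagonal.antidiagonal.snd_le hp))]

/-- The fundamental solution of a formal differential equation `u' = ⁅x, u⁆`. -/
noncomputable def formalFlow (K : Type*) {L : Type*} [Field K] [LieRing L] [LieAlgebra K L]
    (x : ℕ → L) : ℕ → Module.End K L
  | 0 => 1
  | k + 1 => (k + 1 : K)⁻¹ • ∑ p : Fin (k + 1), ad K L (x (k - p)) * formalFlow K x p

theorem isFormalSolution_formalFlow (x : ℕ → L) (y : L) :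
    IsFormalSolution K x (fun k ↦ formalFlow K x k y) := by
  intro k
  simp only [formalFlow]
  rw [LinearMap.smul_apply, smul_inv_smul₀ (Nat.cast_add_one_ne_zero k),
    Finset.sum_range (fun p ↦ ad K L (x (k - p)) * formalFlow K x p) |>.symm,
    ← sum_antidiagonal_swap, sum_antidiagonal_eq_sum_range_succ_mk, LinearMap.sum_apply]
  rfl

theorem formalFlow_lie (x : ℕ → L) (y z : L) (k : ℕ) :
    formalFlow K x k ⁅y, z⁆ =
      ∑ p ∈ antidiagonal k, ⁅formalFlow K x p.1 y, formalFlow K x p.2 z⁆ :=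
  congrFun ((isFormalSolution_formalFlow x ⁅y, z⁆).eq
    ((isFormalSolution_formalFlow x y).lie (isFormalSolution_formalFlow x z))
    (by simp [formalFlow])) k

theorem exists_formal_automorphism {Z : Set L} {V : Submodule K L} {n w : L}
    (hV : ∀ y : L, (∀ z ∈ Z, ⁅y, z⁆ = 0) → ∀ v ∈ V, ⁅y, v⁆ ∈ V)
    (hn : ∀ v ∈ V, ∃ y : L, (∀ z ∈ Z, ⁅y, z⁆ = 0) ∧ ⁅y, n⁆ = v) (hw : w ∈ V) :
    ∃ G : ℕ → Module.End K L,
      (∀ k y z, G k ⁅y, z⁆ = ∑ p ∈ antidiagonal k, ⁅G p.1 y, G p.2 z⁆) ∧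
      (∀ z ∈ Z, ∀ k, G k z = if k = 0 then z else 0) ∧
      ∀ k, G k n = if k = 0 then n else if k = 1 then w else 0 := by
  choose! σ hσ hσn using hn
  let x : ℕ → L := fun k ↦ Nat.rec (σ w) (fun _ a ↦ -σ ⁅a, w⁆) k
  have hx (k : ℕ) : ∀ z ∈ Z, ⁅x k, z⁆ = 0 := by
    induction k with
    | zero => exact hσ w hw
    | succ k ih =>
      intro z hz
      change ⁅-σ ⁅x k, w⁆, z⁆ = 0
      rw [neg_lie, hσ _ (hV _ ih w hw) z hz, neg_zero]
  have hx1 (k : ℕ) : ⁅x (k + 1), n⁆ + ⁅x k, w⁆ = 0 := by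
    change ⁅-σ ⁅x k, w⁆, n⁆ + _ = 0
    rw [neg_lie, hσn _ (hV _ (hx k) w hw), neg_add_cancel]
  refine ⟨formalFlow K x, fun k y z ↦ formalFlow_lie x y z k, fun z hz k ↦ ?_, fun k ↦ ?_⟩
  · refine congrFun ((isFormalSolution_formalFlow x z).eq
      (v := fun k ↦ if k = 0 then z else 0) (fun k ↦ ?_) (by simp [formalFlow])) k
    rw [Finset.sum_eq_zero]
    · simp
    · intro p _
      dsimp only
      split_ifs
      · exact hx _ z hz
      · exact lie_zero _
  · refine congrFun ((isFormalSolution_formalFlow x n).eq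
      (v := fun k ↦ if k = 0 then n else if k = 1 then w else 0) (fun k ↦ ?_)
      (by simp [formalFlow])) k
    cases k with
    | zero => simp [x, hσn w hw]
    | succ k =>
      rw [sum_antidiagonal_succ']
      cases k with
      | zero =>
        simp [hx1]
      | succ k =>
        rw [sum_antidiagonal_succ', Finset.sum_eq_zero]
        · simpa using (hx1 (k + 1)).symm
        · simp
end

section
universe u

open Polynomial PowerSeries TensorProduct

theorem nonempty_algHom_of_finiteType (K S : Type*) [Field K] [IsAlgClosed K] [CommRing S]
    [Nontrivial S] [Algebra K S] [Algebra.FiniteType K S] : Nonempty (S →ₐ[K] K) := by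
  obtain ⟨m, hm⟩ := Ideal.exists_maximal S
  let _ := Ideal.Quotient.field m
  have := finite_of_finite_type_of_isJacobsonRing K (S ⧸ m)
  exact ⟨(AlgEquiv.ofBijective (Algebra.ofId K (S ⧸ m))
    IsAlgClosed.algebraMap_bijective_of_isIntegral).symm.toAlgHom.comp (Ideal.Quotient.mkₐ K m)⟩

theorem exists_algHom_comp_eq {K A B B' : Type u} [CommRing K] [CommRing A] [CommRing B]
    [CommRing B'] [IsDomain B] [IsDomain B'] [Algebra K A] [Algebra K B] [Algebra K B']
    (i : A →ₐ[K] B) (i' : A →ₐ[K] B') (hi : Function.Injective i) (hi' : Function.Injective i') :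
    ∃ (R : Type u) (_ : CommRing R) (_ : Algebra K R) (_ : Nontrivial R) (f : B →ₐ[K] R)
      (f' : B' →ₐ[K] R), ∀ a, f (i a) = f' (i' a) := by
  let _ := i.toRingHom.toAlgebra
  let _ := i'.toRingHom.toAlgebra
  have : IsScalarTower K A B := .of_algebraMap_eq fun x ↦ (i.commutes x).symm
  have : IsScalarTower K A B' := .of_algebraMap_eq fun x ↦ (i'.commutes x).symm
  refine ⟨B ⊗[A] B', inferInstance, inferInstance,
    Algebra.TensorProduct.nontrivial_of_algebraMap_injective_of_isDomain A B B' hi hi',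
    Algebra.TensorProduct.includeLeft, (Algebra.TensorProduct.includeRight).restrictScalars K,
    fun a ↦ ?_⟩
  exact (Algebra.TensorProduct.includeLeft : B →ₐ[A] B ⊗[A] B').commutes a |>.trans
    ((Algebra.TensorProduct.includeRight : B' →ₐ[A] B ⊗[A] B').commutes a).symm

variable {K L : Type*} [Field K] [LieRing L] [LieAlgebra K L] {ι : Type*} [Fintype ι]

/-- The linear maps `L → R ^ ι` that are Lie algebra homomorphisms `L → R ⊗ L` after identifying
`R ⊗ L` with `R ^ ι` using the basis `b`. -/
def IsLiePoint (b : Basis ι K L) {R : Type*} [CommRing R] [Algebra K R] (φ : L →ₗ[K] (ι → R)) :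
    Prop :=
  ∀ y z l, φ ⁅y, z⁆ l = ∑ p, ∑ q, b.repr ⁅b p, b q⁆ l • (φ y p * φ z q)

theorem Module.Basis.repr_lie (b : Basis ι K L) (y z : L) (l : ι) :
    b.repr ⁅y, z⁆ l = ∑ p, ∑ q, b.repr ⁅b p, b q⁆ l * (b.repr y p * b.repr z q) := by
  conv_lhs => rw [← b.sum_repr y, ← b.sum_repr z]
  simp only [sum_lie, lie_sum, smul_lie, lie_smul, map_sum, map_smul, Finsupp.coe_finsetSum,
    Finset.sum_apply, Finsupp.smul_apply, smul_eq_mul, Finset.mul_sum]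
  exact Finset.sum_comm.trans <|
    Finset.sum_congr rfl fun p _ ↦ Finset.sum_congr rfl fun q _ ↦ by ring

theorem IsLiePoint.comp {b : Basis ι K L} {R R' : Type*} [CommRing R] [Algebra K R] [CommRing R']
    [Algebra K R'] {φ : L →ₗ[K] (ι → R)} (hφ : IsLiePoint b φ) (f : R →ₐ[K] R') :
    IsLiePoint b (f.toLinearMap.compLeft ι ∘ₗ φ) := fun y z l ↦ by
  simp [hφ y z l]

theorem IsLiePoint.exists_lieHom {b : Basis ι K L} {φ : L →ₗ[K] (ι → K)} (hφ : IsLiePoint b φ) :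
    ∃ g : L →ₗ⁅K⁆ L, ∀ y l, b.repr (g y) l = φ y l := by
  have h (y : L) (l : ι) : b.repr (b.equivFun.symm (φ y)) l = φ y l :=
    congrFun (b.equivFun.apply_symm_apply (φ y)) l
  refine ⟨{ b.equivFun.symm.toLinearMap ∘ₗ φ with map_lie' := fun {y z} ↦ ?_ }, h⟩
  refine b.ext_elem fun l ↦ ?_
  change b.repr (b.equivFun.symm (φ ⁅y, z⁆)) l =
    b.repr ⁅b.equivFun.symm (φ y), b.equivFun.symm (φ z)⁆ l
  rw [h, b.repr_lie, hφ]
  simp only [h, smul_eq_mul]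

/-- A common specialization to `K` of two points with values in a nontrivial `K`-algebra. -/
theorem IsLiePoint.exists_lieHom_of_nontrivial [IsAlgClosed K] {b : Basis ι K L} {R : Type*}
    [CommRing R] [Algebra K R] [Nontrivial R] {φ φ' : L →ₗ[K] (ι → R)} (hφ : IsLiePoint b φ)
    (hφ' : IsLiePoint b φ') :
    ∃ g g' : L →ₗ⁅K⁆ L, (∀ y z, φ y = φ' z → g y = g' z) ∧
      (∀ z, (∀ l, φ z l = algebraMap K R (b.repr z l)) → g z = z) ∧
      ∀ z, (∀ l, φ' z l = algebraMap K R (b.repr z l)) → g' z = z := by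
  classical
  let T : Finset R := Finset.univ.image (fun p : ι × ι ↦ φ (b p.1) p.2) ∪
    Finset.univ.image (fun p : ι × ι ↦ φ' (b p.1) p.2)
  let S := Algebra.adjoin K (T : Set R)
  have hfin : Algebra.FiniteType K S := S.fg_iff_finiteType.1 (Subalgebra.fg_adjoin_finset T)
  obtain ⟨f⟩ := nonempty_algHom_of_finiteType K S
  have hmem (χ : L →ₗ[K] (ι → R)) (hχ : ∀ i l, χ (b i) l ∈ S) (y : L) (l : ι) : χ y l ∈ S := by
    rw [← b.sum_repr y, map_sum, Finset.sum_apply]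
    refine S.sum_mem fun i _ ↦ ?_
    rw [map_smul, Pi.smul_apply]
    exact S.smul_mem (hχ i l) _
  have key (χ : L →ₗ[K] (ι → R)) (hχ : ∀ y l, χ y l ∈ S) (hχp : IsLiePoint b χ) :
      ∃ g : L →ₗ⁅K⁆ L, ∀ y l, b.repr (g y) l = f ⟨χ y l, hχ y l⟩ := by
    let χ' : L →ₗ[K] (ι → S) :=
      { toFun := fun y l ↦ ⟨χ y l, hχ y l⟩
        map_add' := fun y z ↦ by ext; simp
        map_smul' := fun c y ↦ by ext; simp }
    have hχ' : IsLiePoint b χ' := fun y z l ↦ Subtype.ext (by simpa [χ'] using hχp y z l)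
    exact (hχ'.comp f).exists_lieHom
  have hS : ∀ y l, φ y l ∈ S := hmem φ fun i l ↦ Algebra.subset_adjoin (by simp [T])
  have hS' : ∀ y l, φ' y l ∈ S := hmem φ' fun i l ↦ Algebra.subset_adjoin (by simp [T])
  obtain ⟨g, hg⟩ := key φ hS hφ
  obtain ⟨g', hg'⟩ := key φ' hS' hφ'
  refine ⟨g, g', fun y z h ↦ b.ext_elem fun l ↦ ?_, fun z hz ↦ b.ext_elem fun l ↦ ?_,
    fun z hz ↦ b.ext_elem fun l ↦ ?_⟩
  · rw [hg, hg']
    simp only [h]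
  · rw [hg]
    simp only [hz]
    exact f.commutes _
  · rw [hg']
    simp only [hz]
    exact f.commutes _

end

section
open Polynomial PowerSeries Finset.HasAntidiagonal

variable {K L : Type*} [Field K] [LieRing L] [LieAlgebra K L] {ι : Type*} [Fintype ι]

/-- The point with values in power series attached to a sequence of endomorphisms. -/
noncomputable def powerSeriesPoint (b : Basis ι K L) (G : ℕ → Module.End K L) :
    L →ₗ[K] (ι → K⟦X⟧) where
  toFun y l := PowerSeries.mk fun k ↦ b.repr (G k y) l
  map_add' y z := by ext; simp
  map_smul' c y := by ext; simp

theorem isLiePoint_powerSeriesPoint (b : Basis ι K L) {G : ℕ → Module.End K L}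
    (hG : ∀ k y z, G k ⁅y, z⁆ = ∑ p ∈ antidiagonal k, ⁅G p.1 y, G p.2 z⁆) :
    IsLiePoint b (powerSeriesPoint b G) := fun y z l ↦ by
  ext k
  change PowerSeries.coeff k (PowerSeries.mk fun m ↦ b.repr (G m ⁅y, z⁆) l) = _
  rw [coeff_mk, hG, map_sum, Finsupp.finsetSum_apply, map_sum,
    Finset.sum_congr rfl fun m _ ↦ b.repr_lie _ _ l, Finset.sum_comm]
  refine Finset.sum_congr rfl fun p _ ↦ ?_
  rw [map_sum, Finset.sum_comm]
  refine Finset.sum_congr rfl fun q _ ↦ ?_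
  rw [map_smul, PowerSeries.coeff_mul, smul_eq_mul, Finset.mul_sum]
  simp [powerSeriesPoint]

omit [Fintype ι] in
theorem powerSeriesPoint_apply_eq_C (b : Basis ι K L) {G : ℕ → Module.End K L} {z : L}
    (hz : ∀ k, G k z = if k = 0 then z else 0) (l : ι) :
    powerSeriesPoint b G z l = algebraMap K K⟦X⟧ (b.repr z l) := by
  ext k
  simp only [powerSeriesPoint, LinearMap.coe_mk, AddHom.coe_mk, coeff_mk, hz,
    PowerSeries.algebraMap_apply, Algebra.algebraMap_self, RingHom.id_apply, PowerSeries.coeff_C]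
  split_ifs <;> simp

omit [Fintype ι] in
theorem powerSeriesPoint_apply_eq_coe (b : Basis ι K L) {G : ℕ → Module.End K L} {n w : L}
    (hn : ∀ k, G k n = if k = 0 then n else if k = 1 then w else 0) (l : ι) :
    powerSeriesPoint b G n l =
      (((Polynomial.C (b.repr n l) + Polynomial.C (b.repr w l) * Polynomial.X : K[X])) : K⟦X⟧) := by
  ext k
  simp only [powerSeriesPoint, LinearMap.coe_mk, AddHom.coe_mk, coeff_mk, hn, Polynomial.coeff_coe,
    Polynomial.coeff_add, Polynomial.coeff_C, Polynomial.coeff_C_mul, Polynomial.coeff_X]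
  rcases k with _ | _ | k <;> simp

theorem injective_of_apply_eq_self [LieAlgebra.IsSimple K L] {g : L →ₗ⁅K⁆ L} {z : L} (hz : z ≠ 0)
    (hgz : g z = z) : Function.Injective g := by
  rw [← g.ker_eq_bot]
  refine (LieAlgebra.IsSimple.eq_bot_or_eq_top (R := K) g.ker).resolve_right fun h ↦ hz ?_
  rw [← hgz, ← LieHom.mem_ker, h]
  exact LieSubmodule.mem_top z

/-- Let the centralizer `C` of `Z` act on `V`. Two elements `n` of `V` with `⁅C, n⁆ = V` are
conjugate by an automorphism fixing `Z`. -/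
theorem exists_lieEquiv_apply_eq [IsAlgClosed K] [CharZero K] [FiniteDimensional K L]
    [LieAlgebra.IsSimple K L] {Z : Set L} {V : Submodule K L} {n n' : L}
    (hV : ∀ y : L, (∀ z ∈ Z, ⁅y, z⁆ = 0) → ∀ v ∈ V, ⁅y, v⁆ ∈ V)
    (hn : ∀ v ∈ V, ∃ y : L, (∀ z ∈ Z, ⁅y, z⁆ = 0) ∧ ⁅y, n⁆ = v)
    (hn' : ∀ v ∈ V, ∃ y : L, (∀ z ∈ Z, ⁅y, z⁆ = 0) ∧ ⁅y, n'⁆ = v)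
    (hnV : n ∈ V) (hnV' : n' ∈ V) (hZ : ∃ z ∈ Z, z ≠ 0) :
    ∃ g : L ≃ₗ⁅K⁆ L, (∀ z ∈ Z, g z = z) ∧ g n = n' := by
  obtain ⟨z₀, hz₀, hz₀'⟩ := hZ
  let b := Module.finBasis K L
  obtain ⟨G, hG, hGZ, hGn⟩ := exists_formal_automorphism hV hn (V.sub_mem hnV' hnV)
  obtain ⟨G', hG', hGZ', hGn'⟩ := exists_formal_automorphism hV hn' (V.sub_mem hnV hnV')
  let i : K[X] →ₐ[K] K⟦X⟧ := Polynomial.coeToPowerSeries.algHom K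
  let r : K[X] →ₐ[K] K[X] := Polynomial.aeval (1 - Polynomial.X)
  have hr (p : K[X]) : r (r p) = p := by
    have : r.comp r = AlgHom.id K K[X] := by ext; simp [r]
    exact DFunLike.congr_fun this p
  have hi : Function.Injective i := fun p q h ↦ by
    simpa [i, Polynomial.coeToPowerSeries.algHom_apply] using h
  obtain ⟨R, _, _, _, f, f', hf⟩ := exists_algHom_comp_eq (i.comp r) i
    (hi.comp (Function.LeftInverse.injective hr)) hi
  have hsymm (p : K[X]) : f (i p) = f' (i (r p)) := by simpa [hr] using hf (r p)
  obtain ⟨g, g', hgg', hg, hg'⟩ := IsLiePoint.exists_lieHom_of_nontrivial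
    ((isLiePoint_powerSeriesPoint b hG).comp f) ((isLiePoint_powerSeriesPoint b hG').comp f')
  have hi_apply (p : K[X]) : i p = (p : K⟦X⟧) := by
    simp [i, Polynomial.coeToPowerSeries.algHom_apply]
  have hgZ (z) (hz : z ∈ Z) : g z = z := hg z fun l ↦ by
    simp only [LinearMap.comp_apply, LinearMap.compLeft_apply, Function.comp_apply,
      AlgHom.toLinearMap_apply, powerSeriesPoint_apply_eq_C b (hGZ z hz), f.commutes]
  have hgZ' (z) (hz : z ∈ Z) : g' z = z := hg' z fun l ↦ by
    simp only [LinearMap.comp_apply, LinearMap.compLeft_apply, Function.comp_apply,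
      AlgHom.toLinearMap_apply, powerSeriesPoint_apply_eq_C b (hGZ' z hz), f'.commutes]
  have hgn : g n = g' n' := hgg' n n' <| by
    ext l
    simp only [LinearMap.comp_apply, LinearMap.compLeft_apply, Function.comp_apply,
      AlgHom.toLinearMap_apply, powerSeriesPoint_apply_eq_coe b hGn,
      powerSeriesPoint_apply_eq_coe b hGn', ← hi_apply]
    rw [hsymm]
    congr 2
    simp [r]
    ring
  have hbij {g : L →ₗ⁅K⁆ L} (hg : ∀ z ∈ Z, g z = z) : Function.Bijective g :=
    have h := injective_of_apply_eq_self hz₀' (hg z₀ hz₀)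
    ⟨h, LinearMap.injective_iff_surjective (f := (g : L →ₗ[K] L)).1 h⟩
  let e := LieEquiv.ofBijective g (hbij hgZ)
  let e' := LieEquiv.ofBijective g' (hbij hgZ')
  have he (y : L) : e y = g y := rfl
  have he' (y : L) : e' y = g' y := rfl
  refine ⟨e.trans e'.symm, fun z hz ↦ ?_, ?_⟩
  · rw [LieEquiv.trans_apply, he, hgZ z hz]
    conv_lhs => rw [← hgZ' z hz, ← he', e'.symm_apply_apply]
  · rw [LieEquiv.trans_apply, he, hgn, ← he', e'.symm_apply_apply]

end

section
variable {K L : Type*} [Field K] [LieRing L] [LieAlgebra K L]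

theorem isNilpotent_ad_apply (e : L ≃ₗ⁅K⁆ L) {x : L} (hx : IsNilpotent (ad K L x)) :
    IsNilpotent (ad K L (e x)) := by
  rw [← conj_ad_apply]
  exact hx.map (e.toLinearEquiv.conjAlgEquiv K)

variable [IsAlgClosed K] [CharZero K] [FiniteDimensional K L] [LieAlgebra.IsSimple K L]

/-- Every element of a simple Lie algebra is conjugate to its negative. -/
theorem exists_lieEquiv_apply_eq_neg (x : L) : ∃ a : L ≃ₗ⁅K⁆ L, a x = -x := by
  obtain ⟨s, n, rfl, hsn, hs, hn, -⟩ := exists_jordan_decomposition (K := K) x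
  rcases eq_or_ne n 0 with rfl | hn0
  · obtain ⟨H, _, hsH, -⟩ := exists_isCartanSubalgebra_mem_of_isSemisimple hs hs (lie_self s)
    obtain ⟨c, hc⟩ := exists_lieEquiv_eq_neg_of_isCartanSubalgebra H
    exact ⟨c, by rw [add_zero, hc s hsH]⟩
  obtain ⟨h, f, hnf, hhn, hhf, hsh, hsf⟩ := exists_sl2_of_isNilpotent_ad hs hn hsn
  obtain ⟨t, m, hhtm, htm, ht, hm, hht⟩ := exists_jordan_decomposition (K := K) h
  have hhm : h - t = m := sub_eq_of_eq_add' hhtm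
  have htn : ⁅t, n⁆ = (2 : K) • n := hht _ _ hhn
  have htf : ⁅t, f⁆ = -((2 : K) • f) := by
    rw [hht (-2) f (by rw [hhf, neg_smul]), neg_smul]
  have hts : ⁅t, s⁆ = 0 := by
    rw [hht 0 s (by rw [← lie_skew, hsh, neg_zero, zero_smul]), zero_smul]
  have hst : ⁅s, t⁆ = 0 := by rw [← lie_skew, hts, neg_zero]
  have hth : ⁅t, h⁆ = 0 := by rw [hhtm, lie_add, lie_self, htm, add_zero]
  have ht0 : t ≠ 0 := by
    rintro rfl
    rw [zero_lie] at htn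
    exact hn0 ((smul_eq_zero.1 htn.symm).resolve_left two_ne_zero)
  have hmn : IsNilpotent (ad K L (h - t)) := by rwa [hhm]
  have hf : IsNilpotent (ad K L f) := by
    refine isNilpotent_of_mul_sub_mul_eq_smul (c := (-2 : K)) (by norm_num) (A := ad K L t) ?_
    rw [ad_mul_ad, add_sub_cancel_left, htf, ← neg_smul, map_smul]
  obtain ⟨H, _, hsH, htH⟩ := exists_isCartanSubalgebra_mem_of_isSemisimple hs ht hst
  obtain ⟨c, hc⟩ := exists_lieEquiv_eq_neg_of_isCartanSubalgebra H
  obtain ⟨w, hwn, -, hw⟩ := exists_lieEquiv_weyl hn hf hnf hhn hhf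
  have hws : w s = s := hw s hsn hsf
  have hcs : c s = -s := hc s hsH
  have hct : c t = -t := hc t htH
  have hsc {y : L} (hy : ⁅s, y⁆ = 0) : ⁅s, c y⁆ = 0 := by
    rw [← neg_neg s, ← hcs, neg_lie, ← LieEquiv.map_lie, hy, map_zero, neg_zero]
  have htc {y : L} {k : K} (hy : ⁅t, y⁆ = k • y) : ⁅t, c y⁆ = -(k • c y) := by
    rw [← neg_neg t, ← hct, neg_lie, ← LieEquiv.map_lie, hy, map_smul]
  have htcf : ⁅t, c f⁆ = (2 : K) • c f := by
    rw [htc (k := -2) (by rw [htf, neg_smul]), neg_smul, neg_neg]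
  let V : Submodule K L :=
    LinearMap.ker (ad K L s) ⊓ LinearMap.ker (ad K L t - (2 : K) • LinearMap.id)
  have hV {v : L} : v ∈ V ↔ ⁅s, v⁆ = 0 ∧ ⁅t, v⁆ = (2 : K) • v := by
    simp [V, sub_eq_zero]
  have hZV (y : L) (hy : ∀ z ∈ ({s, t} : Set L), ⁅y, z⁆ = 0) (v : L) (hv : v ∈ V) : ⁅y, v⁆ ∈ V := by
    obtain ⟨hsv, htv⟩ := hV.1 hv
    have hys : ⁅s, y⁆ = 0 := by rw [← lie_skew, hy s (by simp), neg_zero]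
    have hyt : ⁅t, y⁆ = 0 := by rw [← lie_skew, hy t (by simp), neg_zero]
    refine hV.2 ⟨?_, ?_⟩
    · rw [leibniz_lie, hys, hsv, zero_lie, lie_zero, add_zero]
    · rw [leibniz_lie, hyt, htv, zero_lie, lie_smul, zero_add]
  have hcf (v : L) (hv : v ∈ V) :
      ∃ y : L, (∀ z ∈ ({s, t} : Set L), ⁅y, z⁆ = 0) ∧ ⁅y, c f⁆ = v := by
    obtain ⟨hsv, htv⟩ := hV.1 hv
    obtain ⟨y, hsy, hty, hy⟩ := exists_lie_eq_of_sl2 (e := c f) (f := c n) (h := -c h) hst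
      (by rw [← LieEquiv.map_lie, ← lie_skew, hnf, map_neg])
      (by rw [neg_lie, ← LieEquiv.map_lie, hhf, map_neg, map_smul, neg_neg])
      (by rw [neg_lie, ← LieEquiv.map_lie, hhn, map_smul])
      (by rw [lie_neg, hsc hsh, neg_zero]) (hsc hsf) (hsc hsn)
      (by rw [lie_neg, htc (k := 0) (by rw [hth, zero_smul]), zero_smul, neg_zero, neg_zero])
      htcf (htc htn) (isNilpotent_ad_apply c hf)
      (by
        rw [show -c h - t = c (-(h - t)) by rw [map_neg, map_sub, hct]; abel]
        exact isNilpotent_ad_apply c (by rw [map_neg]; exact hmn.neg))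
      hsv htv
    exact ⟨y, by simp [← lie_skew y s, ← lie_skew y t, hsy, hty], hy⟩
  have hn' (v : L) (hv : v ∈ V) :
      ∃ y : L, (∀ z ∈ ({s, t} : Set L), ⁅y, z⁆ = 0) ∧ ⁅y, n⁆ = v := by
    obtain ⟨hsv, htv⟩ := hV.1 hv
    obtain ⟨y, hsy, hty, hy⟩ := exists_lie_eq_of_sl2 hst hnf hhn hhf hsh hsn hsf hth htn htf hn hmn
      hsv htv
    exact ⟨y, by simp [← lie_skew y s, ← lie_skew y t, hsy, hty], hy⟩
  obtain ⟨g, hgZ, hg⟩ := exists_lieEquiv_apply_eq hZV hcf hn' (hV.2 ⟨hsc hsf, htcf⟩)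
    (hV.2 ⟨hsn, htn⟩) ⟨t, by simp, ht0⟩
  refine ⟨(w.trans c).trans g, ?_⟩
  rw [LieEquiv.trans_apply, LieEquiv.trans_apply, map_add, map_add, map_add, hws, hwn, hcs,
    map_neg, map_neg, map_neg, hg, hgZ s (by simp), neg_add]

end

end

theorem antiautomorphism_isLocalAutomorphism
    (K L : Type*) [Field K] [IsAlgClosed K] [CharZero K]
    [LieRing L] [LieAlgebra K L] [FiniteDimensional K L] [LieAlgebra.IsSimple K L]
    (σ : L →ₗ[K] L) (hbij : Function.Bijective σ)
    (hanti : ∀ x y : L, σ ⁅x, y⁆ = ⁅σ y, σ x⁆) :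
    IsLocalAutomorphism K L σ := by
  intro x
  let τ : L →ₗ⁅K⁆ L :=
    { -σ with
      map_lie' := fun {y z} ↦ by
        change -σ ⁅y, z⁆ = ⁅-σ y, -σ z⁆
        rw [hanti, neg_lie, lie_neg, neg_neg, lie_skew] }
  have hτ (y : L) : τ y = -σ y := rfl
  have hτbij : Function.Bijective τ := (Equiv.neg L).bijective.comp hbij
  obtain ⟨a, ha⟩ := exists_lieEquiv_apply_eq_neg (K := K) (τ x)
  refine ⟨(LieEquiv.ofBijective τ hτbij).trans a, ?_⟩
  rw [LieEquiv.trans_apply]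
  change σ x = a (τ x)
  rw [ha, hτ, neg_neg]
end

section
/- Let g be a finite-dimensional simple Lie algebra over an algebraically closed field K of characteristic 0, and let φ : g → g be a local automorphism. Then φ maps the set N of nilpotent elements of g onto N, and the set S of semisimple elements of g onto S; i.e. φ(N) = N and φ(S) = S. -/
theorem LieEquiv.isNilpotent_ad_apply_iff {R L L' : Type*} [CommRing R] [LieRing L]
    [LieAlgebra R L] [LieRing L'] [LieAlgebra R L'] (e : L ≃ₗ⁅R⁆ L') (x : L) :
    IsNilpotent (LieAlgebra.ad R L' (e x)) ↔ IsNilpotent (LieAlgebra.ad R L x) := by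
  rw [← LieAlgebra.conj_ad_apply]
  exact IsNilpotent.map_iff (f := e.toLinearEquiv.conjAlgEquiv R) (AlgEquiv.injective _)

theorem LieEquiv.isSemisimple_ad_apply_iff {R L L' : Type*} [CommRing R] [LieRing L]
    [LieAlgebra R L] [LieRing L'] [LieAlgebra R L'] (e : L ≃ₗ⁅R⁆ L') (x : L) :
    (LieAlgebra.ad R L' (e x)).IsSemisimple ↔ (LieAlgebra.ad R L x).IsSemisimple := by
  refine (LinearEquiv.isSemisimple_iff _ _ e.toLinearEquiv ?_).symm
  ext y
  simp [LieEquiv.map_lie]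

namespace IsLocalAutomorphism

variable {K L : Type*} [Field K] [LieRing L] [LieAlgebra K L] {φ : L →ₗ[K] L}

theorem injective (hφ : IsLocalAutomorphism K L φ) : Function.Injective φ := by
  refine (injective_iff_map_eq_zero φ).2 fun x hx => ?_
  obtain ⟨e, he⟩ := hφ x
  rwa [he, EmbeddingLike.map_eq_zero_iff] at hx

theorem surjective [FiniteDimensional K L] (hφ : IsLocalAutomorphism K L φ) :
    Function.Surjective φ :=
  LinearMap.injective_iff_surjective.1 hφ.injective

/-- A local automorphism maps every automorphism-invariant subset onto itself. -/
theorem image_eq_of_invariant [FiniteDimensional K L] (hφ : IsLocalAutomorphism K L φ)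
    {p : L → Prop} (hp : ∀ (e : L ≃ₗ⁅K⁆ L) (x : L), p (e x) ↔ p x) :
    φ '' {x | p x} = {x | p x} := by
  have hpre : {x | p x} = φ ⁻¹' {x | p x} := by
    ext x
    obtain ⟨e, he⟩ := hφ x
    simp [he, hp]
  conv_lhs => rw [hpre]
  exact Set.image_preimage_eq _ hφ.surjective

end IsLocalAutomorphism

theorem localAutomorphism_preserves_nilpotent_and_semisimple
    (K L : Type*) [Field K] [IsAlgClosed K] [CharZero K]
    [LieRing L] [LieAlgebra K L] [FiniteDimensional K L] [LieAlgebra.IsSimple K L]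
    (φ : L →ₗ[K] L) (hφ : IsLocalAutomorphism K L φ) :
    φ '' {x : L | IsNilpotent (LieAlgebra.ad K L x)} =
      {x : L | IsNilpotent (LieAlgebra.ad K L x)} ∧
    φ '' {x : L | (LieAlgebra.ad K L x).IsSemisimple} =
      {x : L | (LieAlgebra.ad K L x).IsSemisimple} :=
  ⟨hφ.image_eq_of_invariant LieEquiv.isNilpotent_ad_apply_iff,
    hφ.image_eq_of_invariant LieEquiv.isSemisimple_ad_apply_iff⟩
end
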